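/- arXiv:1410.7524 — 8 statements merged into one kernel-verified Lean document; each statement's English description precedes it below -/
import Mathlib

section
/- Let n ≡ 0 (mod 6) with n > 30, and let 𝒞 be a finite collection of maximal proper subgroups of S_n (coatoms in the subgroup lattice) whose union is all of S_n and whose cardinality equals the covering number σ(S_n). Then 𝒞 is exactly the collection 𝓗, i.e., 𝒞 consists precisely of: the alternating group A_n; the stabilizer {g : g(s) = s or g(s) = sᶜ} of the partition {s, sᶜ} for every subset s of Fin n of size n/2; and the setwise stabilizer {g : g(s) = s} for every subset s of Fin n with 1 ≤ |s| ≤ n/3 − 1. -/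
open Pointwise

/-- The covering number `σ(G)`: the least size of a finite collection of proper
subgroups of `G` whose set-theoretic union is all of `G`. -/
noncomputable def coveringNumber (G : Type*) [Group G] : ℕ :=
  sInf {k : ℕ | ∃ 𝒞 : Finset (Subgroup G), 𝒞.card = k ∧ (∀ H ∈ 𝒞, H ≠ ⊤) ∧
    ∀ g : G, ∃ H ∈ 𝒞, g ∈ H}

lemma perm_smul_compl {n : ℕ} (g : Equiv.Perm (Fin n)) (s : Finset (Fin n)) :
    g • sᶜ = (g • s)ᶜ := by
  ext x
  simp [← Finset.inv_smul_mem_iff, Finset.mem_compl]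

/-- The stabilizer of the partition `{s, sᶜ}`: all permutations `g` with
`g • s = s` or `g • s = sᶜ`.  For `|s| = n/2` this is isomorphic to `S_{n/2} ≀ S_2`. -/
def partitionStabilizer {n : ℕ} (s : Finset (Fin n)) : Subgroup (Equiv.Perm (Fin n)) where
  carrier := {g | g • s = s ∨ g • s = sᶜ}
  one_mem' := Or.inl (one_smul _ _)
  mul_mem' := by
    rintro a b (ha | ha) (hb | hb) <;>
      simp only [Set.mem_setOf_eq, mul_smul, hb, ha, perm_smul_compl, compl_compl] <;> tauto
  inv_mem' := by
    rintro a (ha | ha) <;> simp only [Set.mem_setOf_eq] at *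
    · left; rw [inv_smul_eq_iff]; exact ha.symm
    · right; rw [inv_smul_eq_iff, perm_smul_compl, ha, compl_compl]

/-! ### Numerical estimates -/

open Nat in
lemma choose_le_choose_of_le_half {n i j : ℕ} (hij : i ≤ j) (hj : 2 * j ≤ n) :
    n.choose i ≤ n.choose j := by
  induction j, hij using Nat.le_induction with
  | base => exact le_rfl
  | succ k _ ih =>
    exact (ih (by omega)).trans (Nat.choose_le_succ_of_lt_half_left (by omega))

lemma sum_choose_mul_le (n i : ℕ) (hi : 2 * i ≤ n) :
    (n - 2 * i + 1) * ∑ j ∈ Finset.range i, n.choose j ≤ i * n.choose i := by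
  induction i with
  | zero => simp
  | succ i ih =>
    have ih := ih (by omega)
    rw [Finset.sum_range_succ, mul_comm (i + 1), Nat.choose_succ_right_eq]
    obtain ⟨d, rfl⟩ : ∃ d, n = 2 * (i + 1) + d := ⟨n - 2 * (i + 1), by omega⟩
    generalize (2 * (i + 1) + d).choose i = c at *
    generalize ∑ j ∈ Finset.range i, (2 * (i + 1) + d).choose j = s at *
    rw [show 2 * (i + 1) + d - 2 * i + 1 = d + 3 by omega] at ih
    rw [show 2 * (i + 1) + d - 2 * (i + 1) + 1 = d + 1 by omega,
      show 2 * (i + 1) + d - i = i + d + 2 by omega]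
    refine Nat.le_of_mul_le_mul_left (c := d + 3) ?_ (by omega)
    nlinarith [Nat.mul_le_mul_left (d + 1) ih, Nat.zero_le c]

lemma sum_choose_lt (a : ℕ) (ha : 0 < a) :
    ∑ j ∈ Finset.range a, (3 * a).choose j < (3 * a).choose a := by
  have h := sum_choose_mul_le (3 * a) a (by omega)
  rw [show 3 * a - 2 * a + 1 = a + 1 by omega] at h
  have hc : 0 < (3 * a).choose a := Nat.choose_pos (by omega)
  nlinarith

lemma two_mul_sum_choose_lt (a : ℕ) (ha : 0 < a) :
    2 * ∑ j ∈ Finset.range a, (3 * a).choose j < (3 * a).choose (a + 1) := by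
  obtain ⟨a, rfl⟩ : ∃ b, a = b + 1 := ⟨a - 1, by omega⟩
  have h := sum_choose_mul_le (3 * (a + 1)) a (by omega)
  have h1 := Nat.choose_succ_right_eq (3 * (a + 1)) a
  have h2 := Nat.choose_succ_right_eq (3 * (a + 1)) (a + 1)
  have hc : 0 < (3 * (a + 1)).choose a := Nat.choose_pos (by omega)
  rw [Finset.sum_range_succ]
  generalize (3 * (a + 1)).choose a = c at *
  generalize (3 * (a + 1)).choose (a + 1) = c1 at *
  generalize (3 * (a + 1)).choose (a + 1 + 1) = c2 at *
  generalize ∑ j ∈ Finset.range a, (3 * (a + 1)).choose j = s at *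
  rw [show 3 * (a + 1) - 2 * a + 1 = a + 4 by omega] at h
  rw [show 3 * (a + 1) - a = 2 * a + 3 by omega] at h1
  rw [show 3 * (a + 1) - (a + 1) = 2 * (a + 1) by omega] at h2
  have h3 : c2 * (a + 2) = 2 * (c * (2 * a + 3)) := by rw [← h1, h2]; ring
  refine Nat.lt_of_mul_lt_mul_left (a := (a + 2) * (a + 4)) ?_
  calc (a + 2) * (a + 4) * (2 * (s + c))
      = 2 * (a + 2) * ((a + 4) * s) + 2 * (a + 2) * (a + 4) * c := by ring
    _ ≤ 2 * (a + 2) * (a * c) + 2 * (a + 2) * (a + 4) * c := by gcongr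
    _ < (a + 4) * (2 * (c * (2 * a + 3))) := by nlinarith
    _ = (a + 2) * (a + 4) * c2 := by rw [← h3]; ring

lemma cube_lt_choose (a : ℕ) (ha : 12 ≤ a) : 6 * (3 * a) ^ 3 < (2 * a).choose a := by
  rw [← Nat.centralBinom]
  induction a, ha using Nat.le_induction with
  | base => decide +kernel
  | succ a ha ih =>
    have h := Nat.succ_mul_centralBinom_succ a
    refine Nat.lt_of_mul_lt_mul_left (a := a + 1) ?_
    rw [h]
    have : (a + 1) * (6 * (3 * (a + 1)) ^ 3) ≤ 2 * (2 * a + 1) * (6 * (3 * a) ^ 3) := by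
      obtain ⟨d, rfl⟩ := Nat.exists_eq_add_of_le ha
      ring_nf
      nlinarith [Nat.zero_le d, Nat.zero_le (d ^ 2), Nat.zero_le (d ^ 3), Nat.zero_le (d ^ 4)]
    refine this.trans_lt ?_
    gcongr

open Nat in
lemma three_blocks_choose_lt (a : ℕ) (ha : 12 ≤ a) :
    a ! ^ 3 * 3 ! * ((3 * a) ^ 3 * (3 * a).choose a) < (3 * a)! := by
  have h1 := Nat.choose_mul_factorial_mul_factorial (show a ≤ 3 * a by omega)
  have h2 := Nat.choose_mul_factorial_mul_factorial (show a ≤ 2 * a by omega)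
  rw [show 3 * a - a = 2 * a by omega] at h1
  rw [show 2 * a - a = a by omega] at h2
  have hc : 0 < (3 * a).choose a := Nat.choose_pos (by omega)
  have hp := Nat.factorial_pos a
  rw [← h1, ← h2, show 3 ! = 6 from rfl]
  calc _ = (3 * a).choose a * a ! * (6 * (3 * a) ^ 3 * a ! * a !) := by ring
    _ < _ := by
      have := cube_lt_choose a ha
      gcongr

open Nat in
lemma three_blocks_two_pow_lt (a : ℕ) (ha : 12 ≤ a) :
    a ! ^ 3 * 3 ! * (3 * a * 2 ^ (3 * a)) < (3 * a)! := by
  induction a, ha using Nat.le_induction with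
  | base => decide +kernel
  | succ a ha ih =>
    rw [show 3 * (a + 1) = 3 * a + 1 + 1 + 1 by ring, Nat.factorial_succ (3 * a + 1 + 1),
      Nat.factorial_succ (3 * a + 1), Nat.factorial_succ (3 * a), Nat.factorial_succ a]
    calc ((a + 1) * a !) ^ 3 * 3 ! * ((3 * a + 1 + 1 + 1) * 2 ^ (3 * a + 1 + 1 + 1))
        = 8 * (a + 1) ^ 3 * (a ! ^ 3 * 3 ! * ((3 * a + 3) * 2 ^ (3 * a))) := by ring
      _ ≤ 8 * (a + 1) ^ 3 * (a ! ^ 3 * 3 ! * ((2 * (3 * a)) * 2 ^ (3 * a))) := by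
          gcongr; omega
      _ = 16 * (a + 1) ^ 3 * (a ! ^ 3 * 3 ! * ((3 * a) * 2 ^ (3 * a))) := by ring
      _ < 16 * (a + 1) ^ 3 * (3 * a)! := by gcongr
      _ ≤ ((3 * a + 1 + 1 + 1) * ((3 * a + 1 + 1) * (3 * a + 1))) * (3 * a)! := by
          refine Nat.mul_le_mul_right _ ?_
          nlinarith [Nat.zero_le (a ^ 2), Nat.zero_le (a ^ 3)]
      _ = _ := by ring

lemma cube_mul_two_pow_lt_three_pow (n : ℕ) (hn : 36 ≤ n) : n ^ 3 * 2 ^ n < 3 ^ n := by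
  induction n, hn using Nat.le_induction with
  | base => norm_num
  | succ n hn ih =>
    have : 2 * (n + 1) ^ 3 ≤ 3 * n ^ 3 := by
      obtain ⟨d, rfl⟩ := Nat.exists_eq_add_of_le hn
      ring_nf
      nlinarith [Nat.zero_le d, Nat.zero_le (d ^ 2), Nat.zero_le (d ^ 3)]
    calc (n + 1) ^ 3 * 2 ^ (n + 1) = 2 * (n + 1) ^ 3 * 2 ^ n := by ring
      _ ≤ 3 * n ^ 3 * 2 ^ n := by gcongr
      _ = 3 * (n ^ 3 * 2 ^ n) := by ring
      _ < 3 * 3 ^ n := by gcongr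
      _ = _ := by ring

open Nat in
lemma cube_mul_two_pow_lt_factorial (m : ℕ) (hm : 18 ≤ m) :
    (2 * m) ^ 3 * 2 ^ (2 * m) < m ! := by
  induction m, hm using Nat.le_induction with
  | base => decide +kernel
  | succ m hm ih =>
    have : (2 * (m + 1)) ^ 3 ≤ 2 * (2 * m) ^ 3 := by
      obtain ⟨d, rfl⟩ := Nat.exists_eq_add_of_le hm
      ring_nf
      nlinarith [Nat.zero_le d, Nat.zero_le (d ^ 2), Nat.zero_le (d ^ 3)]
    calc (2 * (m + 1)) ^ 3 * 2 ^ (2 * (m + 1)) = (2 * (m + 1)) ^ 3 * 4 * 2 ^ (2 * m) := by ring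
      _ ≤ 2 * (2 * m) ^ 3 * 4 * 2 ^ (2 * m) := by gcongr
      _ = 8 * ((2 * m) ^ 3 * 2 ^ (2 * m)) := by ring
      _ < 8 * m ! := by gcongr
      _ ≤ (m + 1) * m ! := by gcongr; omega
      _ = _ := (Nat.factorial_succ m).symm

open Nat in
lemma four_blocks_le (m : ℕ) (hm : 9 ≤ m) : m ! ^ 4 * 4 ! * 3 ^ (m * 4) ≤ (m * 4)! := by
  induction m, hm using Nat.le_induction with
  | base => decide +kernel
  | succ m hm ih =>
    rw [show (m + 1) * 4 = m * 4 + 1 + 1 + 1 + 1 by ring, Nat.factorial_succ (m * 4 + 1 + 1 + 1),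
      Nat.factorial_succ (m * 4 + 1 + 1), Nat.factorial_succ (m * 4 + 1),
      Nat.factorial_succ (m * 4), Nat.factorial_succ m]
    calc ((m + 1) * m !) ^ 4 * 4 ! * 3 ^ (m * 4 + 1 + 1 + 1 + 1)
        = 81 * (m + 1) ^ 4 * (m ! ^ 4 * 4 ! * 3 ^ (m * 4)) := by ring
      _ ≤ 81 * (m + 1) ^ 4 * (m * 4)! := by gcongr
      _ ≤ ((m * 4 + 1 + 1 + 1 + 1) * ((m * 4 + 1 + 1 + 1) * ((m * 4 + 1 + 1) * (m * 4 + 1)))) *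
          (m * 4)! := by
          refine Nat.mul_le_mul_right _ ?_
          obtain ⟨d, rfl⟩ := Nat.exists_eq_add_of_le hm
          ring_nf
          nlinarith [Nat.zero_le d, Nat.zero_le (d ^ 2), Nat.zero_le (d ^ 3), Nat.zero_le (d ^ 4)]
      _ = _ := by ring

open Nat in
lemma factorial_mul_three_pow_mul_factorial_le (N j : ℕ) (hN : 8 ≤ N) (hj : 1 ≤ j)
    (hjN : 2 * j ≤ N) : j ! * 3 ^ (j + 1) * N ! ≤ (N + j)! := by
  induction j, hj using Nat.le_induction with
  | base =>
    rw [Nat.factorial_succ N, Nat.factorial_one]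
    gcongr
    omega
  | succ j hj ih =>
    rw [← add_assoc, Nat.factorial_succ (N + j), Nat.factorial_succ j]
    calc (j + 1) * j ! * 3 ^ (j + 1 + 1) * N ! = 3 * (j + 1) * (j ! * 3 ^ (j + 1) * N !) := by
          ring
      _ ≤ (N + j + 1) * (N + j)! := Nat.mul_le_mul (by omega) (ih (by omega))

open Nat in
lemma many_blocks_succ_le (m k : ℕ) (hm : 2 ≤ m) (hk : 4 ≤ k)
    (h : m ! ^ k * k ! * 3 ^ (m * k) ≤ (m * k)!) :
    m ! ^ (k + 1) * (k + 1)! * 3 ^ (m * (k + 1)) ≤ (m * (k + 1))! := by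
  have h1 := factorial_mul_three_pow_mul_factorial_le (m * k) (m - 1) (by nlinarith) (by omega)
    (by have := Nat.mul_le_mul_left m hk; omega)
  rw [show m - 1 + 1 = m by omega] at h1
  have h2 : (m * (k + 1))! = m * (k + 1) * (m * k + (m - 1))! := by
    rw [show m * (k + 1) = m * k + (m - 1) + 1 by rw [mul_add]; omega, Nat.factorial_succ]
  have h3 : m ! = m * (m - 1)! := (Nat.mul_factorial_pred (by omega)).symm
  rw [h2]
  calc m ! ^ (k + 1) * (k + 1)! * 3 ^ (m * (k + 1))
      = (m ! * 3 ^ m * (k + 1)) * (m ! ^ k * k ! * 3 ^ (m * k)) := by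
        rw [Nat.factorial_succ k]; ring
    _ ≤ (m ! * 3 ^ m * (k + 1)) * (m * k)! := by gcongr
    _ = m * (k + 1) * ((m - 1)! * 3 ^ m * (m * k)!) := by rw [h3]; ring
    _ ≤ _ := by gcongr

open Nat in
lemma many_blocks_le (m k : ℕ) (hm : 2 ≤ m) (hk : 4 ≤ k) (hmk : 36 ≤ m * k) :
    m ! ^ k * k ! * 3 ^ (m * k) ≤ (m * k)! := by
  have step : ∀ k₀ : ℕ, 4 ≤ k₀ → m ! ^ k₀ * k₀ ! * 3 ^ (m * k₀) ≤ (m * k₀)! → k₀ ≤ k →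
      m ! ^ k * k ! * 3 ^ (m * k) ≤ (m * k)! := by
    intro k₀ hk₀ h₀ hle
    clear hmk hk
    induction k, hle using Nat.le_induction with
    | base => exact h₀
    | succ k hk ih => exact many_blocks_succ_le m k hm (by omega) ih
  by_cases h9 : 9 ≤ m
  · exact step 4 le_rfl (four_blocks_le m h9) hk
  · interval_cases m
    · exact step 18 (by norm_num) (by decide +kernel) (by omega)
    · exact step 12 (by norm_num) (by decide +kernel) (by omega)
    · exact step 9 (by norm_num) (by decide +kernel) (by omega)
    · exact step 8 (by norm_num) (by decide +kernel) (by omega)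
    · exact step 6 (by norm_num) (by decide +kernel) (by omega)
    · exact step 6 (by norm_num) (by decide +kernel) (by omega)
    · exact step 5 (by norm_num) (by decide +kernel) (by omega)

/-! ### Orders of transitive groups -/

open Equiv Equiv.Perm in
lemma isThreeCycle_commutator {α : Type*} [Fintype α] [DecidableEq α] {x y : Perm α} {p : α}
    (hx : x p ≠ p) (hy : y p ≠ p) (hxy : ∀ q, x q ≠ q → y q ≠ q → q = p) :
    (x * y * x⁻¹ * y⁻¹).IsThreeCycle := by
  have apply_inv_self : ∀ (e : Perm α) z, e (e⁻¹ z) = z := fun e => e.apply_symm_apply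
  have inv_apply_self : ∀ (e : Perm α) z, e⁻¹ (e z) = z := fun e => e.symm_apply_apply
  have hyx : ∀ q, x q ≠ q → q ≠ p → y q = q := fun q h h' => by
    by_contra h''; exact h' (hxy q h h'')
  have hxy' : ∀ q, y q ≠ q → q ≠ p → x q = q := fun q h h' => by
    by_contra h''; exact h' (hxy q h'' h)
  have hyxp : y (x p) = x p := hyx _ (fun h => hx (x.injective h)) hx
  have hxyp : x (y p) = y p := hxy' _ (fun h => hy (y.injective h)) hy
  have hne : x p ≠ y p := fun h => hy (y.injective (by rw [← h, hyxp]))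
  have hx' : x⁻¹ p ≠ p := fun h => hx (by rw [inv_eq_iff_eq] at h; exact h.symm)
  have hy' : y⁻¹ p ≠ p := fun h => hy (by rw [inv_eq_iff_eq] at h; exact h.symm)
  rw [← card_support_eq_three_iff]
  have h1 : (x * y * x⁻¹ * y⁻¹) p = x p := by
    have : x⁻¹ (y⁻¹ p) = y⁻¹ p := by
      rw [inv_eq_iff_eq]
      exact (hxy' _ (by simpa using hy'.symm) hy').symm
    simp only [mul_apply, this, apply_inv_self]
  have h2 : (x * y * x⁻¹ * y⁻¹) (x p) = y p := by
    have : y⁻¹ (x p) = x p := by rw [inv_eq_iff_eq, hyxp]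
    simp [mul_apply, this, hxyp]
  have h3 : (x * y * x⁻¹ * y⁻¹) (y p) = p := by
    have : y (x⁻¹ p) = x⁻¹ p := hyx _ (by simpa using hx'.symm) hx'
    rw [mul_apply, mul_apply, mul_apply, inv_apply_self, this, apply_inv_self]
  have h4 : ∀ z, z ≠ p → z ≠ x p → z ≠ y p → (x * y * x⁻¹ * y⁻¹) z = z := by
    intro z hz hzx hzy
    have e1 : x⁻¹ z ≠ p := fun h => hzx (by rw [← h]; simp)
    have e2 : y⁻¹ z ≠ p := fun h => hzy (by rw [← h]; simp)
    by_cases hyz : y z = z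
    · have e3 : y⁻¹ z = z := by rw [inv_eq_iff_eq, hyz]
      have e4 : y (x⁻¹ z) = x⁻¹ z := by
        by_cases hxz : x z = z
        · rw [show x⁻¹ z = z by rw [inv_eq_iff_eq, hxz], hyz]
        · refine hyx _ (fun h => hxz ?_) e1
          have h := congrArg x h
          simpa using h
      rw [mul_apply, mul_apply, mul_apply, e3, e4, apply_inv_self]
    · have e3 : x⁻¹ (y⁻¹ z) = y⁻¹ z := by
        rw [inv_eq_iff_eq]
        refine (hxy' _ (fun h => hyz ?_) e2).symm
        have h := congrArg y h
        simpa using h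
      rw [mul_apply, mul_apply, mul_apply, e3, apply_inv_self, hxy' z hyz hz]
  have hs : (x * y * x⁻¹ * y⁻¹).support = {p, x p, y p} := by
    ext z
    rw [mem_support]
    simp only [Finset.mem_insert, Finset.mem_singleton]
    constructor
    · intro h
      by_contra! h'
      exact h (h4 z h'.1 h'.2.1 h'.2.2)
    · rintro (rfl | rfl | rfl)
      · rw [h1]; exact hx
      · rw [h2]; exact hne.symm
      · rw [h3]; exact hy.symm
  rw [hs, Finset.card_eq_three]
  exact ⟨p, x p, y p, hx.symm, hy.symm, hne, rfl⟩

open Equiv Equiv.Perm in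
open scoped Nat in
/-- Bochert's bound. -/
lemma card_mul_factorial_le_of_isPreprimitive {n : ℕ} (M : Subgroup (Perm (Fin n)))
    (hM : MulAction.IsPreprimitive M (Fin n)) (hA : ¬ alternatingGroup (Fin n) ≤ M) :
    Nat.card M * (n - n / 2)! ≤ n ! := by
  classical
  let base : Finset (Fin n) → Prop := fun Δ => ∀ g ∈ M, (∀ x ∈ Δ, g x = x) → g = 1
  have hbase : ∃ k, ∃ Δ, base Δ ∧ Δ.card = k :=
    ⟨_, Finset.univ, fun g _ h => Equiv.ext fun x => h x (Finset.mem_univ x), rfl⟩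
  obtain ⟨Δ, hΔ, hcard⟩ := Nat.find_spec hbase
  have hmin : ∀ Δ', base Δ' → Δ.card ≤ Δ'.card := fun Δ' h => by
    rw [hcard]; exact Nat.find_min' hbase ⟨Δ', h, rfl⟩
  have hle : Δ.card ≤ n / 2 := by
    by_contra! hlt
    have h1 : ¬ base Δᶜ := fun h => by
      have := hmin _ h
      rw [Finset.card_compl, Fintype.card_fin] at this
      omega
    simp only [base] at h1
    push Not at h1
    obtain ⟨x, hxM, hx, hx1⟩ := h1
    obtain ⟨p, hp⟩ : ∃ p, x p ≠ p := by
      by_contra! h; exact hx1 (Equiv.ext h)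
    have hpΔ : p ∈ Δ := by
      by_contra h; exact hp (hx p (Finset.mem_compl.2 h))
    have h2 : ¬ base (Δ.erase p) := fun h =>
      (Finset.card_erase_lt_of_mem hpΔ).not_ge (hmin _ h)
    simp only [base] at h2
    push Not at h2
    obtain ⟨y, hyM, hy, hy1⟩ := h2
    have hyp : y p ≠ p := fun h => hy1 <| hΔ y hyM fun q hq => by
      by_cases hqp : q = p
      · rw [hqp, h]
      · exact hy q (Finset.mem_erase.2 ⟨hqp, hq⟩)
    refine hA (alternatingGroup_le_of_isPreprimitive_of_isThreeCycle_mem hM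
      (isThreeCycle_commutator hp hyp fun q hq hq' => ?_)
      (M.mul_mem (M.mul_mem (M.mul_mem hxM hyM) (M.inv_mem hxM)) (M.inv_mem hyM)))
    by_contra hqp
    refine hq' (hy q (Finset.mem_erase.2 ⟨hqp, ?_⟩))
    by_contra h
    exact hq (hx q (Finset.mem_compl.2 h))
  have hemb : Nat.card M ≤ Nat.card (Δ ↪ Fin n) := by
    refine Nat.card_le_card_of_injective
      (fun g : M => (Function.Embedding.subtype (· ∈ Δ)).trans g.1.toEmbedding) fun g h hgh => ?_
    have : h⁻¹ * g = 1 := by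
      refine Subtype.ext (hΔ _ (h⁻¹ * g).2 fun x hx => ?_)
      have := DFunLike.congr_fun hgh ⟨x, hx⟩
      simp only [Function.Embedding.trans_apply, Function.Embedding.coe_subtype,
        Equiv.coe_toEmbedding] at this
      simp [mul_apply, this]
    exact (inv_mul_eq_one.1 this).symm
  rw [Nat.card_eq_fintype_card (α := Δ ↪ Fin n), Fintype.card_embedding_eq, Fintype.card_fin,
    Fintype.card_coe] at hemb
  calc Nat.card M * (n - n / 2)! ≤ n.descFactorial Δ.card * (n - Δ.card)! := by gcongr
    _ = n ! := by rw [mul_comm, Nat.factorial_mul_descFactorial (by omega)]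

open Equiv Equiv.Perm in
open scoped Nat in
lemma card_le_of_isBlock {n : ℕ} (M : Subgroup (Perm (Fin n)))
    [MulAction.IsPretransitive M (Fin n)] {B : Set (Fin n)} (hB : MulAction.IsBlock M B)
    (hne : B.Nonempty) :
    Nat.card M ≤ B.ncard ! ^ (MulAction.orbit M B).ncard * (MulAction.orbit M B).ncard ! := by
  classical
  set O := MulAction.orbit M B
  have hpart : ∀ x, ∃! C : Set (Fin n), C ∈ O ∧ x ∈ C := by
    have := (hB.isBlockSystem hne).1.2
    intro x
    exact this x
  choose f hf hfu using hpart
  let F : Fin n → O := fun x => ⟨f x, (hf x).1⟩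
  have hF : ∀ (x : Fin n) (C : O), F x = C ↔ x ∈ (C : Set (Fin n)) := fun x C =>
    ⟨fun h => h ▸ (hf x).2, fun h => Subtype.ext (hfu x C ⟨C.2, h⟩).symm⟩
  let ρ := MulAction.toPermHom M O
  have hcard : Nat.card M = Nat.card ρ.ker * Nat.card ρ.range := by
    rw [← Subgroup.card_mul_index ρ.ker, Subgroup.index_ker]
  have hrange : Nat.card ρ.range ≤ O.ncard ! := by
    refine (Nat.card_le_card_of_injective _ Subtype.val_injective).trans ?_
    rw [Nat.card_perm, Nat.card_coe_set_eq]
  have hker : Nat.card ρ.ker ≤ B.ncard ! ^ O.ncard := by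
    have h1 : Nat.card ρ.ker ≤ Nat.card {g : Perm (Fin n) // F ∘ g = F} := by
      refine Nat.card_le_card_of_injective (fun g => ⟨g.1.1, ?_⟩) fun g h hgh => ?_
      · funext x
        simp only [Function.comp_apply]
        rw [hF]
        have h := DFunLike.congr_fun (MonoidHom.mem_ker.1 g.2) (F x)
        have h : g.1 • F x = F x := h
        rw [← h]
        exact Set.smul_mem_smul_set (a := g.1) (hf x).2
      · exact Subtype.ext (Subtype.ext (congrArg (fun g => g.1) hgh))
    refine h1.trans ?_
    have : Fintype O := Fintype.ofFinite _
    rw [Nat.card_eq_fintype_card, DomMulAct.stabilizer_card]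
    have : ∀ C : O, Fintype.card {x // F x = C} = B.ncard := by
      intro C
      obtain ⟨g, hg⟩ := C.2
      rw [← Nat.card_eq_fintype_card,
        Nat.card_congr (Equiv.subtypeEquivRight fun x => hF x C)]
      change Nat.card (C : Set (Fin n)) = _
      rw [Nat.card_coe_set_eq, ← hg]
      exact Set.ncard_smul_set g B
    simp only [this, Finset.prod_const, Finset.card_univ]
    rw [← Nat.card_eq_fintype_card, Nat.card_coe_set_eq]
  rw [hcard]
  exact Nat.mul_le_mul hker hrange

section Permutations

open Equiv Equiv.Perm

/-! ### Invariant sets of permutations and cycles -/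


lemma mem_of_sameCycle_of_smul_eq {α : Type*} [DecidableEq α] {σ : Perm α} {t : Finset α}
    (ht : σ • t = t) {x y : α} (h : σ.SameCycle x y) (hx : x ∈ t) : y ∈ t := by
  obtain ⟨k, rfl⟩ := h
  have hk : σ ^ k ∈ MulAction.stabilizer (Perm α) t :=
    Subgroup.zpow_mem _ (MulAction.mem_stabilizer_iff.2 ht) k
  rw [← MulAction.mem_stabilizer_iff.1 hk]
  exact Finset.smul_mem_smul_finset hx

lemma subset_or_disjoint_of_isCycleOn {α : Type*} [DecidableEq α] {σ : Perm α} {c t : Finset α}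
    (hc : σ.IsCycleOn c) (ht : σ • t = t) : c ⊆ t ∨ Disjoint c t := by
  by_cases h : Disjoint c t
  · exact Or.inr h
  · obtain ⟨x, hxc, hxt⟩ := Finset.not_disjoint_iff.1 h
    exact Or.inl fun y hy => mem_of_sameCycle_of_smul_eq ht (hc.2 hxc hy) hxt

lemma smul_eq_of_isCycleOn {α : Type*} [DecidableEq α] {σ : Perm α} {c : Finset α}
    (hc : σ.IsCycleOn c) : σ • c = c := by
  refine Finset.coe_injective ?_
  rw [Finset.coe_smul_finset]
  exact hc.1.image_eq

lemma even_card_of_isCycleOn {α : Type*} [Fintype α] [DecidableEq α] {σ : Perm α}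
    {c t : Finset α} (hc : σ.IsCycleOn c) (ht : σ • t = tᶜ) : Even c.card := by
  have h : (c ∩ t).card = (c ∩ tᶜ).card := by
    rw [← Finset.card_smul_finset σ (c ∩ t), Finset.smul_finset_inter, ht,
      smul_eq_of_isCycleOn hc]
  rw [← Finset.sdiff_eq_inter_compl] at h
  rw [← Finset.card_inter_add_card_sdiff c t, ← h]
  exact ⟨_, rfl⟩

lemma isCycleOn_congr {α : Type*} {f g : Perm α} {c : Finset α} (hf : f.IsCycleOn c)
    (h : ∀ x ∈ c, f x = g x) : g.IsCycleOn c := by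
  refine ⟨hf.1.congr h, fun x hx y hy => ?_⟩
  obtain ⟨k, -, rfl⟩ := hf.exists_pow_eq hx hy
  have key : ∀ k : ℕ, (f ^ k) x ∈ c ∧ (g ^ k) x = (f ^ k) x := by
    intro k
    induction k with
    | zero => exact ⟨hx, rfl⟩
    | succ k ih =>
      rw [pow_succ', pow_succ', mul_apply, mul_apply, ih.2]
      exact ⟨hf.1.mapsTo ih.1, (h _ ih.1).symm⟩
  rw [← (key k).2]
  exact sameCycle_pow_right.2 (SameCycle.refl _ _)

lemma sign_of_isCycleOn {α : Type*} [Fintype α] [DecidableEq α] {f : Perm α} {c : Finset α}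
    (hf : f.IsCycleOn c) (hs : f.support ⊆ c) (hc : c.Nonempty) :
    sign f = -(-1) ^ c.card := by
  by_cases hn : (c : Set α).Nontrivial
  · have hcyc : f.IsCycle := isCycle_iff_exists_isCycleOn.2
      ⟨c, hn, hf, fun x hx => hs (mem_support.2 hx)⟩
    rw [hcyc.sign]
    congr 3
    exact hs.antisymm fun x hx => mem_support.2 (hf.apply_ne hn hx)
  · obtain ⟨x, hx⟩ := hc
    have hx1 : c = {x} := by
      refine Finset.coe_injective ?_
      rw [Finset.coe_singleton]
      exact (Set.not_nontrivial_iff.1 hn).eq_singleton_of_mem hx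
    subst hx1
    have : f = 1 := by
      rw [← card_support_le_one]
      exact (Finset.card_le_card hs).trans (by simp)
    simp [this]

lemma exists_smul_eq_compl {α : Type*} [Fintype α] [DecidableEq α] (σ : Perm α)
    (h : ∀ (x : α) (k : ℤ), (σ ^ k) x = x → Even k) : ∃ s : Finset α, σ • s = sᶜ := by
  classical
  let r : α → α := fun x => (Quotient.mk (SameCycle.setoid σ) x).out
  have hr : ∀ x, σ.SameCycle (r x) x := fun x =>
    Quotient.exact (Quotient.out_eq (Quotient.mk (SameCycle.setoid σ) x))
  have hrσ : ∀ x, r (σ x) = r x := fun x => by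
    have : Quotient.mk (SameCycle.setoid σ) (σ x) = Quotient.mk (SameCycle.setoid σ) x :=
      Quotient.sound (sameCycle_apply_left.2 (SameCycle.refl _ _))
    simp only [r, this]
  choose k hk using hr
  have hflip : ∀ x, Even (k (σ x)) ↔ ¬ Even (k x) := fun x => by
    have h1 : (σ ^ (-(k (σ x)) + (1 + k x))) (r x) = r x := by
      rw [zpow_add, zpow_add, mul_apply, mul_apply, hk, zpow_one, zpow_neg]
      rw [inv_eq_iff_eq, ← hrσ x, hk]
    have h2 := h _ _ h1
    grind
  refine ⟨Finset.univ.filter fun x => Even (k x), ?_⟩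
  ext y
  obtain ⟨x, rfl⟩ := σ.surjective y
  rw [← Finset.inv_smul_mem_iff]
  simp [hflip, -Int.not_even_iff_odd]

lemma exists_smul_finset_eq {α : Type*} [Fintype α] [DecidableEq α] {s t : Finset α}
    (h : s.card = t.card) : ∃ g : Perm α, g • s = t := by
  have := Set.powersetCard.isPretransitive (α := α) (n := t.card)
  obtain ⟨g, hg⟩ := MulAction.exists_smul_eq (Perm α)
    (⟨s, h⟩ : Set.powersetCard α t.card) ⟨t, rfl⟩
  exact ⟨g, congrArg Subtype.val hg⟩

lemma card_eq_half_of_smul_eq_compl {n : ℕ} {σ : Perm (Fin n)} {s : Finset (Fin n)}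
    (h : σ • s = sᶜ) : 2 * s.card = n := by
  have h1 := congrArg Finset.card h
  rw [Finset.card_smul_finset, Finset.card_compl, Fintype.card_fin] at h1
  have := s.card_le_univ
  rw [Fintype.card_fin] at this
  omega

lemma exists_isCycleOn_univ_smul_eq_compl {n : ℕ} {s : Finset (Fin n)}
    (hs : 2 * s.card = n) :
    ∃ σ : Perm (Fin n), σ.IsCycleOn Set.univ ∧ σ • s = sᶜ := by
  obtain ⟨τ, hτ, -⟩ := (Finset.univ : Finset (Fin n)).exists_cycleOn
  obtain ⟨s₀, hs₀⟩ := exists_smul_eq_compl τ fun x k hk => by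
    rw [hτ.zpow_apply_eq (Finset.mem_univ x), Finset.card_univ, Fintype.card_fin] at hk
    have : (2 : ℤ) ∣ n := ⟨s.card, by exact_mod_cast hs.symm⟩
    exact even_iff_two_dvd.2 (this.trans hk)
  obtain ⟨g, rfl⟩ := exists_smul_finset_eq (s := s₀) (t := s) (by
    have := card_eq_half_of_smul_eq_compl hs₀
    omega)
  refine ⟨g * τ * g⁻¹, ?_, ?_⟩
  · rw [Finset.coe_univ] at hτ
    have h := hτ.conj (g := g)
    rwa [Set.image_univ_of_surjective g.surjective] at h
  · rw [mul_smul, mul_smul, inv_smul_smul, hs₀, perm_smul_compl]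

/-! ### Cardinality of stabilizers and of conjugacy classes -/

lemma card_le_pow_mul_card_of_conj_mem {n r : ℕ} (H : Subgroup (Perm (Fin n)))
    (P : Finset (Perm (Fin n))) (σ : Perm (Fin n)) (hP : ∀ h ∈ H, h * σ * h⁻¹ ∈ P)
    (ρ : Fin r → Fin n) (hρ : ∀ x, ∃ j, σ.SameCycle (ρ j) x) :
    Nat.card H ≤ n ^ r * P.card := by
  classical
  rw [Nat.card_eq_fintype_card, ← Finset.card_univ]
  refine Finset.card_le_mul_card_image_of_maps_to (f := fun h : H => h.1 * σ * h.1⁻¹)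
    (fun h _ => hP h.1 h.2) _ fun τ _ => ?_
  have hcard : (Finset.univ : Finset (Fin r → Fin n)).card = n ^ r := by simp
  rw [← hcard]
  refine Finset.card_le_card_of_injOn (fun h j => h.1 (ρ j)) (fun _ _ => Finset.mem_univ _)
    fun g hg h hh hgh => ?_
  have key : ∀ g : Perm (Fin n), g * σ * g⁻¹ = τ → ∀ (k : ℤ) x, g ((σ ^ k) x) = (τ ^ k) (g x) := by
    intro g hg k x
    rw [← hg, conj_zpow]
    simp [mul_apply]
  refine Subtype.ext (Equiv.ext fun x => ?_)
  obtain ⟨j, k, rfl⟩ := hρ x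
  rw [key _ (Finset.mem_filter.1 hg).2, key _ (Finset.mem_filter.1 hh).2]
  exact congrArg _ (congrFun hgh j)

open scoped Nat in
lemma factorial_le_choose_mul_card_stabilizer {n : ℕ} (s : Finset (Fin n)) :
    n ! ≤ n.choose s.card * Nat.card (MulAction.stabilizer (Perm (Fin n)) s) := by
  classical
  have h := MulAction.card_orbit_mul_card_stabilizer_eq_card_group (Perm (Fin n)) s
  rw [Fintype.card_perm, Fintype.card_fin] at h
  rw [← h, Nat.card_eq_fintype_card]
  refine Nat.mul_le_mul_right _ ?_
  have hcard : (Finset.powersetCard s.card (Finset.univ : Finset (Fin n))).card =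
      n.choose s.card := by
    rw [Finset.card_powersetCard, Finset.card_univ, Fintype.card_fin]
  rw [← hcard, ← Set.toFinset_card]
  refine Finset.card_le_card fun t ht => ?_
  obtain ⟨g, rfl⟩ := Set.mem_toFinset.1 ht
  simp [Finset.mem_powersetCard]

/-! ### The members of the cover and the permutations that single them out -/

/-- The setwise stabilizer of `s` if `s` is nonempty, and the alternating group if `s = ∅`. -/
def smallStabilizer {n : ℕ} (s : Finset (Fin n)) : Subgroup (Perm (Fin n)) :=
  if s = ∅ then alternatingGroup (Fin n) else MulAction.stabilizer (Perm (Fin n)) s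

/-- The orbits of `σ` are `s` (if nonempty) and two sets of size at least `n / 3`, different from
`n / 2`; these sizes are not all even, and `σ` is even if and only if `s = ∅`. -/
def IsTricycle {n : ℕ} (s : Finset (Fin n)) (σ : Perm (Fin n)) : Prop :=
  ∃ J K : Finset (Fin n), Disjoint s J ∧ Disjoint s K ∧ Disjoint J K ∧ s ∪ J ∪ K = Finset.univ ∧
    σ.IsCycleOn s ∧ σ.IsCycleOn J ∧ σ.IsCycleOn K ∧ n ≤ 3 * J.card ∧ n ≤ 3 * K.card ∧
    2 * J.card ≠ n ∧ 2 * K.card ≠ n ∧ ¬ (Even s.card ∧ Even J.card ∧ Even K.card) ∧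
    sign σ = if s = ∅ then 1 else -1

lemma smallStabilizer_empty {n : ℕ} :
    smallStabilizer (∅ : Finset (Fin n)) = alternatingGroup (Fin n) := if_pos rfl

lemma smallStabilizer_of_nonempty {n : ℕ} {s : Finset (Fin n)} (hs : s.Nonempty) :
    smallStabilizer s = MulAction.stabilizer (Perm (Fin n)) s := if_neg hs.ne_empty

lemma mem_partitionStabilizer {n : ℕ} {s : Finset (Fin n)} {σ : Perm (Fin n)} :
    σ ∈ partitionStabilizer s ↔ σ • s = s ∨ σ • s = sᶜ := Iff.rfl

lemma disjoint_smul_finset {n : ℕ} (g : Perm (Fin n)) {s t : Finset (Fin n)}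
    (h : _root_.Disjoint s t) : _root_.Disjoint (g • s) (g • t) := by
  rw [Finset.disjoint_iff_inter_eq_empty] at h ⊢
  rw [← Finset.smul_finset_inter, h, Finset.smul_finset_empty]

namespace IsTricycle

variable {n : ℕ} {s : Finset (Fin n)} {σ : Perm (Fin n)}

lemma mem_smallStabilizer (h : IsTricycle s σ) : σ ∈ smallStabilizer s := by
  obtain ⟨J, K, -, -, -, -, hs, -, -, -, -, -, -, -, hsign⟩ := h
  rcases s.eq_empty_or_nonempty with rfl | hne
  · rw [smallStabilizer_empty, mem_alternatingGroup, hsign, if_pos rfl]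
  · rw [smallStabilizer_of_nonempty hne, MulAction.mem_stabilizer_iff]
    exact smul_eq_of_isCycleOn hs

lemma conj (h : IsTricycle s σ) (g : Perm (Fin n)) : IsTricycle (g • s) (g * σ * g⁻¹) := by
  obtain ⟨J, K, h1, h2, h3, h4, hs, hJ, hK, h⟩ := h
  have hcyc : ∀ c : Finset (Fin n), σ.IsCycleOn c →
      (g * σ * g⁻¹).IsCycleOn ((g • c : Finset (Fin n)) : Set (Fin n)) := by
    intro c hc
    rw [Finset.coe_smul_finset]
    exact hc.conj
  refine ⟨g • J, g • K, ?_, ?_, ?_, ?_, hcyc s hs, hcyc J hJ, hcyc K hK, ?_⟩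
  · exact disjoint_smul_finset g h1
  · exact disjoint_smul_finset g h2
  · exact disjoint_smul_finset g h3
  · rw [← Finset.smul_finset_union, ← Finset.smul_finset_union, h4, Finset.smul_finset_univ]
  · simpa only [Finset.card_smul_finset, map_mul, map_inv, mul_inv_cancel_comm,
      Finset.smul_finset_eq_empty] using h

end IsTricycle

lemma card_eq_of_partition {n : ℕ} {s J K : Finset (Fin n)} (hsJ : Disjoint s J)
    (hsK : Disjoint s K) (hJK : Disjoint J K) (hun : s ∪ J ∪ K = Finset.univ)
    (t : Finset (Fin n)) : (s ∩ t).card + (J ∩ t).card + (K ∩ t).card = t.card := by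
  rw [← Finset.card_union_of_disjoint (hsJ.mono Finset.inter_subset_left Finset.inter_subset_left),
    ← Finset.union_inter_distrib_right, ← Finset.card_union_of_disjoint
      ((Finset.disjoint_union_left.2 ⟨hsK, hJK⟩).mono Finset.inter_subset_left
        Finset.inter_subset_left),
    ← Finset.union_inter_distrib_right, hun, Finset.univ_inter]

lemma inter_card_of_subset_or_disjoint {α : Type*} [DecidableEq α] {c t : Finset α}
    (h : c ⊆ t ∨ Disjoint c t) :
    (c ⊆ t ∧ (c ∩ t).card = c.card) ∨ (Disjoint c t ∧ (c ∩ t).card = 0) := by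
  rcases h with h | h
  · exact Or.inl ⟨h, by rw [Finset.inter_eq_left.2 h]⟩
  · exact Or.inr ⟨h, by rw [Finset.disjoint_iff_inter_eq_empty.1 h, Finset.card_empty]⟩

namespace IsTricycle

variable {n : ℕ} {s : Finset (Fin n)} {σ : Perm (Fin n)}

lemma eq_of_smul_eq (h : IsTricycle s σ) {t : Finset (Fin n)} (ht : σ • t = t)
    (hne : t.Nonempty) (hcard : 3 * t.card < n) : t = s := by
  obtain ⟨J, K, hsJ, hsK, hJK, hun, hs, hJ, hK, hJn, hKn, -⟩ := h
  have hc := card_eq_of_partition hsJ hsK hJK hun t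
  have hst := inter_card_of_subset_or_disjoint (subset_or_disjoint_of_isCycleOn hs ht)
  have hJt := inter_card_of_subset_or_disjoint (subset_or_disjoint_of_isCycleOn hJ ht)
  have hKt := inter_card_of_subset_or_disjoint (subset_or_disjoint_of_isCycleOn hK ht)
  have hpos := hne.card_pos
  obtain ⟨h1, h2⟩ : s ⊆ t ∧ t.card = s.card := by grind
  exact (Finset.eq_of_subset_of_card_le h1 h2.le).symm

lemma two_mul_card_ne (h : IsTricycle s σ) (hsn : 3 * s.card < n) {t : Finset (Fin n)}
    (ht : σ • t = t) : 2 * t.card ≠ n := by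
  obtain ⟨J, K, hsJ, hsK, hJK, hun, hs, hJ, hK, hJn, hKn, hJ2, hK2, -⟩ := h
  have hc := card_eq_of_partition hsJ hsK hJK hun t
  have hc' := card_eq_of_partition hsJ hsK hJK hun Finset.univ
  simp only [Finset.inter_univ, Finset.card_univ, Fintype.card_fin] at hc'
  have hst := inter_card_of_subset_or_disjoint (subset_or_disjoint_of_isCycleOn hs ht)
  have hJt := inter_card_of_subset_or_disjoint (subset_or_disjoint_of_isCycleOn hJ ht)
  have hKt := inter_card_of_subset_or_disjoint (subset_or_disjoint_of_isCycleOn hK ht)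
  omega

lemma notMem_partitionStabilizer (h : IsTricycle s σ) (hsn : 3 * s.card < n)
    {t : Finset (Fin n)} (htn : 2 * t.card = n) : σ ∉ partitionStabilizer t := by
  rintro (ht | ht)
  · exact h.two_mul_card_ne hsn ht htn
  · obtain ⟨J, K, -, -, -, -, hs, hJ, hK, -, -, -, -, hodd, -⟩ := h
    exact hodd ⟨even_card_of_isCycleOn hs ht, even_card_of_isCycleOn hJ ht,
      even_card_of_isCycleOn hK ht⟩

lemma eq_of_mem_smallStabilizer (h : IsTricycle s σ) {t : Finset (Fin n)}
    (ht : σ ∈ smallStabilizer t) (htn : 3 * t.card < n) : t = s := by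
  rcases t.eq_empty_or_nonempty with rfl | hne
  · obtain ⟨J, K, -, -, -, -, -, -, -, -, -, -, -, -, hsign⟩ := h
    rw [smallStabilizer_empty, mem_alternatingGroup, hsign] at ht
    by_contra hs
    rw [if_neg (Ne.symm hs)] at ht
    exact absurd ht (by decide)
  · rw [smallStabilizer_of_nonempty hne, MulAction.mem_stabilizer_iff] at ht
    exact h.eq_of_smul_eq ht hne htn

/-- An invariant set of size between `n / 3` and `n / 2` contains exactly one of the two large
cycles, and is determined by it and its size. -/
lemma card_invariant_le (h : IsTricycle s σ) (hsn : 3 * s.card < n) {r : ℕ} (hr : 2 * r < n)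
    (hr' : n ≤ 3 * r) :
    {t : Finset (Fin n) | t.card = r ∧ σ • t = t}.toFinset.card ≤ 2 ∧
    (3 * r = n → {t : Finset (Fin n) | t.card = r ∧ σ • t = t}.toFinset.card ≤ 1) := by
  classical
  obtain ⟨J, K, hsJ, hsK, hJK, hun, hs, hJ, hK, hJn, hKn, hJ2, hK2, -⟩ := h
  have hc' := card_eq_of_partition hsJ hsK hJK hun Finset.univ
  simp only [Finset.inter_univ, Finset.card_univ, Fintype.card_fin] at hc'
  have key : ∀ t : Finset (Fin n), t.card = r → σ • t = t →
      (J ⊆ t ∧ ¬ K ⊆ t ∧ (t = J ∧ J.card = r ∨ t = s ∪ J ∧ s.card + J.card = r)) ∨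
      (K ⊆ t ∧ ¬ J ⊆ t ∧ (t = K ∧ K.card = r ∨ t = s ∪ K ∧ s.card + K.card = r)) := by
    intro t htr ht
    have hc := card_eq_of_partition hsJ hsK hJK hun t
    have hst := inter_card_of_subset_or_disjoint (subset_or_disjoint_of_isCycleOn hs ht)
    have hJt := inter_card_of_subset_or_disjoint (subset_or_disjoint_of_isCycleOn hJ ht)
    have hKt := inter_card_of_subset_or_disjoint (subset_or_disjoint_of_isCycleOn hK ht)
    have hu : ∀ x, x ∈ s ∨ x ∈ J ∨ x ∈ K := fun x => by
      have := Finset.mem_univ x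
      rw [← hun, Finset.mem_union, Finset.mem_union, or_assoc] at this
      exact this
    have hKne : ∀ c : Finset (Fin n), n ≤ 3 * c.card → Disjoint c t → ¬ c ⊆ t := by
      intro c hcn hd hsub
      have : c.card = 0 := by
        rw [← Finset.inter_eq_left.2 hsub, Finset.disjoint_iff_inter_eq_empty.1 hd,
          Finset.card_empty]
      omega
    have hout : ∀ c : Finset (Fin n), Disjoint c t → ∀ x ∈ c, x ∉ t := fun c hd x hx =>
      Finset.disjoint_left.1 hd hx
    rcases hJt with ⟨hJ1, hJ2⟩ | ⟨hJ1, hJ2⟩ <;> rcases hKt with ⟨hK1, hK2⟩ | ⟨hK1, hK2⟩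
    · omega
    · refine Or.inl ⟨hJ1, hKne K hKn hK1, ?_⟩
      have := hout K hK1
      rcases hst with ⟨hs1, hs2⟩ | ⟨hs1, hs2⟩
      · exact Or.inr ⟨by grind, by omega⟩
      · have := hout s hs1
        exact Or.inl ⟨by grind, by omega⟩
    · refine Or.inr ⟨hK1, hKne J hJn hJ1, ?_⟩
      have := hout J hJ1
      rcases hst with ⟨hs1, hs2⟩ | ⟨hs1, hs2⟩
      · exact Or.inr ⟨by grind, by omega⟩
      · have := hout s hs1
        exact Or.inl ⟨by grind, by omega⟩
    · omega
  constructor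
  · have h2 : (Finset.univ : Finset Bool).card = 2 := rfl
    rw [← h2]
    refine Finset.card_le_card_of_injOn (fun t => decide (J ⊆ t)) (fun _ _ => Finset.mem_univ _)
      fun t ht t' ht' htt' => ?_
    simp only [Set.coe_toFinset, Set.mem_ofPred_eq] at ht ht'
    have := key t ht.1 ht.2
    have := key t' ht'.1 ht'.2
    simp only [decide_eq_decide] at htt'
    grind
  · intro hr3
    refine Finset.card_le_one.2 fun t ht t' ht' => ?_
    simp only [Set.mem_toFinset, Set.mem_ofPred_eq] at ht ht'
    have := key t ht.1 ht.2
    have := key t' ht'.1 ht'.2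
    grind

end IsTricycle

lemma exists_isTricycle {n : ℕ} (hmod : n % 6 = 0) (hn : 30 < n) {s : Finset (Fin n)}
    (hs : 3 * s.card < n) : ∃ σ, IsTricycle s σ := by
  obtain ⟨j, hjn, hjs, hkn, hj2, hk2, hodd⟩ : ∃ j, n ≤ 3 * j ∧ j ≤ n - s.card ∧
      n ≤ 3 * (n - s.card - j) ∧ 2 * j ≠ n ∧ 2 * (n - s.card - j) ≠ n ∧
      ¬ (Even s.card ∧ Even j ∧ Even (n - s.card - j)) := by
    simp only [Nat.even_iff]
    by_cases hpar : s.card % 2 = 0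
    · by_cases h : s.card + 1 = n / 6
      · exact ⟨n / 3 + 3, by omega⟩
      · exact ⟨n / 3 + 1, by omega⟩
    · by_cases h : s.card = n / 6
      · exact ⟨n / 3 + 1, by omega⟩
      · exact ⟨n / 3, by omega⟩
  have hsc : sᶜ.card = n - s.card := by rw [Finset.card_compl, Fintype.card_fin]
  obtain ⟨J, hJs, rfl⟩ := Finset.exists_subset_card_eq (hjs.trans hsc.ge)
  have hsJ : _root_.Disjoint s J := Finset.disjoint_left.2 fun x hx hxJ =>
    Finset.mem_compl.1 (hJs hxJ) hx
  have hK : (sᶜ \ J).card = n - s.card - J.card := by rw [Finset.card_sdiff_of_subset hJs, hsc]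
  generalize hKdef : sᶜ \ J = K at hK
  have hmemK : ∀ x, x ∈ K ↔ x ∉ s ∧ x ∉ J := fun x => by
    rw [← hKdef, Finset.mem_sdiff, Finset.mem_compl]
  have hsK : _root_.Disjoint s K := Finset.disjoint_left.2 fun x hx hxK => ((hmemK x).1 hxK).1 hx
  have hJK : _root_.Disjoint J K := Finset.disjoint_left.2 fun x hx hxK => ((hmemK x).1 hxK).2 hx
  have hun : s ∪ J ∪ K = Finset.univ := Finset.eq_univ_iff_forall.2 fun x => by
    rw [Finset.mem_union, Finset.mem_union, hmemK]
    tauto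
  rw [← hK] at hkn hk2 hodd
  obtain ⟨f₁, hf₁, hf₁'⟩ := s.exists_cycleOn
  obtain ⟨f₂, hf₂, hf₂'⟩ := J.exists_cycleOn
  obtain ⟨f₃, hf₃, hf₃'⟩ := K.exists_cycleOn
  have hfix : ∀ {c : Finset (Fin n)} {f : Perm (Fin n)}, f.support ⊆ c → ∀ x ∉ c, f x = x :=
    fun hf x hx => notMem_support.1 fun h => hx (hf h)
  have h1 : ∀ x ∈ s, f₁ x = (f₁ * f₂ * f₃) x := fun x hx => by
    rw [mul_apply, mul_apply, hfix hf₃' x (Finset.disjoint_left.1 hsK hx),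
      hfix hf₂' x (Finset.disjoint_left.1 hsJ hx)]
  have h2 : ∀ x ∈ J, f₂ x = (f₁ * f₂ * f₃) x := fun x hx => by
    rw [mul_apply, mul_apply, hfix hf₃' x (Finset.disjoint_left.1 hJK hx),
      hfix hf₁' _ (Finset.disjoint_right.1 hsJ (hf₂.1.mapsTo hx))]
  have h3 : ∀ x ∈ K, f₃ x = (f₁ * f₂ * f₃) x := fun x hx => by
    have := hf₃.1.mapsTo hx
    rw [mul_apply, mul_apply, hfix hf₂' _ (Finset.disjoint_right.1 hJK this),
      hfix hf₁' _ (Finset.disjoint_right.1 hsK this)]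
  refine ⟨f₁ * f₂ * f₃, J, K, hsJ, hsK, hJK, hun, isCycleOn_congr hf₁ h1, isCycleOn_congr hf₂ h2,
    isCycleOn_congr hf₃ h3, hjn, hkn, hj2, hk2, hodd, ?_⟩
  rw [map_mul, map_mul, sign_of_isCycleOn hf₂ hf₂' (Finset.card_pos.1 (by omega)),
    sign_of_isCycleOn hf₃ hf₃' (Finset.card_pos.1 (by omega))]
  have hsum : Even (s.card + J.card + K.card) := by rw [Nat.even_iff]; omega
  split_ifs with hs0
  · subst hs0
    rw [Finset.card_empty, zero_add] at hsum
    have : f₁ = 1 := by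
      rw [← support_eq_empty_iff, ← Finset.subset_empty]
      exact hf₁'
    rw [this, map_one, one_mul, neg_mul_neg, ← pow_add, hsum.neg_one_pow]
  · rw [sign_of_isCycleOn hf₁ hf₁' (Finset.nonempty_iff_ne_empty.2 hs0), neg_mul_neg, mul_neg,
      ← pow_add, ← pow_add, hsum.neg_one_pow]

/-! ### Cycles that swap a set with its complement -/

section Swap

variable {n : ℕ} {s t : Finset (Fin n)} {σ : Perm (Fin n)}

lemma eq_empty_or_univ_of_isCycleOn_univ (hσ : σ.IsCycleOn Set.univ) (ht : σ • t = t) :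
    t = ∅ ∨ t = Finset.univ := by
  rw [← Finset.coe_univ] at hσ
  rcases subset_or_disjoint_of_isCycleOn hσ ht with h | h
  · exact Or.inr (Finset.univ_subset_iff.1 h)
  · exact Or.inl (Finset.eq_empty_of_forall_notMem fun x => Finset.disjoint_left.1 h
      (Finset.mem_univ x))

lemma sign_eq_neg_one_of_smul_eq_compl (hn : 0 < n) (hσ : σ.IsCycleOn Set.univ)
    (hs : σ • s = sᶜ) : sign σ = -1 := by
  have : Nonempty (Fin n) := ⟨⟨0, hn⟩⟩
  have hc := card_eq_half_of_smul_eq_compl hs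
  rw [← Finset.coe_univ] at hσ
  rw [sign_of_isCycleOn hσ (Finset.subset_univ _) Finset.univ_nonempty, Finset.card_univ,
    Fintype.card_fin, Even.neg_one_pow ⟨s.card, by omega⟩]

lemma notMem_smallStabilizer_of_smul_eq_compl (hσ : σ.IsCycleOn Set.univ) (hs : σ • s = sᶜ)
    (ht : 3 * t.card < n) : σ ∉ smallStabilizer t := by
  intro hmem
  rcases t.eq_empty_or_nonempty with rfl | hne
  · rw [smallStabilizer_empty, mem_alternatingGroup,
      sign_eq_neg_one_of_smul_eq_compl (by omega) hσ hs] at hmem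
    exact absurd hmem (by decide)
  · rw [smallStabilizer_of_nonempty hne, MulAction.mem_stabilizer_iff] at hmem
    rcases eq_empty_or_univ_of_isCycleOn_univ hσ hmem with rfl | rfl
    · exact Finset.not_nonempty_empty hne
    · rw [Finset.card_univ, Fintype.card_fin] at ht
      omega

lemma partitionStabilizer_compl : partitionStabilizer sᶜ = partitionStabilizer s := by
  ext σ
  rw [mem_partitionStabilizer, mem_partitionStabilizer, perm_smul_compl, compl_inj_iff,
    compl_inj_iff]

lemma partitionStabilizer_eq_of_smul_eq_compl (hn : 0 < n) (hσ : σ.IsCycleOn Set.univ)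
    (hs : σ • s = sᶜ) (ht : σ ∈ partitionStabilizer t) (htn : 2 * t.card = n) :
    partitionStabilizer t = partitionStabilizer s := by
  rcases ht with ht | ht
  · rcases eq_empty_or_univ_of_isCycleOn_univ hσ ht with rfl | rfl
    · rw [Finset.card_empty] at htn
      omega
    · rw [Finset.card_univ, Fintype.card_fin] at htn
      omega
  · have h : σ • symmDiff s t = symmDiff s t := by
      rw [Finset.smul_finset_symmDiff, hs, ht, compl_symmDiff_compl]
    rcases eq_empty_or_univ_of_isCycleOn_univ hσ h with h | h
    · rw [← Finset.bot_eq_empty, symmDiff_eq_bot] at h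
      rw [h]
    · rw [← Finset.top_eq_univ, symmDiff_eq_top] at h
      rw [h.compl_eq.symm, partitionStabilizer_compl]

end Swap

/-! ### The cover -/

lemma exists_smul_eq_compl_of_sign_eq_neg_one {n : ℕ} (hmod : n % 6 = 0) (hn : 30 < n)
    {σ : Perm (Fin n)} (hσ : sign σ = -1)
    (hinv : ∀ t : Finset (Fin n), t.Nonempty → σ • t = t → n ≤ 3 * t.card) :
    ∃ s : Finset (Fin n), σ • s = sᶜ := by
  have hcycle : ∀ x, σ.IsCycleOn (σ.cycleOf x).support := fun x => by
    refine isCycleOn_support_cycleOf σ x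
  have hsupp : ∀ x, x ∈ σ.support := fun x => by
    rw [mem_support]
    intro hx
    have := hinv {x} (Finset.singleton_nonempty x) (by
      rw [Finset.smul_finset_singleton, Perm.smul_def, hx])
    rw [Finset.card_singleton] at this
    omega
  have hpart : ∀ m ∈ σ.cycleType, n / 3 ≤ m := by
    intro m hm
    simp only [cycleType_def, Multiset.mem_map, Finset.mem_val] at hm
    obtain ⟨c, hc, rfl⟩ := hm
    obtain ⟨x, hx⟩ := (mem_cycleFactorsFinset_iff.1 hc).1.nonempty_support
    obtain rfl := cycle_is_cycleOf hx hc
    have := hinv _ ⟨x, hx⟩ (smul_eq_of_isCycleOn (hcycle x))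
    rw [Function.comp_apply]
    omega
  have hsum : σ.cycleType.sum = n := by
    rw [sum_cycleType, Finset.eq_univ_iff_forall.2 hsupp, Finset.card_univ, Fintype.card_fin]
  have hodd : Odd σ.cycleType.card := by
    rw [sign_of_cycleType, hsum, pow_add, Even.neg_one_pow (Nat.even_iff.2 (by omega)),
      one_mul] at hσ
    by_contra h
    rw [Nat.not_odd_iff_even] at h
    rw [h.neg_one_pow] at hσ
    exact absurd hσ (by decide)
  have hle := Multiset.card_nsmul_le_sum hpart
  rw [hsum, smul_eq_mul] at hle
  have heven : ∀ m ∈ σ.cycleType, Even m := by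
    have h4 : σ.cycleType.card < 4 := by
      by_contra h
      have := Nat.mul_le_mul_right (n / 3) (not_lt.1 h)
      omega
    obtain h | h : σ.cycleType.card = 1 ∨ σ.cycleType.card = 3 := by
      rw [Nat.odd_iff] at hodd
      omega
    · obtain ⟨a, ha⟩ := Multiset.card_eq_one.1 h
      rw [ha, Multiset.sum_singleton] at hsum
      intro m hm
      rw [ha, Multiset.mem_singleton] at hm
      rw [Nat.even_iff]
      omega
    · obtain ⟨a, b, c, ha⟩ := Multiset.card_eq_three.1 h
      rw [ha] at hsum hpart ⊢
      simp only [Multiset.insert_eq_cons, Multiset.mem_cons, Multiset.mem_singleton,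
        Multiset.sum_cons, Multiset.sum_singleton, forall_eq_or_imp, forall_eq] at hsum hpart ⊢
      simp only [Nat.even_iff]
      omega
  refine exists_smul_eq_compl σ fun x k hk => ?_
  have hx : x ∈ (σ.cycleOf x).support := by
    rw [mem_support_cycleOf_iff]
    exact ⟨SameCycle.refl _ _, hsupp x⟩
  rw [(hcycle x).zpow_apply_eq hx] at hk
  have hm : (σ.cycleOf x).support.card ∈ σ.cycleType := by
    rw [cycleType_def, Multiset.mem_map]
    exact ⟨_, cycleOf_mem_cycleFactorsFinset_iff.2 (hsupp x), rfl⟩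
  exact even_iff_two_dvd.2 ((Int.natCast_dvd_natCast.2 (heven _ hm).two_dvd).trans hk)

lemma exists_mem_cover {n : ℕ} (hmod : n % 6 = 0) (hn : 30 < n) (σ : Perm (Fin n)) :
    (∃ s : Finset (Fin n), 2 * s.card = n ∧ σ ∈ partitionStabilizer s) ∨
      ∃ s : Finset (Fin n), 3 * s.card < n ∧ σ ∈ smallStabilizer s := by
  by_contra! h
  have hσ : sign σ = -1 := by
    rcases Int.units_eq_one_or (sign σ) with h1 | h1
    · refine absurd ?_ (h.2 ∅ (by rw [Finset.card_empty]; omega))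
      rwa [smallStabilizer_empty, mem_alternatingGroup]
    · exact h1
  obtain ⟨s, hs⟩ := exists_smul_eq_compl_of_sign_eq_neg_one hmod hn hσ fun t hne ht => by
    by_contra! hlt
    refine h.2 t hlt ?_
    rwa [smallStabilizer_of_nonempty hne, MulAction.mem_stabilizer_iff]
  exact h.1 s (card_eq_half_of_smul_eq_compl hs) (Or.inr hs)

/-! ### Lower bounds for the number of distinguishing permutations -/

lemma card_smallStabilizer_le {n : ℕ} {s : Finset (Fin n)} (hn : 0 < n)
    (P : Finset (Perm (Fin n))) (hP : ∀ σ, σ ∈ P ↔ IsTricycle s σ) (hne : P.Nonempty) :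
    Nat.card (smallStabilizer s) ≤ n ^ 3 * P.card := by
  obtain ⟨σ, hσ⟩ := hne
  obtain ⟨J, K, -, -, -, hun, hs, hJ, hK, hJn, hKn, -⟩ := (hP σ).1 hσ
  obtain ⟨y, hy⟩ := Finset.card_pos.1 (show 0 < J.card by omega)
  obtain ⟨z, hz⟩ := Finset.card_pos.1 (show 0 < K.card by omega)
  obtain ⟨x, hx⟩ : ∃ x, s.Nonempty → x ∈ s := by
    rcases s.eq_empty_or_nonempty with rfl | ⟨x, hx⟩
    · exact ⟨y, fun h => absurd h Finset.not_nonempty_empty⟩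
    · exact ⟨x, fun _ => hx⟩
  refine card_le_pow_mul_card_of_conj_mem _ P σ (fun g hg => ?_) ![x, y, z] fun w => ?_
  · have hgs : g • s = s := by
      rcases s.eq_empty_or_nonempty with rfl | hne
      · exact Finset.smul_finset_empty g
      · rwa [smallStabilizer_of_nonempty hne, MulAction.mem_stabilizer_iff] at hg
    have := ((hP σ).1 hσ).conj g
    rwa [hgs, ← hP] at this
  · have hw := Finset.mem_univ w
    rw [← hun, Finset.mem_union, Finset.mem_union] at hw
    rcases hw with (hw | hw) | hw
    · exact ⟨0, hs.2 (hx ⟨w, hw⟩) hw⟩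
    · exact ⟨1, hJ.2 hy hw⟩
    · exact ⟨2, hK.2 hz hw⟩

open scoped Nat in
lemma factorial_le_mul_card_smallStabilizer {n : ℕ} {s : Finset (Fin n)} (hn : 30 < n)
    (hmod : n % 6 = 0) (hs : 3 * s.card < n) :
    n ! ≤ n.choose (n / 3) * Nat.card (smallStabilizer s) := by
  rcases s.eq_empty_or_nonempty with rfl | hne
  · have : Nontrivial (Fin n) := Fin.nontrivial_iff_two_le.2 (by omega)
    have h := two_mul_nat_card_alternatingGroup (α := Fin n)
    rw [Nat.card_perm, Nat.card_fin] at h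
    rw [smallStabilizer_empty, ← h]
    refine Nat.mul_le_mul_right _ ?_
    have := choose_le_choose_of_le_half (n := n) (i := 1) (j := n / 3) (by omega) (by omega)
    rw [Nat.choose_one_right] at this
    omega
  · rw [smallStabilizer_of_nonempty hne]
    exact (factorial_le_choose_mul_card_stabilizer s).trans (Nat.mul_le_mul_right _
      (choose_le_choose_of_le_half (by omega) (by omega)))

open scoped Nat in
lemma factorial_le_mul_card_isTricycle {n : ℕ} {s : Finset (Fin n)} (hn : 30 < n)
    (hmod : n % 6 = 0) (hs : 3 * s.card < n)
    (P : Finset (Perm (Fin n))) (hP : ∀ σ, σ ∈ P ↔ IsTricycle s σ) :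
    n ! ≤ n ^ 3 * n.choose (n / 3) * P.card := by
  obtain ⟨σ, hσ⟩ := exists_isTricycle hmod hn hs
  calc n ! ≤ n.choose (n / 3) * Nat.card (smallStabilizer s) :=
        factorial_le_mul_card_smallStabilizer hn hmod hs
    _ ≤ n.choose (n / 3) * (n ^ 3 * P.card) :=
        Nat.mul_le_mul_left _ (card_smallStabilizer_le (by omega) P hP ⟨σ, (hP σ).2 hσ⟩)
    _ = _ := by ring

open scoped Nat in
lemma factorial_le_mul_card_swap {n : ℕ} {s : Finset (Fin n)} (hn : 0 < n) (hs : 2 * s.card = n)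
    (P : Finset (Perm (Fin n)))
    (hP : ∀ σ, σ ∈ P ↔ σ.IsCycleOn Set.univ ∧ σ • s = sᶜ) :
    n ! ≤ n * 2 ^ n * P.card := by
  obtain ⟨σ, hσ, hσs⟩ := exists_isCycleOn_univ_smul_eq_compl hs
  have key : Nat.card (MulAction.stabilizer (Perm (Fin n)) s) ≤ n ^ 1 * P.card := by
    refine card_le_pow_mul_card_of_conj_mem _ P σ (fun g hg => (hP _).2 ⟨?_, ?_⟩)
      (fun _ => ⟨0, hn⟩) fun w => ⟨0, hσ.2 (Set.mem_univ _) (Set.mem_univ _)⟩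
    · have h := hσ.conj (g := g)
      rwa [Set.image_univ_of_surjective g.surjective] at h
    · rw [MulAction.mem_stabilizer_iff] at hg
      rw [mul_smul, mul_smul, inv_smul_eq_iff.2 hg.symm, hσs, perm_smul_compl, hg]
  calc n ! ≤ n.choose s.card * Nat.card (MulAction.stabilizer (Perm (Fin n)) s) :=
        factorial_le_choose_mul_card_stabilizer s
    _ ≤ 2 ^ n * (n ^ 1 * P.card) := Nat.mul_le_mul (Nat.choose_le_two_pow _ _) key
    _ = _ := by ring

/-! ### Maximal transitive subgroups outside the cover are small -/

lemma partitionStabilizer_ne_top {n : ℕ} (hmod : n % 6 = 0) (hn : 30 < n) {s : Finset (Fin n)}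
    (hs : 2 * s.card = n) : partitionStabilizer s ≠ ⊤ := by
  have h0 : 3 * (∅ : Finset (Fin n)).card < n := by rw [Finset.card_empty]; omega
  obtain ⟨σ, hσ⟩ := exists_isTricycle hmod hn h0
  intro h
  exact hσ.notMem_partitionStabilizer h0 hs (h ▸ Subgroup.mem_top σ)

lemma alternatingGroup_ne_top {n : ℕ} (hn : 2 ≤ n) : alternatingGroup (Fin n) ≠ ⊤ := by
  have : Nontrivial (Fin n) := Fin.nontrivial_iff_two_le.2 hn
  intro h
  have := alternatingGroup.index_eq_two (α := Fin n)
  rw [h, Subgroup.index_top] at this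
  omega

lemma eq_alternatingGroup_of_le {n : ℕ} (hn : 2 ≤ n) {M : Subgroup (Perm (Fin n))} (hM : M ≠ ⊤)
    (h : alternatingGroup (Fin n) ≤ M) : M = alternatingGroup (Fin n) := by
  have : Nontrivial (Fin n) := Fin.nontrivial_iff_two_le.2 hn
  refine eq_alternatingGroup_of_index_eq_two ?_
  have hdvd := Subgroup.index_dvd_of_le h
  rw [alternatingGroup.index_eq_two, Nat.dvd_prime Nat.prime_two] at hdvd
  exact hdvd.resolve_left fun h1 => hM (Subgroup.index_eq_one.1 h1)

open scoped Nat in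
lemma natCard_mul_lt_of_isPretransitive {n : ℕ} (hmod : n % 6 = 0) (hn : 30 < n)
    {M : Subgroup (Perm (Fin n))} [hT : MulAction.IsPretransitive M (Fin n)] (hM : IsCoatom M)
    (hA : M ≠ alternatingGroup (Fin n))
    (hpart : ∀ s : Finset (Fin n), 2 * s.card = n → M ≠ partitionStabilizer s) :
    Nat.card M * (n ^ 3 * n.choose (n / 3)) < n ! ∧ Nat.card M * (n * 2 ^ n) < n ! := by
  have hof : Nat.card M * (n ^ 3 * 2 ^ n) < n ! →
      Nat.card M * (n ^ 3 * n.choose (n / 3)) < n ! ∧ Nat.card M * (n * 2 ^ n) < n ! := by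
    refine fun h => ⟨lt_of_le_of_lt ?_ h, lt_of_le_of_lt ?_ h⟩
    · gcongr
      exact Nat.choose_le_two_pow _ _
    · gcongr
      exact Nat.le_self_pow (by omega) n
  by_cases hP : MulAction.IsPreprimitive M (Fin n)
  · have hAM : ¬ alternatingGroup (Fin n) ≤ M := fun h =>
      hA (eq_alternatingGroup_of_le (by omega) hM.1 h)
    have h := card_mul_factorial_le_of_isPreprimitive M hP hAM
    have h1 := cube_mul_two_pow_lt_factorial (n / 2) (by omega)
    rw [show 2 * (n / 2) = n by omega] at h1
    refine hof (lt_of_lt_of_le ?_ h)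
    rw [show n - n / 2 = n / 2 by omega]
    exact Nat.mul_lt_mul_of_pos_left h1 Nat.card_pos
  · obtain ⟨B, hB, hBt⟩ : ∃ B : Set (Fin n), MulAction.IsBlock M B ∧
        ¬ MulAction.IsTrivialBlock B := by
      by_contra! h
      exact hP { isTrivialBlock_of_isBlock := fun hB => h _ hB }
    rw [MulAction.IsTrivialBlock, not_or, Set.not_subsingleton_iff] at hBt
    have hne : B.Nonempty := hBt.1.nonempty
    have hmul := hB.ncard_block_mul_ncard_orbit_eq hne
    have hcard := card_le_of_isBlock M hB hne
    rw [Nat.card_fin] at hmul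
    have hm : 2 ≤ B.ncard := (Set.one_lt_ncard_iff_nontrivial).2 hBt.1
    have hk : 2 ≤ (MulAction.orbit M B).ncard := by
      by_contra! hlt
      have : B.ncard = n := by
        interval_cases h : (MulAction.orbit M B).ncard
        · omega
        · omega
      exact hBt.2 ((Set.eq_univ_iff_ncard B).2 (by rw [this, Nat.card_fin]))
    have hk2 : (MulAction.orbit M B).ncard ≠ 2 := by
      intro hk2
      rw [hk2] at hmul
      classical
      have hBc : 2 * B.toFinset.card = n := by
        rw [← Set.ncard_eq_toFinset_card']
        omega
      have hle : M ≤ partitionStabilizer B.toFinset := by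
        intro g hg
        rw [mem_partitionStabilizer]
        rcases hB.smul_eq_or_disjoint ⟨g, hg⟩ with h | h
        · left
          refine Finset.coe_injective ?_
          rw [Finset.coe_smul_finset, Set.coe_toFinset]
          exact h
        · right
          refine Finset.eq_of_subset_of_card_le (fun x hx => ?_) ?_
          · rw [Finset.mem_compl, Set.mem_toFinset]
            refine Set.disjoint_left.1 h ?_
            rw [← Finset.mem_coe, Finset.coe_smul_finset, Set.coe_toFinset] at hx
            exact hx
          · rw [Finset.card_smul_finset, Finset.card_compl, Fintype.card_fin]
            omega
      refine hpart _ hBc (hle.eq_or_lt.resolve_right fun hlt => ?_)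
      exact partitionStabilizer_ne_top hmod hn hBc (hM.2 _ hlt)
    rcases (show 3 ≤ (MulAction.orbit M B).ncard by omega).eq_or_lt with hk3 | hk4
    · obtain ⟨a, ha⟩ : ∃ a, a = B.ncard := ⟨_, rfl⟩
      rw [← hk3, ← ha] at hmul hcard
      obtain rfl : n = 3 * a := by omega
      rw [show 3 * a / 3 = a by omega]
      exact ⟨(Nat.mul_le_mul_right _ hcard).trans_lt (three_blocks_choose_lt a (by omega)),
        (Nat.mul_le_mul_right _ hcard).trans_lt (three_blocks_two_pow_lt a (by omega))⟩
    · have h := many_blocks_le _ _ hm hk4 (by omega)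
      rw [hmul] at h
      refine hof (lt_of_lt_of_le ?_ h)
      calc _ < Nat.card M * 3 ^ n :=
            Nat.mul_lt_mul_of_pos_left (cube_mul_two_pow_lt_three_pow n (by omega)) Nat.card_pos
        _ ≤ _ := Nat.mul_le_mul_right _ hcard

/-! ### Averaging over setwise stabilizers -/

lemma card_filter_card_eq (n r : ℕ) :
    (Finset.univ.filter fun s : Finset (Fin n) => s.card = r).card = n.choose r := by
  rw [← Finset.powerset_univ, ← Finset.powersetCard_eq_filter, Finset.card_powersetCard,
    Finset.card_univ, Fintype.card_fin]

lemma card_filter_three_mul_card_lt (a : ℕ) :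
    (Finset.univ.filter fun s : Finset (Fin (3 * a)) => 3 * s.card < 3 * a).card =
      ∑ i ∈ Finset.range a, (3 * a).choose i := by
  rw [Finset.card_eq_sum_card_fiberwise (f := Finset.card) (t := Finset.range a)
    (fun s hs => by simpa using hs)]
  refine Finset.sum_congr rfl fun i hi => ?_
  rw [← card_filter_card_eq, Finset.filter_filter]
  congr 1
  ext s
  have := Finset.mem_range.1 hi
  simp only [Finset.mem_filter, Finset.mem_univ, true_and]
  omega

section Averaging

open Classical in
/-- The proportion of elements of the stabilizer of `t` among the permutations satisfying
`IsTricycle s`. -/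
noncomputable def tricycleProportion {n : ℕ} (s t : Finset (Fin n)) : ℚ :=
  (Finset.univ.filter fun σ : Perm (Fin n) => IsTricycle s σ ∧ σ • t = t).card /
    (Finset.univ.filter fun σ : Perm (Fin n) => IsTricycle s σ).card

variable {n : ℕ}

lemma isTricycle_smul_iff {s : Finset (Fin n)} {σ : Perm (Fin n)} (g : Perm (Fin n)) :
    IsTricycle (g • s) (g * σ * g⁻¹) ↔ IsTricycle s σ := by
  refine ⟨fun h => ?_, fun h => h.conj g⟩
  simpa [mul_assoc] using h.conj g⁻¹

lemma tricycleProportion_smul (g : Perm (Fin n)) (s t : Finset (Fin n)) :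
    tricycleProportion (g • s) (g • t) = tricycleProportion s t := by
  classical
  rw [tricycleProportion, tricycleProportion]
  congr 2
  · symm
    refine Finset.card_equiv (MulAut.conj g).toEquiv fun σ => ?_
    simp [isTricycle_smul_iff, mul_smul]
  · symm
    refine Finset.card_equiv (MulAut.conj g).toEquiv fun σ => ?_
    simp [isTricycle_smul_iff]

lemma sum_tricycleProportion_smul (g : Perm (Fin n)) (t : Finset (Fin n)) :
    ∑ s : Finset (Fin n) with 3 * s.card < n, tricycleProportion s (g • t) =
      ∑ s : Finset (Fin n) with 3 * s.card < n, tricycleProportion s t := by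
  symm
  refine Finset.sum_bij (fun s _ => g • s) (fun s hs => ?_) (fun s _ t _ h => ?_)
    (fun s hs => ⟨g⁻¹ • s, ?_, smul_inv_smul g s⟩) fun s _ => (tricycleProportion_smul g s t).symm
  · simpa using hs
  · exact smul_left_cancel g h
  · simpa using hs

lemma choose_mul_sum_tricycleProportion (t : Finset (Fin n)) :
    (n.choose t.card : ℚ) * ∑ s : Finset (Fin n) with 3 * s.card < n, tricycleProportion s t =
      ∑ s : Finset (Fin n) with 3 * s.card < n,
        ∑ t' : Finset (Fin n) with t'.card = t.card, tricycleProportion s t' := by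
  have h : ∀ t' ∈ Finset.univ.filter fun t' : Finset (Fin n) => t'.card = t.card,
      ∑ s : Finset (Fin n) with 3 * s.card < n, tricycleProportion s t' =
        ∑ s : Finset (Fin n) with 3 * s.card < n, tricycleProportion s t := fun t' ht' => by
    obtain ⟨g, hg⟩ := exists_smul_finset_eq (Finset.mem_filter.1 ht').2.symm
    rw [← hg, sum_tricycleProportion_smul]
  rw [Finset.sum_comm, Finset.sum_congr rfl h, Finset.sum_const, nsmul_eq_mul, card_filter_card_eq]

lemma sum_tricycleProportion_le {s : Finset (Fin n)} {r m : ℕ}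
    (hm : ∀ σ : Perm (Fin n), IsTricycle s σ →
      {t : Finset (Fin n) | t.card = r ∧ σ • t = t}.toFinset.card ≤ m) :
    ∑ t : Finset (Fin n) with t.card = r, tricycleProportion s t ≤ m := by
  classical
  simp only [tricycleProportion]
  rw [← Finset.sum_div]
  refine div_le_of_le_mul₀ (by positivity) (by positivity) ?_
  norm_cast
  rw [mul_comm]
  calc _ = ∑ t : Finset (Fin n) with t.card = r, ((Finset.univ.filter fun σ : Perm (Fin n) =>
        IsTricycle s σ).filter fun σ => σ • t = t).card := by
        simp only [Finset.filter_filter]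
    _ = ∑ σ with IsTricycle s σ, ((Finset.univ.filter fun t : Finset (Fin n) =>
        t.card = r).filter fun t => σ • t = t).card := by
        exact Finset.sum_card_bipartiteAbove_eq_sum_card_bipartiteBelow _
    _ ≤ _ := by
        refine Finset.sum_le_card_nsmul _ _ m fun σ hσ => ?_
        refine le_trans (Finset.card_le_card fun t ht => ?_) (hm σ (Finset.mem_filter.1 hσ).2)
        simpa using ht

lemma sum_tricycleProportion_lt_one (hmod : n % 6 = 0) (hn : 30 < n) {t : Finset (Fin n)}
    (ht : n ≤ 3 * t.card) (ht' : 2 * t.card < n) :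
    ∑ s : Finset (Fin n) with 3 * s.card < n, tricycleProportion s t < 1 := by
  obtain ⟨a, rfl⟩ : ∃ a, n = 3 * a := ⟨n / 3, by omega⟩
  have hpos : (0 : ℚ) < (3 * a).choose t.card := by
    exact_mod_cast Nat.choose_pos (by omega)
  refine lt_of_mul_lt_mul_left ?_ hpos.le
  rw [choose_mul_sum_tricycleProportion, mul_one]
  have hle : ∀ m : ℕ, (∀ s : Finset (Fin (3 * a)), 3 * s.card < 3 * a → ∀ σ : Perm (Fin (3 * a)),
      IsTricycle s σ → {t' : Finset (Fin (3 * a)) | t'.card = t.card ∧ σ • t' = t'}.toFinset.card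
        ≤ m) →
      ∑ s : Finset (Fin (3 * a)) with 3 * s.card < 3 * a,
        ∑ t' : Finset (Fin (3 * a)) with t'.card = t.card, tricycleProportion s t' ≤
          ((∑ i ∈ Finset.range a, (3 * a).choose i) * m : ℕ) := by
    intro m hm
    rw [← card_filter_three_mul_card_lt, Nat.cast_mul, ← nsmul_eq_mul]
    exact Finset.sum_le_card_nsmul _ _ _ fun s hs =>
      sum_tricycleProportion_le (hm s (Finset.mem_filter.1 hs).2)
  rcases (show a ≤ t.card by omega).eq_or_lt with h | h
  · refine (hle 1 fun s hs σ hσ => (hσ.card_invariant_le hs ht' ht).2 (by omega)).trans_lt ?_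
    rw [mul_one, ← h]
    exact_mod_cast sum_choose_lt a (by omega)
  · refine (hle 2 fun s hs σ hσ => (hσ.card_invariant_le hs ht' ht).1).trans_lt ?_
    rw [mul_comm]
    exact_mod_cast (two_mul_sum_choose_lt a (by omega)).trans_le
      (choose_le_choose_of_le_half h (by omega))

end Averaging

/-! ### Comparing two covers -/

open Classical in
lemma eq_of_cover_of_sum_lt_one {G : Type*} [Group G] {𝓗 𝒞 : Finset (Subgroup G)}
    {P : Subgroup G → Finset G} (hne : ∀ H ∈ 𝓗, (P H).Nonempty)
    (hP : ∀ H ∈ 𝓗, ∀ g ∈ P H, ∀ H' ∈ 𝓗, g ∈ H' → H' = H)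
    (hcov : ∀ g : G, ∃ H ∈ 𝒞, g ∈ H) (hcard : 𝒞.card ≤ 𝓗.card)
    (hsum : ∀ M ∈ 𝒞, M ∉ 𝓗 →
      ∑ H ∈ 𝓗, (((P H).filter (· ∈ M)).card / (P H).card : ℚ) < 1) : 𝒞 = 𝓗 := by
  have h1 : ∀ H ∈ 𝓗 \ 𝒞,
      (1 : ℚ) ≤ ∑ M ∈ 𝒞 \ 𝓗, (((P H).filter (· ∈ M)).card / (P H).card : ℚ) := by
    intro H hH
    rw [Finset.mem_sdiff] at hH
    have hpos : (0 : ℚ) < (P H).card := by exact_mod_cast (hne H hH.1).card_pos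
    rw [← Finset.sum_div, one_le_div hpos]
    norm_cast
    refine le_trans (Finset.card_le_card fun g hg => ?_) Finset.card_biUnion_le
    obtain ⟨M, hM, hgM⟩ := hcov g
    refine Finset.mem_biUnion.2 ⟨M, Finset.mem_sdiff.2 ⟨hM, fun hM' => ?_⟩,
      Finset.mem_filter.2 ⟨hg, hgM⟩⟩
    exact hH.2 (hP H hH.1 g hg M hM' hgM ▸ hM)
  have h2 : ((𝓗 \ 𝒞).card : ℚ) ≤
      ∑ M ∈ 𝒞 \ 𝓗, ∑ H ∈ 𝓗, (((P H).filter (· ∈ M)).card / (P H).card : ℚ) := by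
    have h := Finset.card_nsmul_le_sum _ _ _ h1
    rw [nsmul_eq_mul, mul_one, Finset.sum_comm] at h
    refine h.trans (Finset.sum_le_sum fun M _ => ?_)
    exact Finset.sum_le_sum_of_subset_of_nonneg Finset.sdiff_subset fun _ _ _ => by positivity
  have h3 := Finset.card_sdiff_add_card_inter 𝒞 𝓗
  have h4 := Finset.card_sdiff_add_card_inter 𝓗 𝒞
  rw [Finset.inter_comm] at h4
  rcases (𝒞 \ 𝓗).eq_empty_or_nonempty with h | h
  · exact Finset.eq_of_subset_of_card_le (Finset.sdiff_eq_empty_iff_subset.1 h) (by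
      rw [h, Finset.sum_empty] at h2
      have : (𝓗 \ 𝒞).card ≤ 0 := by exact_mod_cast h2
      omega)
  · have h5 := h2.trans_lt (Finset.sum_lt_sum_of_nonempty h fun M hM =>
      hsum M (Finset.mem_sdiff.1 hM).1 (Finset.mem_sdiff.1 hM).2)
    rw [Finset.sum_const, nsmul_eq_mul, mul_one] at h5
    have : (𝓗 \ 𝒞).card < (𝒞 \ 𝓗).card := by exact_mod_cast h5
    omega

open Classical in
lemma sum_div_lt_one_of_card_lt {G : Type*} [Group G] [Finite G] {𝓗 : Finset (Subgroup G)}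
    {P : Subgroup G → Finset G} (hdisj : (𝓗 : Set (Subgroup G)).PairwiseDisjoint P)
    {M : Subgroup G} (hM : ∀ H ∈ 𝓗, Nat.card M < (P H).card) :
    ∑ H ∈ 𝓗, (((P H).filter (· ∈ M)).card / (P H).card : ℚ) < 1 := by
  have hpos : (0 : ℚ) < (Nat.card M + 1 : ℕ) := by positivity
  have hle : ∑ H ∈ 𝓗, ((P H).filter (· ∈ M)).card ≤ Nat.card M := by
    rw [← Finset.card_biUnion fun H hH H' hH' h =>
      (hdisj hH hH' h).mono (Finset.filter_subset _ _) (Finset.filter_subset _ _),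
      ← SetLike.coe_sort_coe, Nat.card_coe_set_eq, ← Set.ncard_coe_finset]
    refine Set.ncard_le_ncard (fun g hg => ?_) (Set.toFinite _)
    obtain ⟨H, -, hg⟩ := Finset.mem_biUnion.1 (Finset.mem_coe.1 hg)
    exact (Finset.mem_filter.1 hg).2
  calc _ ≤ ∑ H ∈ 𝓗, (((P H).filter (· ∈ M)).card / (Nat.card M + 1 : ℕ) : ℚ) := by
        refine Finset.sum_le_sum fun H hH => ?_
        refine div_le_div_of_nonneg_left (by positivity) hpos ?_
        exact_mod_cast hM H hH
    _ < 1 := by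
        rw [← Finset.sum_div, div_lt_one hpos]
        exact_mod_cast Nat.lt_succ_of_le hle

/-! ### The standard cover and its distinguishing permutations -/

section StandardCover

variable {n : ℕ}

lemma stabilizer_ne_top_of_nonempty {t : Finset (Fin n)} (ht : t.Nonempty) (ht' : t.card < n) :
    MulAction.stabilizer (Perm (Fin n)) t ≠ ⊤ := by
  intro h
  obtain ⟨x, hx⟩ := ht
  obtain ⟨y, hy⟩ : ∃ y, y ∉ t := by
    by_contra! hall
    rw [Finset.eq_univ_iff_forall.2 hall, Finset.card_univ, Fintype.card_fin] at ht'
    exact lt_irrefl _ ht'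
  have hmem : swap x y ∈ MulAction.stabilizer (Perm (Fin n)) t := h ▸ Subgroup.mem_top _
  rw [MulAction.mem_stabilizer_iff] at hmem
  refine hy ?_
  rw [← hmem]
  simpa using Finset.smul_mem_smul_finset (a := swap x y) hx

open Classical in
/-- The alternating group, the setwise stabilizers of nonempty sets of size less than `n / 3` and
the stabilizers of partitions into two halves. -/
noncomputable def standardCover (n : ℕ) : Finset (Subgroup (Perm (Fin n))) :=
  (Finset.univ.filter fun s : Finset (Fin n) => 2 * s.card = n).image partitionStabilizer ∪
    (Finset.univ.filter fun s : Finset (Fin n) => 3 * s.card < n).image smallStabilizer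

lemma mem_standardCover {H : Subgroup (Perm (Fin n))} :
    H ∈ standardCover n ↔ (∃ s : Finset (Fin n), 2 * s.card = n ∧ partitionStabilizer s = H) ∨
      ∃ s : Finset (Fin n), 3 * s.card < n ∧ smallStabilizer s = H := by
  simp [standardCover]

/-- Permutations lying in exactly one member of the standard cover. -/
def IsDistinguishing (σ : Perm (Fin n)) : Prop :=
  (∃ s : Finset (Fin n), σ.IsCycleOn Set.univ ∧ σ • s = sᶜ) ∨
    ∃ s : Finset (Fin n), 3 * s.card < n ∧ IsTricycle s σ

lemma IsDistinguishing.eq_of_mem (hn : 0 < n) {σ : Perm (Fin n)} (hσ : IsDistinguishing σ)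
    {H H' : Subgroup (Perm (Fin n))} (hH : H ∈ standardCover n) (hH' : H' ∈ standardCover n)
    (hmem : σ ∈ H) (hmem' : σ ∈ H') : H' = H := by
  rw [mem_standardCover] at hH hH'
  rcases hσ with ⟨s, hcyc, hs⟩ | ⟨s, hsn, hs⟩
  · have key : ∀ H, ((∃ s : Finset (Fin n), 2 * s.card = n ∧ partitionStabilizer s = H) ∨
        ∃ s : Finset (Fin n), 3 * s.card < n ∧ smallStabilizer s = H) → σ ∈ H →
        H = partitionStabilizer s := by
      rintro _ (⟨t, ht, rfl⟩ | ⟨t, ht, rfl⟩) hmem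
      · exact partitionStabilizer_eq_of_smul_eq_compl hn hcyc hs hmem ht
      · exact absurd hmem (notMem_smallStabilizer_of_smul_eq_compl hcyc hs ht)
    rw [key H hH hmem, key H' hH' hmem']
  · have key : ∀ H, ((∃ s : Finset (Fin n), 2 * s.card = n ∧ partitionStabilizer s = H) ∨
        ∃ s : Finset (Fin n), 3 * s.card < n ∧ smallStabilizer s = H) → σ ∈ H →
        H = smallStabilizer s := by
      rintro _ (⟨t, ht, rfl⟩ | ⟨t, ht, rfl⟩) hmem
      · exact absurd hmem (hs.notMem_partitionStabilizer hsn ht)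
      · rw [hs.eq_of_mem_smallStabilizer hmem ht]
    rw [key H hH hmem, key H' hH' hmem']

open Classical in
/-- The distinguishing permutations in `H`. -/
noncomputable def distinguishing (H : Subgroup (Perm (Fin n))) : Finset (Perm (Fin n)) :=
  Finset.univ.filter fun σ => IsDistinguishing σ ∧ σ ∈ H

lemma mem_distinguishing {H : Subgroup (Perm (Fin n))} {σ : Perm (Fin n)} :
    σ ∈ distinguishing H ↔ IsDistinguishing σ ∧ σ ∈ H := by
  simp [distinguishing]

lemma mem_distinguishing_partitionStabilizer (hn : 0 < n) {s : Finset (Fin n)}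
    (hs : 2 * s.card = n) {σ : Perm (Fin n)} :
    σ ∈ distinguishing (partitionStabilizer s) ↔ σ.IsCycleOn Set.univ ∧ σ • s = sᶜ := by
  rw [mem_distinguishing]
  refine ⟨?_, fun h => ⟨Or.inl ⟨s, h⟩, Or.inr h.2⟩⟩
  rintro ⟨⟨t, hcyc, -⟩ | ⟨t, htn, ht⟩, hmem⟩
  · refine ⟨hcyc, hmem.resolve_left fun h => ?_⟩
    rcases eq_empty_or_univ_of_isCycleOn_univ hcyc h with rfl | rfl
    · rw [Finset.card_empty] at hs
      omega
    · rw [Finset.card_univ, Fintype.card_fin] at hs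
      omega
  · exact absurd hmem (ht.notMem_partitionStabilizer htn hs)

lemma mem_distinguishing_smallStabilizer {s : Finset (Fin n)}
    (hs : 3 * s.card < n) {σ : Perm (Fin n)} :
    σ ∈ distinguishing (smallStabilizer s) ↔ IsTricycle s σ := by
  rw [mem_distinguishing]
  refine ⟨?_, fun h => ⟨Or.inr ⟨s, hs, h⟩, h.mem_smallStabilizer⟩⟩
  rintro ⟨⟨t, hcyc, ht⟩ | ⟨t, htn, ht⟩, hmem⟩
  · exact absurd hmem (notMem_smallStabilizer_of_smul_eq_compl hcyc ht hs)
  · rwa [ht.eq_of_mem_smallStabilizer hmem hs]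

lemma distinguishing_nonempty (hmod : n % 6 = 0) (hn : 30 < n) {H : Subgroup (Perm (Fin n))}
    (hH : H ∈ standardCover n) : (distinguishing H).Nonempty := by
  rcases mem_standardCover.1 hH with ⟨s, hs, rfl⟩ | ⟨s, hs, rfl⟩
  · obtain ⟨σ, hσ⟩ := exists_isCycleOn_univ_smul_eq_compl hs
    exact ⟨σ, (mem_distinguishing_partitionStabilizer (by omega) hs).2 hσ⟩
  · obtain ⟨σ, hσ⟩ := exists_isTricycle hmod hn hs
    exact ⟨σ, (mem_distinguishing_smallStabilizer hs).2 hσ⟩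

lemma pairwiseDisjoint_distinguishing (hn : 0 < n) :
    (standardCover n : Set (Subgroup (Perm (Fin n)))).PairwiseDisjoint distinguishing := by
  intro H hH H' hH' hne
  refine Finset.disjoint_left.2 fun σ hσ hσ' => hne ?_
  rw [mem_distinguishing] at hσ hσ'
  exact hσ.1.eq_of_mem hn hH' hH hσ'.2 hσ.2

lemma injOn_smallStabilizer (hmod : n % 6 = 0) (hn : 30 < n) :
    Set.InjOn smallStabilizer {s : Finset (Fin n) | 3 * s.card < n} := by
  intro s hs t ht hst
  obtain ⟨σ, hσ⟩ := exists_isTricycle hmod hn hs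
  exact (hσ.eq_of_mem_smallStabilizer (hst ▸ hσ.mem_smallStabilizer) ht).symm

lemma coveringNumber_le_card_standardCover (hmod : n % 6 = 0) (hn : 30 < n) :
    coveringNumber (Perm (Fin n)) ≤ (standardCover n).card := by
  refine Nat.sInf_le ⟨standardCover n, rfl, fun H hH => ?_, fun σ => ?_⟩
  · rcases mem_standardCover.1 hH with ⟨s, hs, rfl⟩ | ⟨s, hs, rfl⟩
    · exact partitionStabilizer_ne_top hmod hn hs
    · rcases s.eq_empty_or_nonempty with rfl | hne
      · rw [smallStabilizer_empty]
        exact alternatingGroup_ne_top (by omega)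
      · rw [smallStabilizer_of_nonempty hne]
        exact stabilizer_ne_top_of_nonempty hne (by omega)
  · rcases exists_mem_cover hmod hn σ with ⟨s, hs, hσ⟩ | ⟨s, hs, hσ⟩
    · exact ⟨_, mem_standardCover.2 (Or.inl ⟨s, hs, rfl⟩), hσ⟩
    · exact ⟨_, mem_standardCover.2 (Or.inr ⟨s, hs, rfl⟩), hσ⟩

/-! ### Maximal subgroups outside the standard cover -/

lemma natCard_lt_card_distinguishing (hmod : n % 6 = 0) (hn : 30 < n)
    {M : Subgroup (Perm (Fin n))} (hT : MulAction.IsPretransitive M (Fin n)) (hM : IsCoatom M)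
    (hMc : M ∉ standardCover n) {H : Subgroup (Perm (Fin n))} (hH : H ∈ standardCover n) :
    Nat.card M < (distinguishing H).card := by
  have h := natCard_mul_lt_of_isPretransitive hmod hn hM
    (fun h => hMc (mem_standardCover.2 (Or.inr ⟨∅, by rw [Finset.card_empty]; omega, by
      rw [smallStabilizer_empty, h]⟩)))
    fun s hs h => hMc (mem_standardCover.2 (Or.inl ⟨s, hs, h.symm⟩))
  rcases mem_standardCover.1 hH with ⟨s, hs, rfl⟩ | ⟨s, hs, rfl⟩
  · have h1 := h.2.trans_le (factorial_le_mul_card_swap (by omega) hs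
      (distinguishing (partitionStabilizer s))
      fun σ => mem_distinguishing_partitionStabilizer (by omega) hs)
    rw [mul_comm] at h1
    exact lt_of_mul_lt_mul_left h1 (Nat.zero_le _)
  · have h1 := h.1.trans_le (factorial_le_mul_card_isTricycle hn hmod hs
      (distinguishing (smallStabilizer s)) fun σ => mem_distinguishing_smallStabilizer hs)
    rw [mul_comm] at h1
    exact lt_of_mul_lt_mul_left h1 (Nat.zero_le _)

lemma exists_eq_stabilizer_of_not_isPretransitive {M : Subgroup (Perm (Fin n))}
    (hM : IsCoatom M) (hT : ¬ MulAction.IsPretransitive M (Fin n)) :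
    ∃ t : Finset (Fin n), t.Nonempty ∧ 2 * t.card ≤ n ∧
      M = MulAction.stabilizer (Perm (Fin n)) t := by
  classical
  obtain ⟨x, hx⟩ : ∃ x, MulAction.orbit M x ≠ Set.univ := by
    by_contra! h
    refine hT ⟨fun x y => ?_⟩
    have := Set.mem_univ y
    rwa [← h x] at this
  have hMt : ∀ g ∈ M, g • (MulAction.orbit M x).toFinset = (MulAction.orbit M x).toFinset := by
    intro g hg
    refine Finset.coe_injective ?_
    rw [Finset.coe_smul_finset, Set.coe_toFinset]
    exact MulAction.smul_orbit (⟨g, hg⟩ : M) x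
  obtain ⟨t, ht⟩ : ∃ t, t = (MulAction.orbit M x).toFinset := ⟨_, rfl⟩
  rw [← ht] at hMt
  have hne : t.Nonempty := ⟨x, by rw [ht, Set.mem_toFinset]; exact MulAction.mem_orbit_self x⟩
  have hne' : tᶜ.Nonempty := by
    rw [Finset.nonempty_iff_ne_empty, Ne, Finset.compl_eq_empty_iff]
    rintro rfl
    exact hx (Set.toFinset_eq_univ.1 ht.symm)
  have hcard : t.card + tᶜ.card = n := by rw [Finset.card_add_card_compl, Fintype.card_fin]
  have hpos := hne.card_pos
  have hpos' := hne'.card_pos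
  have hof : ∀ t : Finset (Fin n), t.Nonempty → t.card < n → (∀ g ∈ M, g • t = t) →
      M = MulAction.stabilizer (Perm (Fin n)) t := fun t hne hlt hMt => by
    refine (show M ≤ MulAction.stabilizer (Perm (Fin n)) t from fun g hg =>
      MulAction.mem_stabilizer_iff.2 (hMt g hg)).eq_or_lt.resolve_right fun h => ?_
    exact stabilizer_ne_top_of_nonempty hne hlt (hM.2 _ h)
  rcases le_total (2 * t.card) n with h | h
  · exact ⟨t, hne, h, hof t hne (by omega) hMt⟩
  · exact ⟨tᶜ, hne', by omega, hof _ hne' (by omega) fun g hg => by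
      rw [perm_smul_compl, hMt g hg]⟩

open Classical in
lemma sum_div_lt_one_of_not_isPretransitive (hmod : n % 6 = 0) (hn : 30 < n)
    {M : Subgroup (Perm (Fin n))} (hT : ¬ MulAction.IsPretransitive M (Fin n)) (hM : IsCoatom M)
    (hMc : M ∉ standardCover n) :
    ∑ H ∈ standardCover n,
      (((distinguishing H).filter (· ∈ M)).card / (distinguishing H).card : ℚ) < 1 := by
  obtain ⟨t, hne, ht, hMt⟩ := exists_eq_stabilizer_of_not_isPretransitive hM hT
  have ht3 : n ≤ 3 * t.card := by
    by_contra! h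
    exact hMc (mem_standardCover.2
      (Or.inr ⟨t, h, (smallStabilizer_of_nonempty hne).trans hMt.symm⟩))
  have ht2 : 2 * t.card ≠ n := fun h => by
    refine hMc (mem_standardCover.2 (Or.inl ⟨t, h, ?_⟩))
    rw [hMt] at hM ⊢
    refine ((show MulAction.stabilizer (Perm (Fin n)) t ≤ partitionStabilizer t from fun g hg =>
      Or.inl hg).eq_or_lt.resolve_right fun hlt => ?_).symm
    exact partitionStabilizer_ne_top hmod hn h (hM.2 _ hlt)
  rw [standardCover, ← Finset.sum_subset Finset.subset_union_right fun H hH hH' => ?_,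
    Finset.sum_image fun s hs s' hs' => ?_]
  · refine lt_of_le_of_lt (Finset.sum_le_sum fun s hs => le_of_eq ?_)
      (sum_tricycleProportion_lt_one hmod hn ht3 (lt_of_le_of_ne ht ht2))
    have hs := (Finset.mem_filter.1 hs).2
    rw [tricycleProportion]
    congr 3 <;> ext σ <;> simp [mem_distinguishing_smallStabilizer hs, hMt]
  · exact injOn_smallStabilizer hmod hn (by simpa using hs) (by simpa using hs')
  · obtain ⟨s, hs, rfl⟩ := Finset.mem_image.1 ((Finset.mem_union.1 hH).resolve_right hH')
    rw [Finset.card_eq_zero.2 (Finset.eq_empty_of_forall_notMem fun σ hσ => ?_), Nat.cast_zero,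
      zero_div]
    obtain ⟨hσ, hσt⟩ := Finset.mem_filter.1 hσ
    rw [hMt] at hσt
    rw [mem_distinguishing_partitionStabilizer (by omega) (Finset.mem_filter.1 hs).2] at hσ
    rcases eq_empty_or_univ_of_isCycleOn_univ hσ.1 hσt with rfl | rfl
    · exact Finset.not_nonempty_empty hne
    · rw [Finset.card_univ, Fintype.card_fin] at ht
      omega

end StandardCover

end Permutations

/-- Theorem 3.1 (uniqueness): for `n ≡ 0 (mod 6)` with `n > 30`, any minimal cover of `S_n`
by maximal subgroups consists precisely of `A_n`, the stabilizers of partitions into two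
blocks of size `n/2`, and the setwise stabilizers of subsets of size between `1` and
`n/3 − 1`. -/
theorem minimal_cover_unique (n : ℕ) (hmod : n % 6 = 0) (hn : 30 < n)
    (𝒞 : Finset (Subgroup (Equiv.Perm (Fin n))))
    (hmax : ∀ H ∈ 𝒞, IsCoatom H)
    (hcover : ∀ g : Equiv.Perm (Fin n), ∃ H ∈ 𝒞, g ∈ H)
    (hcard : 𝒞.card = coveringNumber (Equiv.Perm (Fin n))) :
    ∀ H : Subgroup (Equiv.Perm (Fin n)),
      H ∈ 𝒞 ↔
        H = alternatingGroup (Fin n) ∨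
        (∃ s : Finset (Fin n), s.card = n / 2 ∧ H = partitionStabilizer s) ∨
        (∃ s : Finset (Fin n), 1 ≤ s.card ∧ s.card ≤ n / 3 - 1 ∧
          H = MulAction.stabilizer (Equiv.Perm (Fin n)) s) := by
  classical
  have h𝒞 : 𝒞 = standardCover n := by
    refine eq_of_cover_of_sum_lt_one (P := distinguishing)
      (fun H hH => distinguishing_nonempty hmod hn hH) (fun H hH σ hσ H' hH' hσ' => ?_) hcover
      (hcard.trans_le (coveringNumber_le_card_standardCover hmod hn)) fun M hM hMc => ?_
    · rw [mem_distinguishing] at hσ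
      exact hσ.1.eq_of_mem (by omega) hH hH' hσ.2 hσ'
    · by_cases hT : MulAction.IsPretransitive M (Fin n)
      · exact sum_div_lt_one_of_card_lt (pairwiseDisjoint_distinguishing (by omega))
          fun H hH => natCard_lt_card_distinguishing hmod hn hT (hmax M hM) hMc hH
      · exact sum_div_lt_one_of_not_isPretransitive hmod hn hT (hmax M hM) hMc
  intro H
  rw [h𝒞, mem_standardCover]
  constructor
  · rintro (⟨s, hs, rfl⟩ | ⟨s, hs, rfl⟩)
    · exact Or.inr (Or.inl ⟨s, by omega, rfl⟩)
    · rcases s.eq_empty_or_nonempty with rfl | hne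
      · exact Or.inl smallStabilizer_empty
      · exact Or.inr (Or.inr ⟨s, hne.card_pos, by omega, smallStabilizer_of_nonempty hne⟩)
  · rintro (rfl | ⟨s, hs, rfl⟩ | ⟨s, hs, hs', rfl⟩)
    · exact Or.inr ⟨∅, by rw [Finset.card_empty]; omega, smallStabilizer_empty⟩
    · exact Or.inl ⟨s, by omega, rfl⟩
    · exact Or.inr ⟨s, by omega, smallStabilizer_of_nonempty (Finset.card_pos.1 hs)⟩
end

section
/- Let n ≡ 0 (mod 6) with n ≥ 6. Then every permutation g ∈ S_n satisfies at least one of the following: (i) g is an even permutation (g ∈ A_n); (ii) there exists a subset s of Fin n with 1 ≤ |s| ≤ n/3 − 1 and g(s) = s; (iii) there exists a subset s of Fin n with |s| = n/2 and either g(s) = s or g(s) = sᶜ. In other words, the collection 𝓗 of subgroups consisting of A_n, the setwise stabilizers of subsets of size between 1 and n/3 − 1, and the stabilizers of partitions into two blocks of size n/2, covers S_n. -/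
open Pointwise

/-- If every cycle of a fixed-point-free permutation has even length, then some finset is mapped
onto its complement. -/
theorem exists_smul_eq_compl_of_even_cycleOf {α : Type*} [Fintype α] [DecidableEq α]
    (g : Equiv.Perm α) (hfix : ∀ x, g x ≠ x)
    (heven : ∀ x, Even (g.cycleOf x).support.card) :
    ∃ s : Finset α, g • s = sᶜ := by
  classical
  have hpow (x : α) (j : ℤ) (hj : (g ^ j) x = x) : Even j := by
    have hc : (g.cycleOf x).IsCycle := g.isCycle_cycleOf (hfix x)
    have h1 : (g.cycleOf x ^ j) x = x := by
      rw [Equiv.Perm.cycleOf_zpow_apply_self, hj]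
    have h2 : (g.cycleOf x ^ j.natAbs) x = x := by
      rcases Int.natAbs_eq j with h | h
      · rw [h, zpow_natCast] at h1
        exact h1
      · rw [h, zpow_neg, zpow_natCast, Equiv.Perm.inv_eq_iff_eq] at h1
        exact h1.symm
    have h3 : g.cycleOf x ^ j.natAbs = 1 :=
      hc.pow_eq_one_iff.2 ⟨x, by rw [Equiv.Perm.cycleOf_apply_self]; exact hfix x, h2⟩
    have h4 := orderOf_dvd_of_pow_eq_one h3
    rw [hc.orderOf] at h4
    exact Int.natAbs_even.1 ((heven x).trans_dvd h4)
  let r : α → α := fun x => (Quotient.mk (Equiv.Perm.SameCycle.setoid g) x).out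
  have hr (x : α) : g.SameCycle (r x) x :=
    Quotient.exact (Quotient.out_eq (Quotient.mk (Equiv.Perm.SameCycle.setoid g) x))
  choose k hk using hr
  have hrg (x : α) : r (g x) = r x := by
    have : Quotient.mk (Equiv.Perm.SameCycle.setoid g) (g x) =
        Quotient.mk (Equiv.Perm.SameCycle.setoid g) x :=
      Quotient.sound (Equiv.Perm.sameCycle_apply_left.2 (Equiv.Perm.SameCycle.refl g x))
    simp only [r, this]
  have hkg (x : α) : Even (k (g x)) ↔ ¬ Even (k x) := by
    have h1 : (g ^ (k (g x))) (r x) = (g ^ (1 + k x)) (r x) := by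
      rw [zpow_add, zpow_one, Equiv.Perm.mul_apply, hk x, ← hrg x, hk (g x)]
    have h2 : (g ^ (-(1 + k x) + k (g x))) (r x) = r x := by
      rw [zpow_add, Equiv.Perm.mul_apply, h1, ← Equiv.Perm.mul_apply, ← zpow_add]
      simp
    have h3 := hpow _ _ h2
    grind
  refine ⟨Finset.univ.filter fun x => Even (k x), ?_⟩
  ext y
  obtain ⟨x, rfl⟩ := g.surjective y
  rw [← Equiv.Perm.smul_def, Finset.smul_mem_smul_finset_iff]
  simp only [Finset.mem_compl, Finset.mem_filter_univ, Equiv.Perm.smul_def, hkg, not_not]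

/-- The support of the cycle through a point is invariant. -/
theorem smul_support_cycleOf {α : Type*} [Fintype α] [DecidableEq α]
    (g : Equiv.Perm α) (x : α) :
    g • (g.cycleOf x).support = (g.cycleOf x).support := by
  ext y
  obtain ⟨z, rfl⟩ := g.surjective y
  rw [← Equiv.Perm.smul_def, Finset.smul_mem_smul_finset_iff]
  rw [Equiv.Perm.smul_def, Equiv.Perm.mem_support_cycleOf_iff, Equiv.Perm.mem_support_cycleOf_iff,
    Equiv.Perm.sameCycle_apply_right]

/-- A multiset of odd size with sum `6 * m` and all entries at least `2 * m > 0` has only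
even entries. -/
theorem Multiset.even_of_odd_card_of_two_mul_le (M : Multiset ℕ) (m : ℕ) (hm : 0 < m)
    (hsum : M.sum = 6 * m) (hodd : Odd M.card) (hle : ∀ a ∈ M, 2 * m ≤ a) :
    ∀ a ∈ M, Even a := by
  have h1 : M.card • (2 * m) ≤ M.sum := Multiset.card_nsmul_le_sum hle
  rw [hsum, smul_eq_mul] at h1
  have h2 : M.card ≤ 3 := by
    by_contra! h
    nlinarith
  have h3 : M.card = 1 ∨ M.card = 3 := by
    obtain ⟨t, ht⟩ := hodd
    omega
  rcases h3 with h | h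
  · obtain ⟨a, rfl⟩ := Multiset.card_eq_one.1 h
    simp at hsum ⊢
    grind
  · obtain ⟨a, b, c, rfl⟩ := Multiset.card_eq_three.1 h
    simp at hsum hle ⊢
    grind

/-- Lemma 2.3: for `n ≡ 0 (mod 6)`, every permutation of `Fin n` is even, or stabilizes
a subset of size between `1` and `n/3 − 1`, or stabilizes a partition of `Fin n` into
two blocks of size `n/2`; i.e. the collection `𝓗` covers `S_n`. -/
theorem H_is_cover (n : ℕ) (hmod : n % 6 = 0) (hn : 6 ≤ n) (g : Equiv.Perm (Fin n)) :
    g ∈ alternatingGroup (Fin n) ∨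
    (∃ s : Finset (Fin n), 1 ≤ s.card ∧ s.card ≤ n / 3 - 1 ∧ g • s = s) ∨
    (∃ s : Finset (Fin n), s.card = n / 2 ∧ (g • s = s ∨ g • s = sᶜ)) := by
  by_cases hA : g ∈ alternatingGroup (Fin n)
  · exact Or.inl hA
  by_cases hB : ∃ s : Finset (Fin n), 1 ≤ s.card ∧ s.card ≤ n / 3 - 1 ∧ g • s = s
  · exact Or.inr (Or.inl hB)
  refine Or.inr (Or.inr ?_)
  obtain ⟨m, rfl⟩ : ∃ m, n = 6 * m := ⟨n / 6, by omega⟩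
  have hfix (x : Fin (6 * m)) : g x ≠ x := fun hx =>
    hB ⟨{x}, by simp, by simp; omega, by simp [hx]⟩
  have hmem (x : Fin (6 * m)) : (g.cycleOf x).support.card ∈ g.cycleType := by
    rw [Equiv.Perm.cycleType_def]
    exact Multiset.mem_map_of_mem _ (Finset.mem_def.1
      (Equiv.Perm.cycleOf_mem_cycleFactorsFinset_iff.2 (Equiv.Perm.mem_support.2 (hfix x))))
  have hle : ∀ a ∈ g.cycleType, 2 * m ≤ a := by
    intro a ha
    have ha2 := Equiv.Perm.two_le_of_mem_cycleType ha
    rw [Equiv.Perm.cycleType_def] at ha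
    obtain ⟨c, hc, rfl⟩ := Multiset.mem_map.1 ha
    simp only [Function.comp_apply] at ha2 ⊢
    obtain ⟨x, hx⟩ := Finset.card_pos.1 (by omega : 0 < c.support.card)
    have hcx := Equiv.Perm.cycle_is_cycleOf hx hc
    by_contra! hlt
    exact hB ⟨c.support, by omega, by omega, by rw [hcx, smul_support_cycleOf]⟩
  have hsum : g.cycleType.sum = 6 * m := by
    have : g.support = Finset.univ := by
      ext x
      simp [hfix x]
    rw [Equiv.Perm.sum_cycleType, this, Finset.card_univ, Fintype.card_fin]
  have hodd : Odd g.cycleType.card := by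
    by_contra h
    refine hA (Equiv.Perm.mem_alternatingGroup.2 ?_)
    rw [Equiv.Perm.sign_of_cycleType, hsum]
    exact Even.neg_one_pow (by grind)
  have heven := Multiset.even_of_odd_card_of_two_mul_le _ m (by omega) hsum hodd hle
  obtain ⟨s, hs⟩ := exists_smul_eq_compl_of_even_cycleOf g hfix fun x => heven _ (hmem x)
  refine ⟨s, ?_, Or.inr hs⟩
  have h := congrArg Finset.card hs
  rw [Finset.card_smul_finset, Finset.card_compl, Fintype.card_fin] at h
  have := s.card_le_univ
  rw [Fintype.card_fin] at this
  omega
end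

section
/- Let n ≡ 0 (mod 6) with n > 30, and let 𝒞 be a finite collection of proper subgroups of S_n whose union is all of S_n and whose cardinality equals the covering number σ(S_n). Then the alternating group A_n belongs to 𝒞. -/
open Pointwise

section

open Equiv Equiv.Perm MulAction

theorem isThreeCycle_commutator_s8 {α : Type*} [Fintype α] [DecidableEq α] {g h : Perm α} {a : α}
    (hg : g a ≠ a) (hh : h a ≠ a) (hgh : ∀ x, x ≠ a → g x = x ∨ h x = x) :
    (g * h * g⁻¹ * h⁻¹).IsThreeCycle := by
  have hga : h (g a) = g a := (hgh _ hg).resolve_left (fun e ↦ hg (g.injective e))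
  have hha : g (h a) = h a := (hgh _ hh).resolve_right (fun e ↦ hh (h.injective e))
  have hne : g a ≠ h a := fun e ↦ hg (g.injective (by rw [e, hha]))
  have key : ∀ y, g (h y) ≠ h (g y) ↔ y = a ∨ h y = a ∨ g y = a := by
    intro y
    constructor
    · intro hy
      by_contra! hc
      obtain ⟨h1, h2, h3⟩ := hc
      rcases hgh y h1 with e | e
      · rcases hgh _ h2 with e' | e'
        · exact hy (by rw [e, e'])
        · have := h.injective e'
          exact hy (by rw [e, this, e])
      · rcases hgh _ h3 with e' | e'
        · have := g.injective e'
          exact hy (by rw [e, this, e])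
        · exact hy (by rw [e, e'])
    · rintro (rfl | e | e)
      · rw [hga, hha]; exact hne.symm
      · have hya : y ≠ a := by rintro rfl; exact hh e
        have : g y = y := (hgh y hya).resolve_right (fun e' ↦ hya (e'.symm.trans e))
        rw [this, e]; exact hg
      · have hya : y ≠ a := by rintro rfl; exact hg e
        have : h y = y := (hgh y hya).resolve_left (fun e' ↦ hya (e'.symm.trans e))
        rw [this, e]; exact hh.symm
  rw [← card_support_eq_three_iff]
  have : (g * h * g⁻¹ * h⁻¹).support = {a, g a, h a} := by
    ext x
    obtain ⟨y, rfl⟩ : ∃ y, x = h (g y) := ⟨g⁻¹ (h⁻¹ x), by simp⟩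
    have hx : (g * h * g⁻¹ * h⁻¹) (h (g y)) = g (h y) := by simp
    simp only [mem_support, hx, key, Finset.mem_insert, Finset.mem_singleton]
    constructor
    · rintro (rfl | e | e)
      · exact Or.inr (Or.inl hga)
      · have hya : y ≠ a := by rintro rfl; exact hh e
        have : g y = y := (hgh y hya).resolve_right (fun e' ↦ hya (e'.symm.trans e))
        exact Or.inl (by rw [this, e])
      · exact Or.inr (Or.inr (by rw [e]))
    · rintro (e | e | e)
      · have hgy : g y ≠ a := by intro e'; rw [e'] at e; exact hh e
        have : g (g y) = g y := (hgh _ hgy).resolve_right (fun e' ↦ hgy (e'.symm.trans e))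
        rw [g.injective this] at e
        exact Or.inr (Or.inl e)
      · rw [← hga] at e
        exact Or.inl (g.injective (h.injective e))
      · exact Or.inr (Or.inr (h.injective e))
  rw [this, Finset.card_eq_three]
  exact ⟨a, g a, h a, hg.symm, hh.symm, hne, rfl⟩

/-- Bochert's bound on the order of a primitive permutation group. -/
theorem card_mul_factorial_le_of_isPreprimitive_s8 {α : Type*} [Fintype α] [DecidableEq α]
    {G : Subgroup (Perm α)} (hG : IsPreprimitive G α) (hA : ¬ alternatingGroup α ≤ G) :
    Nat.card G * (Fintype.card α - Fintype.card α / 2).factorial ≤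
      (Fintype.card α).factorial := by
  classical
  let S : Finset (Finset α) :=
    Finset.univ.filter fun Δ ↦ ∀ g ∈ G, (∀ x ∈ Δ, g x = x) → g = 1
  have hS : S.Nonempty :=
    ⟨Finset.univ, by simp only [S, Finset.mem_filter, Finset.mem_univ, true_and]
                     exact fun g _ hg ↦ Perm.ext fun x ↦ hg x trivial⟩
  obtain ⟨Δ, hΔ, hmin⟩ := S.exists_min_image Finset.card hS
  have hbase : ∀ g ∈ G, (∀ x ∈ Δ, g x = x) → g = 1 := (Finset.mem_filter.1 hΔ).2
  have hsmall : ∀ Γ : Finset α, Γ.card < Δ.card → ∃ g ∈ G, (∀ x ∈ Γ, g x = x) ∧ g ≠ 1 := by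
    intro Γ hΓ
    by_contra! hc
    exact absurd (hmin Γ (Finset.mem_filter.2 ⟨Finset.mem_univ _, hc⟩)) (by omega)
  have hcard : Δ.card ≤ Fintype.card α / 2 := by
    by_contra! hlt
    obtain ⟨g, hgG, hg, hg1⟩ := hsmall Δᶜ (by rw [Finset.card_compl]; omega)
    obtain ⟨a, ha⟩ : ∃ a, g a ≠ a := by
      by_contra! hc
      exact hg1 (Perm.ext hc)
    have haΔ : a ∈ Δ := by
      by_contra hc
      exact ha (hg a (Finset.mem_compl.2 hc))
    obtain ⟨h, hhG, hh, hh1⟩ := hsmall (Δ.erase a) (Finset.card_erase_lt_of_mem haΔ)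
    have hha : h a ≠ a := by
      intro e
      refine hh1 (hbase h hhG fun x hx ↦ ?_)
      rcases eq_or_ne x a with rfl | hxa
      · exact e
      · exact hh x (Finset.mem_erase.2 ⟨hxa, hx⟩)
    refine hA (alternatingGroup_le_of_isPreprimitive_of_isThreeCycle_mem hG
      (isThreeCycle_commutator_s8 ha hha fun x hx ↦ ?_)
      (G.mul_mem (G.mul_mem (G.mul_mem hgG hhG) (G.inv_mem hgG)) (G.inv_mem hhG)))
    by_cases hxΔ : x ∈ Δ
    · exact Or.inr (hh x (Finset.mem_erase.2 ⟨hx, hxΔ⟩))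
    · exact Or.inl (hg x (Finset.mem_compl.2 hxΔ))
  have hinj : Function.Injective
      fun g : G ↦ (Function.Embedding.subtype (· ∈ Δ)).trans (g : Perm α).toEmbedding := by
    intro g g' e
    have he : ∀ x ∈ Δ, (g : Perm α) x = (g' : Perm α) x := fun x hx ↦
      DFunLike.congr_fun e (⟨x, hx⟩ : {x // x ∈ Δ})
    have := hbase ((g' : Perm α)⁻¹ * g) (G.mul_mem (G.inv_mem g'.2) g.2) fun x hx ↦ by
      simp [he x hx]
    exact Subtype.ext (inv_mul_eq_one.1 this).symm
  have hle := Nat.card_le_card_of_injective _ hinj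
  rw [Nat.card_eq_fintype_card (α := _ ↪ _), Fintype.card_embedding_eq, Fintype.card_coe] at hle
  calc Nat.card G * (Fintype.card α - Fintype.card α / 2).factorial
      ≤ (Fintype.card α).descFactorial Δ.card * (Fintype.card α - Δ.card).factorial :=
        Nat.mul_le_mul hle (Nat.factorial_le (by omega))
    _ = (Fintype.card α).factorial := by
        rw [mul_comm, Nat.factorial_mul_descFactorial Δ.card_le_univ]

theorem ncard_dvd_ncard_of_isBlock_of_isCycleOn {α : Type*} {G : Subgroup (Perm α)} {B s : Set α}
    (hB : IsBlock G B) (hne : B.Nonempty) (hBs : B ⊆ s) {g : Perm α} (hgG : g ∈ G)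
    (hg : g.IsCycleOn s) : B.ncard ∣ s.ncard := by
  obtain ⟨x, hx⟩ := hne
  have horb : orbit (Subgroup.zpowers g) x = s := by
    rw [← hg.range_zpow (hBs hx)]
    ext y
    constructor
    · rintro ⟨⟨_, i, rfl⟩, rfl⟩
      exact ⟨i, rfl⟩
    · rintro ⟨i, rfl⟩
      exact ⟨⟨_, i, rfl⟩, rfl⟩
  have hBz : IsBlock (Subgroup.zpowers g) B := fun a b hab ↦
    hB (g₁ := ⟨a, Subgroup.zpowers_le.2 hgG a.2⟩) (g₂ := ⟨b, Subgroup.zpowers_le.2 hgG b.2⟩) hab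
  let j : orbit (Subgroup.zpowers g) x →ₑ[(id : Subgroup.zpowers g → Subgroup.zpowers g)] α :=
    ⟨Subtype.val, fun _ _ ↦ rfl⟩
  have hBj : IsBlock (Subgroup.zpowers g) (j ⁻¹' B) :=
    IsBlock.preimage (φ := MonoidHom.id (Subgroup.zpowers g)) j hBz
  have hdvd := hBj.ncard_dvd_card ⟨⟨x, mem_orbit_self x⟩, hx⟩
  have himg : (j ⁻¹' B).ncard = B.ncard := by
    rw [← Set.ncard_image_of_injective (j ⁻¹' B) (f := j) Subtype.val_injective]
    congr 1
    rw [Set.image_preimage_eq_iff]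
    intro y hy
    exact ⟨⟨y, horb ▸ hBs hy⟩, rfl⟩
  rwa [himg, Nat.card_coe_set_eq, horb] at hdvd

theorem isPreprimitive_of_isCycleOn_of_isCycleOn_compl {α : Type*} [Fintype α] [DecidableEq α]
    {G : Subgroup (Perm α)} (hG : IsPretransitive G α) {A : Finset α} {g : Perm α} (hgG : g ∈ G)
    (hg : g.IsCycleOn A) (hg' : g.IsCycleOn (Aᶜ : Finset α))
    (hcop : A.card.Coprime (Fintype.card α)) : IsPreprimitive G α := by
  refine ⟨fun {B} hB ↦ ?_⟩
  have hcop' : Aᶜ.card.Coprime (Fintype.card α) := by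
    rwa [Finset.card_compl, Nat.coprime_self_sub_left A.card_le_univ]
  have hcopc : A.card.Coprime Aᶜ.card := by
    rwa [Finset.card_compl, Nat.coprime_sub_self_right A.card_le_univ]
  have hone : ∀ s : Finset α, g.IsCycleOn s → s.card.Coprime (Fintype.card α) →
      B.Nonempty → B ⊆ s → IsTrivialBlock B := by
    intro s hs hsc hne hBs
    have h1 := ncard_dvd_ncard_of_isBlock_of_isCycleOn hB hne hBs hgG hs
    have h2 := hB.ncard_dvd_card hne
    rw [Set.ncard_coe_finset] at h1
    rw [Nat.card_eq_fintype_card] at h2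
    have h3 := Nat.eq_one_of_dvd_coprimes hsc h1 h2
    exact Or.inl (Set.ncard_le_one_iff_subsingleton.1 h3.le)
  rcases B.eq_empty_or_nonempty with rfl | hne
  · exact Or.inl Set.subsingleton_empty
  by_cases hBA : B ⊆ A
  · exact hone A hg hcop hne hBA
  by_cases hBA' : B ⊆ (Aᶜ : Finset α)
  · exact hone _ hg' hcop' hne hBA'
  obtain ⟨y, hyB, hy⟩ := Set.not_subset.1 hBA
  obtain ⟨x, hxB, hx⟩ := Set.not_subset.1 hBA'
  replace hy : y ∈ Aᶜ := by simpa using hy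
  replace hx : x ∈ A := by simpa using hx
  let γ : G := ⟨g, hgG⟩
  have hstab : ∀ (k : ℕ) (z : α), z ∈ B → (g ^ k) z = z → γ ^ k ∈ stabilizer G B := by
    intro k z hz hk
    refine hB.smul_eq_of_nonempty ⟨z, ?_, hz⟩
    exact ⟨z, hz, hk⟩
  have h1 := hstab _ x hxB (hg.pow_card_apply hx)
  have h2 := hstab _ y hyB (hg'.pow_card_apply hy)
  have hγ : γ ∈ stabilizer G B := by
    have hb := Nat.gcd_eq_gcd_ab A.card Aᶜ.card
    rw [hcopc.gcd_eq_one, Nat.cast_one] at hb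
    have : γ = (γ ^ A.card) ^ (A.card.gcdA Aᶜ.card) * (γ ^ Aᶜ.card) ^ (A.card.gcdB Aᶜ.card) := by
      rw [← zpow_natCast, ← zpow_natCast, ← zpow_mul, ← zpow_mul, ← zpow_add, ← hb, zpow_one]
    rw [this]
    exact Subgroup.mul_mem _ (Subgroup.zpow_mem _ h1 _) (Subgroup.zpow_mem _ h2 _)
  have hsub : ∀ z ∈ B, ∀ w, g.SameCycle z w → w ∈ B := by
    rintro z hz w ⟨i, rfl⟩
    have : γ ^ i ∈ stabilizer G B := Subgroup.zpow_mem _ hγ i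
    rw [← mem_stabilizer_iff.1 this]
    exact ⟨z, hz, rfl⟩
  refine Or.inr (Set.eq_univ_of_forall fun z ↦ ?_)
  by_cases hz : z ∈ A
  · exact hsub x hxB z (hg.2 hx hz)
  · exact hsub y hyB z (hg'.2 hy (by simpa using hz))

/-- The permutations having `A` and its complement as their two cycles. -/
noncomputable def twoCyclePerms {α : Type*} [Fintype α] [DecidableEq α] (A : Finset α) :
    Finset (Perm α) := by
  classical
  exact Finset.univ.filter fun g ↦ g.IsCycleOn A ∧ g.IsCycleOn (Aᶜ : Finset α)

section TwoCycles

variable {α : Type*} [Fintype α] [DecidableEq α]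

theorem mem_twoCyclePerms {A : Finset α} {g : Perm α} :
    g ∈ twoCyclePerms A ↔ g.IsCycleOn A ∧ g.IsCycleOn (Aᶜ : Finset α) := by
  simp [twoCyclePerms]

theorem card_twoCyclePerms_le {A A' : Finset α} (h : A.card = A'.card) :
    (twoCyclePerms A).card ≤ (twoCyclePerms A').card := by
  obtain ⟨σ, hσ⟩ : ∃ σ : Perm α, A.image σ = A' := by
    let e : {x // x ∈ A} ≃ {x // x ∈ A'} := Finset.equivOfCardEq h
    refine ⟨e.extendSubtype, Finset.eq_of_subset_of_card_le ?_ ?_⟩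
    · intro y hy
      obtain ⟨x, hx, rfl⟩ := Finset.mem_image.1 hy
      exact e.extendSubtype_mem x hx
    · rw [Finset.card_image_of_injective _ (Equiv.injective _), h]
  refine Finset.card_le_card_of_injOn (fun g ↦ σ * g * σ⁻¹) ?_ ?_
  · intro g hg
    rw [Finset.mem_coe, mem_twoCyclePerms] at hg
    rw [Finset.mem_coe, mem_twoCyclePerms]
    have h1 := hg.1.conj (g := σ)
    have h2 := hg.2.conj (g := σ)
    refine ⟨?_, ?_⟩
    · rwa [← Finset.coe_image, hσ] at h1
    · rwa [Finset.coe_compl, Set.image_compl_eq σ.bijective, ← Finset.coe_image, hσ,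
        ← Finset.coe_compl] at h2
  · intro g _ g' _ e
    exact mul_left_cancel (mul_right_cancel e)

theorem card_twoCyclePerms_eq {A A' : Finset α} (h : A.card = A'.card) :
    (twoCyclePerms A).card = (twoCyclePerms A').card :=
  (card_twoCyclePerms_le h).antisymm (card_twoCyclePerms_le h.symm)

theorem eq_of_sameCycle_imp {A A' : Finset α} (hne : A.Nonempty)
    (hcard : A'.card = A.card) (hhalf : A.card ≠ Aᶜ.card) {c : Perm α} (hc : c ∈ twoCyclePerms A')
    (hinv : ∀ x y, c.SameCycle x y → (x ∈ A ↔ y ∈ A)) : A' = A := by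
  rw [mem_twoCyclePerms] at hc
  have hsub : ∀ s : Finset α, c.IsCycleOn s → s ⊆ A ∨ s ⊆ Aᶜ := by
    intro s hs
    by_contra! hcon
    obtain ⟨x, hx, hxA⟩ := Finset.not_subset.1 hcon.1
    obtain ⟨y, hy, hyA⟩ := Finset.not_subset.1 hcon.2
    exact hxA ((hinv x y (hs.2 hx hy)).2 (by simpa using hyA))
  rcases hsub A' hc.1 with h | h
  · exact Finset.eq_of_subset_of_card_le h hcard.ge
  · exfalso
    have h1 : A ⊆ A'ᶜ := Finset.subset_compl_comm.1 h
    have h2 : A'ᶜ ⊆ A := by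
      refine (hsub _ hc.2).resolve_right fun h3 ↦ ?_
      obtain ⟨x, hx⟩ := hne
      exact (Finset.mem_compl.1 (h3 (h1 hx))) hx
    have h3 := congrArg Finset.card (h1.antisymm h2)
    rw [Finset.card_compl, hcard, ← Finset.card_compl] at h3
    exact hhalf h3

theorem mem_iff_mem_of_mem_twoCyclePerms {A : Finset α} {g : Perm α} (hg : g ∈ twoCyclePerms A)
    (x y : α) (hxy : g.SameCycle x y) : x ∈ A ↔ y ∈ A := by
  obtain ⟨h1, h2⟩ := mem_twoCyclePerms.1 hg
  obtain ⟨i, rfl⟩ := hxy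
  constructor
  · exact fun hx ↦ (h1.1.perm_zpow i).mapsTo hx
  · intro hy
    by_contra hx
    have := (h2.1.perm_zpow i).mapsTo (show x ∈ ((Aᶜ : Finset α) : Set α) by simpa using hx)
    exact Finset.mem_compl.1 this hy

theorem pairwiseDisjoint_twoCyclePerms {k : ℕ} (hk : 0 < k) (hk' : 2 * k < Fintype.card α) :
    Set.PairwiseDisjoint (Finset.powersetCard k (Finset.univ : Finset α) : Set (Finset α))
      twoCyclePerms := by
  intro A hA A' hA' hne
  rw [Finset.mem_coe, Finset.mem_powersetCard_univ] at hA hA'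
  rw [Function.onFun, Finset.disjoint_left]
  intro g hg hg'
  refine hne (eq_of_sameCycle_imp (Finset.card_pos.1 (by omega)) (by omega) ?_ hg'
    (mem_iff_mem_of_mem_twoCyclePerms hg)).symm
  rw [Finset.card_compl]; omega

theorem factorial_mul_factorial_le_card_twoCyclePerms {k : ℕ} (hk : 2 ≤ k)
    (hk' : 2 * k < Fintype.card α) {A : Finset α} (hA : A.card = k) :
    (k - 1).factorial * (Fintype.card α - k - 1).factorial ≤ (twoCyclePerms A).card := by
  have hkn : k ≠ Fintype.card α - k := by omega
  have hcount := card_of_cycleType_mul_eq α {k, Fintype.card α - k}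
  rw [if_pos ⟨by simp; omega, by simp; omega⟩] at hcount
  have hsum : ({k, Fintype.card α - k} : Multiset ℕ).sum = Fintype.card α := by simp; omega
  have hnd : ({k, Fintype.card α - k} : Multiset ℕ).Nodup := by simpa using hkn
  have hone : ∏ n ∈ ({k, Fintype.card α - k} : Multiset ℕ).toFinset,
      (({k, Fintype.card α - k} : Multiset ℕ).count n).factorial = 1 := by
    refine Finset.prod_eq_one fun n hn ↦ ?_
    rw [Multiset.count_eq_one_of_mem hnd (Multiset.mem_toFinset.1 hn), Nat.factorial_one]
  rw [hone, hsum, Nat.sub_self, Nat.factorial_zero, one_mul, mul_one] at hcount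
  have hsub : (Finset.univ.filter fun g : Perm α ↦ g.cycleType = {k, Fintype.card α - k}) ⊆
      (Finset.powersetCard k (Finset.univ : Finset α)).biUnion twoCyclePerms := by
    intro g hg
    replace hg : g.cycleType = {k, Fintype.card α - k} := by simpa using hg
    have hex : ∀ j ∈ g.cycleType, ∃ c ∈ g.cycleFactorsFinset, c.support.card = j := by
      intro j hj
      simpa [cycleType_def] using hj
    obtain ⟨c, hc, hck⟩ := hex k (by simp [hg])
    obtain ⟨d, hd, hdk⟩ := hex (Fintype.card α - k) (by simp [hg])
    have hcd : c ≠ d := by rintro rfl; omega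
    have hdisj := disjoint_iff_disjoint_support.1 (g.cycleFactorsFinset_pairwise_disjoint hc hd hcd)
    have hcompl : c.supportᶜ = d.support := by
      symm
      refine Finset.eq_of_subset_of_card_le (Finset.subset_compl_iff_disjoint_left.2 hdisj) ?_
      rw [Finset.card_compl]; omega
    rw [Finset.mem_biUnion]
    refine ⟨c.support, by simpa using hck, mem_twoCyclePerms.2 ⟨?_, ?_⟩⟩
    · exact isCycleOn_support_of_mem_cycleFactorsFinset hc
    · rw [hcompl]; exact isCycleOn_support_of_mem_cycleFactorsFinset hd
  have hle := Finset.card_le_card hsub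
  rw [Finset.card_biUnion (pairwiseDisjoint_twoCyclePerms (by omega) hk'),
    Finset.sum_congr rfl (fun B hB ↦ card_twoCyclePerms_eq (A' := A)
      ((Finset.mem_powersetCard_univ.1 hB).trans hA.symm)), Finset.sum_const,
    Finset.card_powersetCard, Finset.card_univ, smul_eq_mul] at hle
  have hchoose := Nat.choose_mul_factorial_mul_factorial (show k ≤ Fintype.card α by omega)
  have hk1 := Nat.mul_factorial_pred (show k ≠ 0 by omega)
  have hk2 := Nat.mul_factorial_pred (show Fintype.card α - k ≠ 0 by omega)
  rw [← hk1, ← hk2] at hchoose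
  have hpos : 0 < (Fintype.card α).choose k * (k * (Fintype.card α - k)) :=
    Nat.mul_pos (Nat.choose_pos (by omega)) (Nat.mul_pos (by omega) (by omega))
  refine Nat.le_of_mul_le_mul_left ?_ hpos
  have hle' := Nat.mul_le_mul_right (k * (Fintype.card α - k)) hle
  have hprod : ({k, Fintype.card α - k} : Multiset ℕ).prod = k * (Fintype.card α - k) := by simp
  rw [← hprod, hcount, ← hchoose, hprod] at hle'
  calc _ = _ := by ring
    _ ≤ _ := hle'
    _ = _ := by ring

theorem card_filter_mem_le_card_twoCyclePerms {k : ℕ} (hk : 2 ≤ k) (hk' : 2 * k < Fintype.card α)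
    (hcop : k.Coprime (Fintype.card α))
    (hfac : (Fintype.card α).factorial ≤ (Fintype.card α - Fintype.card α / 2).factorial *
      ((k - 1).factorial * (Fintype.card α - k - 1).factorial))
    {H : Subgroup (Perm α)} [DecidablePred (· ∈ H)] (hH : ¬ alternatingGroup α ≤ H)
    {A : Finset α} (hA : A.card = k) :
    (((Finset.powersetCard k (Finset.univ : Finset α)).biUnion twoCyclePerms).filter
      (· ∈ H)).card ≤ (twoCyclePerms A).card := by
  rcases Finset.eq_empty_or_nonempty (((Finset.powersetCard k
    (Finset.univ : Finset α)).biUnion twoCyclePerms).filter (· ∈ H)) with he | ⟨g, hg⟩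
  · rw [he]; exact Nat.zero_le _
  obtain ⟨hg, hgH⟩ := Finset.mem_filter.1 hg
  obtain ⟨B, hB, hgB⟩ := Finset.mem_biUnion.1 hg
  replace hB : B.card = k := Finset.mem_powersetCard_univ.1 hB
  have hgB' := mem_twoCyclePerms.1 hgB
  by_cases htr : IsPretransitive H α
  · have hprim := isPreprimitive_of_isCycleOn_of_isCycleOn_compl htr hgH hgB'.1 hgB'.2
      (hB.symm ▸ hcop)
    have hH' := (card_mul_factorial_le_of_isPreprimitive_s8 hprim hH).trans hfac
    rw [mul_comm] at hH'
    have hsub : (((Finset.powersetCard k (Finset.univ : Finset α)).biUnion twoCyclePerms).filter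
        (· ∈ H)).card ≤ Nat.card H := by
      rw [← Set.ncard_coe_finset]
      exact Set.ncard_le_ncard (t := (H : Set (Perm α))) fun c hc ↦ (Finset.mem_filter.1 hc).2
    exact hsub.trans ((Nat.le_of_mul_le_mul_left hH' (Nat.factorial_pos _)).trans
      (factorial_mul_factorial_le_card_twoCyclePerms hk hk' hA))
  · rw [card_twoCyclePerms_eq (hA.trans hB.symm)]
    refine Finset.card_le_card fun c hc ↦ ?_
    obtain ⟨hc, hcH⟩ := Finset.mem_filter.1 hc
    obtain ⟨A', hA', hcA'⟩ := Finset.mem_biUnion.1 hc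
    replace hA' : A'.card = k := Finset.mem_powersetCard_univ.1 hA'
    have hcycle : ∀ f ∈ H, ∀ x y, f.SameCycle x y → y ∈ orbit H x := by
      rintro f hf x _ ⟨i, rfl⟩
      exact ⟨⟨f ^ i, H.zpow_mem hf i⟩, rfl⟩
    have hsep : ∀ x ∈ B, ∀ y ∉ B, y ∉ orbit H x := by
      intro x hx y hy hxy
      refine htr ⟨fun u v ↦ ?_⟩
      have hall : ∀ u, u ∈ orbit H x := by
        intro u
        by_cases hu : u ∈ B
        · exact hcycle g hgH x u (hgB'.1.2 hx hu)
        · rw [← orbit_eq_iff.2 hxy]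
          exact hcycle g hgH y u (hgB'.2.2 (by simpa using hy) (by simpa using hu))
      have hv := hall v
      rw [← orbit_eq_iff.2 (hall u)] at hv
      exact hv
    rw [← eq_of_sameCycle_imp (A := B) (A' := A') (Finset.card_pos.1 (by omega)) (by omega)
      (by rw [Finset.card_compl]; omega) hcA' ?_]
    · exact hcA'
    · intro x y hxy
      have h1 := hcycle c hcH x y hxy
      constructor
      · intro hx
        by_contra hy
        exact hsep x hx y hy h1
      · intro hy
        by_contra hx
        exact hsep y hy x hx (mem_orbit_symm.1 h1)

theorem choose_le_card_of_forall_not_alternatingGroup_le {k : ℕ} (hk : 2 ≤ k)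
    (hk' : 2 * k < Fintype.card α) (hcop : k.Coprime (Fintype.card α))
    (hfac : (Fintype.card α).factorial ≤ (Fintype.card α - Fintype.card α / 2).factorial *
      ((k - 1).factorial * (Fintype.card α - k - 1).factorial))
    {𝒞 : Finset (Subgroup (Perm α))} (hA : ∀ H ∈ 𝒞, ¬ alternatingGroup α ≤ H)
    (hcover : ∀ g : Perm α, ∃ H ∈ 𝒞, g ∈ H) :
    (Fintype.card α).choose k ≤ 𝒞.card := by
  classical
  obtain ⟨A, -, hAk⟩ := Finset.exists_subset_card_eq (s := (Finset.univ : Finset α)) (n := k)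
    (by rw [Finset.card_univ]; omega)
  let U := (Finset.powersetCard k (Finset.univ : Finset α)).biUnion twoCyclePerms
  have hU : U.card = (Fintype.card α).choose k * (twoCyclePerms A).card := by
    rw [Finset.card_biUnion (pairwiseDisjoint_twoCyclePerms (by omega) hk'),
      Finset.sum_congr rfl (fun B hB ↦ card_twoCyclePerms_eq (A' := A)
        ((Finset.mem_powersetCard_univ.1 hB).trans hAk.symm)), Finset.sum_const,
      Finset.card_powersetCard, Finset.card_univ, smul_eq_mul]
  have hsub : U ⊆ 𝒞.biUnion fun H ↦ U.filter (· ∈ H) := by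
    intro g hg
    obtain ⟨H, hH, hgH⟩ := hcover g
    exact Finset.mem_biUnion.2 ⟨H, hH, Finset.mem_filter.2 ⟨hg, hgH⟩⟩
  have hle := (Finset.card_le_card hsub).trans (Finset.card_biUnion_le_card_mul 𝒞 _ _
    fun H hH ↦ card_filter_mem_le_card_twoCyclePerms hk hk' hcop hfac (hA H hH) hAk)
  rw [hU] at hle
  exact Nat.le_of_mul_le_mul_right hle (lt_of_lt_of_le
    (Nat.mul_pos (Nat.factorial_pos _) (Nat.factorial_pos _))
    (factorial_mul_factorial_le_card_twoCyclePerms hk hk' hAk))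

end TwoCycles

section Cover

variable {α : Type*}

theorem exists_smul_eq_compl_of_even_cycles [Fintype α] [DecidableEq α] {g : Perm α}
    (hg : ∀ x, g x ≠ x ∧ Even (g.cycleOf x).support.card) :
    ∃ A : Finset α, g • (A : Set α) = (A : Set α)ᶜ := by
  let r : α → α := fun x ↦ (Quotient.mk (SameCycle.setoid g) x).out
  have hr : ∀ x, g.SameCycle (r x) x := fun x ↦ Quotient.mk_out (s := SameCycle.setoid g) x
  choose i hi using hr
  have hrg : ∀ x, r (g x) = r x := fun x ↦
    congrArg Quotient.out (Quotient.sound (s := SameCycle.setoid g)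
      (show g.SameCycle (g x) x from ⟨-1, by simp⟩))
  have hpar : ∀ x, Even (i (g x)) ↔ ¬ Even (i x) := by
    intro x
    have h1 : (g ^ i (g x)) (r x) = (g ^ (1 + i x)) (r x) := by
      rw [zpow_add, zpow_one, Perm.mul_apply, hi, ← hrg, hi]
    rw [zpow_eq_zpow_on_iff g (hg _).1] at h1
    obtain ⟨c, hc⟩ := (hg (r x)).2
    have hcast : ((g.cycleOf (r x)).support.card : ℤ) = 2 * c := by rw [hc]; push_cast; ring
    have h2 : (2 : ℤ) ∣ i (g x) - (1 + i x) :=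
      (Dvd.intro _ hcast.symm).trans (Int.ModEq.dvd h1.symm)
    rw [Int.even_iff, Int.even_iff]
    omega
  refine ⟨Finset.univ.filter fun x ↦ Even (i x), ?_⟩
  ext y
  obtain ⟨x, rfl⟩ := g.surjective y
  rw [← Perm.smul_def, Set.smul_mem_smul_set_iff]
  simp [hpar]

/-- The permutations preserving the partition of `α` into `A` and its complement. -/
def bipartitionStabilizer (A : Set α) : Subgroup (Perm α) :=
  stabilizer (Perm α) ({A, Aᶜ} : Set (Set α))

theorem mem_bipartitionStabilizer_of_smul_eq_compl {A : Set α} {g : Perm α} (hg : g • A = Aᶜ) :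
    g ∈ bipartitionStabilizer A := by
  have h : g • Aᶜ = A := by rw [Set.smul_set_compl, hg, compl_compl]
  rw [bipartitionStabilizer, mem_stabilizer_iff, ← Set.image_smul, Set.image_pair, hg, h,
    Set.pair_comm]

theorem bipartitionStabilizer_compl (A : Set α) :
    bipartitionStabilizer Aᶜ = bipartitionStabilizer A := by
  rw [bipartitionStabilizer, bipartitionStabilizer, compl_compl, Set.pair_comm]

theorem bipartitionStabilizer_ne_top {A : Set α} (hA : A.Nontrivial) (hA' : Aᶜ.Nonempty) :
    bipartitionStabilizer A ≠ ⊤ := by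
  classical
  obtain ⟨a, ha, b, hb, hab⟩ := hA
  obtain ⟨c, hc⟩ := hA'
  have hac : a ≠ c := fun h ↦ hc (h ▸ ha)
  have hbc : b ≠ c := fun h ↦ hc (h ▸ hb)
  intro h
  have hmem : swap a c ∈ bipartitionStabilizer A := h ▸ Subgroup.mem_top _
  rw [bipartitionStabilizer, mem_stabilizer_iff] at hmem
  have hA : swap a c • A ∈ ({A, Aᶜ} : Set (Set α)) := by
    rw [← hmem]
    exact Set.smul_mem_smul_set (Set.mem_insert _ _)
  have hcA : c ∈ swap a c • A := ⟨a, ha, by simp⟩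
  have hbA : b ∈ swap a c • A := ⟨b, hb, by simp [swap_apply_of_ne_of_ne hab.symm hbc]⟩
  rcases hA with e | e
  · exact hc (e ▸ hcA)
  · rw [Set.mem_singleton_iff.1 e] at hbA
    exact hbA hb

theorem even_cycles_of_sign_eq_neg_one [Fintype α] [DecidableEq α] {m : ℕ} (hm : 1 ≤ m)
    (hα : Fintype.card α = 6 * m) {g : Perm α} (hsign : sign g = -1)
    (hinv : ∀ A : Finset α, A.Nonempty → g • (A : Set α) = A → 2 * m ≤ A.card) (x : α) :
    g x ≠ x ∧ Even (g.cycleOf x).support.card := by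
  have hfix : ∀ y, g y ≠ y := by
    intro y hy
    have := hinv {y} (Finset.singleton_nonempty y) (by simp [hy])
    rw [Finset.card_singleton] at this
    omega
  refine ⟨hfix x, ?_⟩
  have hle : ∀ c ∈ g.cycleType, 2 * m ≤ c := by
    intro c hc
    obtain ⟨f, hf, rfl⟩ : ∃ f ∈ g.cycleFactorsFinset, f.support.card = c := by
      simpa [cycleType_def] using hc
    refine hinv _ (mem_cycleFactorsFinset_iff.1 hf).1.nonempty_support ?_
    ext y
    obtain ⟨z, rfl⟩ := g.surjective y
    rw [← Perm.smul_def, Set.smul_mem_smul_set_iff]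
    exact (mem_cycleFactorsFinset_support hf z).symm
  have hsum : g.cycleType.sum = 6 * m := by
    rw [sum_cycleType, ← hα, ← Finset.card_univ]
    congr 1
    ext y
    simpa using hfix y
  have hodd : Odd (Multiset.card g.cycleType) := by
    rw [sign_of_cycleType, hsum] at hsign
    by_contra hc
    rw [Nat.not_odd_iff_even] at hc
    have : Even (6 * m + Multiset.card g.cycleType) := Even.add ⟨3 * m, by ring⟩ hc
    rw [this.neg_one_pow] at hsign
    exact absurd hsign (by decide)
  have hmem : (g.cycleOf x).support.card ∈ g.cycleType := by
    rw [cycleType_def, Multiset.mem_map]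
    exact ⟨g.cycleOf x, by simpa [cycleOf_mem_cycleFactorsFinset_iff] using hfix x, rfl⟩
  obtain ⟨s, hs⟩ := Multiset.exists_cons_of_mem hmem
  have hs' : Multiset.card s * (2 * m) ≤ s.sum := by
    rw [← smul_eq_mul]
    exact Multiset.card_nsmul_le_sum fun c hc ↦ hle c (by rw [hs]; exact Multiset.mem_cons_of_mem hc)
  have hx := hle _ hmem
  rw [hs, Multiset.sum_cons] at hsum
  rw [hs, Multiset.card_cons] at hodd
  have hs0 : Multiset.card s = 0 → s.sum = 0 := fun h ↦ by
    rw [Multiset.card_eq_zero.1 h, Multiset.sum_zero]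
  generalize Multiset.card s = j at *
  have hj : j = 0 ∨ j = 2 := by
    have : j ≤ 2 := by
      by_contra! h3
      have := Nat.mul_le_mul_right (2 * m) h3
      omega
    interval_cases j
    · exact Or.inl rfl
    · exact absurd hodd (by decide)
    · exact Or.inr rfl
  rcases hj with rfl | rfl
  · have := hs0 rfl
    exact ⟨3 * m, by omega⟩
  · exact ⟨m, by omega⟩

end Cover

theorem coveringNumber_le_card {G : Type*} [Group G] {𝒞 : Finset (Subgroup G)}
    (hproper : ∀ H ∈ 𝒞, H ≠ ⊤) (hcover : ∀ g : G, ∃ H ∈ 𝒞, g ∈ H) :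
    coveringNumber G ≤ 𝒞.card :=
  Nat.sInf_le ⟨𝒞, rfl, hproper, hcover⟩

theorem coveringNumber_perm_le {α : Type*} [Fintype α] {m : ℕ} (hm : 1 ≤ m)
    (hα : Fintype.card α = 6 * m) :
    coveringNumber (Perm α) ≤
      ∑ i ∈ Finset.range (2 * m), (6 * m).choose i + (6 * m - 1).choose (3 * m) := by
  classical
  have : Nontrivial α := Fintype.one_lt_card_iff_nontrivial.1 (by omega)
  obtain ⟨a⟩ : Nonempty α := inferInstance
  let 𝒮 : Finset (Subgroup (Perm α)) := (Finset.Ico 1 (2 * m)).biUnion fun i ↦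
    (Finset.powersetCard i Finset.univ).image fun A : Finset α ↦ stabilizer (Perm α) (A : Set α)
  let 𝒲 : Finset (Subgroup (Perm α)) := (Finset.powersetCard (3 * m) (Finset.univ.erase a)).image
    fun A : Finset α ↦ bipartitionStabilizer (A : Set α)
  have h𝒮 : 𝒮.card ≤ ∑ i ∈ Finset.Ico 1 (2 * m), (6 * m).choose i := by
    refine Finset.card_biUnion_le.trans (Finset.sum_le_sum fun i _ ↦ ?_)
    exact Finset.card_image_le.trans_eq (by rw [Finset.card_powersetCard, Finset.card_univ, hα])
  have h𝒲 : 𝒲.card ≤ (6 * m - 1).choose (3 * m) :=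
    Finset.card_image_le.trans_eq (by
      rw [Finset.card_powersetCard, Finset.card_erase_of_mem (Finset.mem_univ a),
        Finset.card_univ, hα])
  have hcard : (insert (alternatingGroup α) (𝒮 ∪ 𝒲)).card ≤
      ∑ i ∈ Finset.range (2 * m), (6 * m).choose i + (6 * m - 1).choose (3 * m) := by
    have h1 := Finset.card_insert_le (alternatingGroup α) (𝒮 ∪ 𝒲)
    have h2 := Finset.card_union_le 𝒮 𝒲
    have h3 := Finset.sum_eq_sum_Ico_succ_bot (show 0 < 2 * m by omega) (6 * m).choose
    rw [Nat.choose_zero_right, zero_add] at h3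
    rw [Finset.range_eq_Ico, h3]
    omega
  refine (coveringNumber_le_card ?_ ?_).trans hcard
  · intro H hH
    rw [Finset.mem_insert, Finset.mem_union] at hH
    rcases hH with rfl | hH | hH
    · intro h
      have := alternatingGroup.index_eq_two (α := α)
      rw [h, Subgroup.index_top] at this
      omega
    · obtain ⟨i, hi, hH⟩ := Finset.mem_biUnion.1 hH
      obtain ⟨A, hA, rfl⟩ := Finset.mem_image.1 hH
      rw [Finset.mem_Ico] at hi
      rw [Finset.mem_powersetCard_univ] at hA
      refine stabilizer_ne_top_of_nonempty_of_nonempty_compl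
        (Finset.coe_nonempty.2 (Finset.card_pos.1 (by omega))) ?_
      rw [← Finset.coe_compl, Finset.coe_nonempty, ← Finset.card_pos, Finset.card_compl]
      omega
    · obtain ⟨A, hA, rfl⟩ := Finset.mem_image.1 hH
      obtain ⟨hsub, hA⟩ := Finset.mem_powersetCard.1 hA
      refine bipartitionStabilizer_ne_top ?_ ⟨a, fun h ↦ Finset.notMem_erase a _ (hsub h)⟩
      exact Finset.one_lt_card_iff_nontrivial.1 (by omega)
  · intro g
    rcases Int.units_eq_one_or (sign g) with hs | hs
    · exact ⟨_, Finset.mem_insert_self _ _, mem_alternatingGroup.2 hs⟩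
    by_cases hinv : ∀ A : Finset α, A.Nonempty → g • (A : Set α) = A → 2 * m ≤ A.card
    · obtain ⟨A, hA⟩ := exists_smul_eq_compl_of_even_cycles
        (even_cycles_of_sign_eq_neg_one hm hα hs hinv)
      have hAcard : A.card = 3 * m := by
        have h := congrArg Set.ncard hA
        rw [Set.ncard_smul_set, ← Finset.coe_compl, Set.ncard_coe_finset, Set.ncard_coe_finset,
          Finset.card_compl] at h
        omega
      have hgA := mem_bipartitionStabilizer_of_smul_eq_compl hA
      have hsuff : ∀ B : Finset α, a ∉ B → B.card = 3 * m → bipartitionStabilizer (B : Set α) ∈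
          insert (alternatingGroup α) (𝒮 ∪ 𝒲) := fun B haB hB ↦
        Finset.mem_insert_of_mem (Finset.mem_union_right _ (Finset.mem_image_of_mem _
          (Finset.mem_powersetCard.2 ⟨fun x hx ↦ Finset.mem_erase.2
            ⟨fun e ↦ haB (e ▸ hx), Finset.mem_univ x⟩, hB⟩)))
      by_cases haA : a ∈ A
      · refine ⟨_, hsuff Aᶜ (by simpa using haA) (by rw [Finset.card_compl]; omega), ?_⟩
        rwa [Finset.coe_compl, bipartitionStabilizer_compl]
      · exact ⟨_, hsuff A haA hAcard, hgA⟩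
    · push Not at hinv
      obtain ⟨A, hne, hA, hlt⟩ := hinv
      refine ⟨stabilizer (Perm α) (A : Set α), Finset.mem_insert_of_mem (Finset.mem_union_left _
        (Finset.mem_biUnion.2 ⟨A.card, Finset.mem_Ico.2 ⟨Finset.card_pos.2 hne, hlt⟩,
          Finset.mem_image_of_mem _ (by simp)⟩)), hA⟩

theorem eq_alternatingGroup_of_le_of_ne_top {α : Type*} [Fintype α] [DecidableEq α] [Nontrivial α]
    {H : Subgroup (Perm α)} (hle : alternatingGroup α ≤ H) (hne : H ≠ ⊤) :
    H = alternatingGroup α := by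
  have hmul := Subgroup.relIndex_mul_index hle
  rw [alternatingGroup.index_eq_two] at hmul
  have hH : H.index ≠ 1 := fun h ↦ hne (Subgroup.index_eq_one.1 h)
  have hdvd : H.index ∣ 2 := Dvd.intro_left _ hmul
  exact eq_alternatingGroup_of_index_eq_two (((Nat.dvd_prime Nat.prime_two).1 hdvd).resolve_left hH)

end

theorem five_mul_choose_two_mul_le {m : ℕ} (hm : 6 ≤ m) :
    5 * (6 * m).choose (2 * m) ≤ (6 * m).choose (3 * m) := by
  have key : 5 * ((3 * m).factorial * (3 * m).factorial) ≤
      (2 * m).factorial * (4 * m).factorial := by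
    induction m, hm using Nat.le_induction with
    | base => decide +kernel
    | succ m hm ih =>
      have e1 : (3 * (m + 1)).factorial =
          (3 * m + 3) * (3 * m + 2) * (3 * m + 1) * (3 * m).factorial := by
        rw [show 3 * (m + 1) = 3 * m + 2 + 1 by ring]
        simp only [Nat.factorial_succ]; ring
      have e2 : (2 * (m + 1)).factorial = (2 * m + 2) * (2 * m + 1) * (2 * m).factorial := by
        rw [show 2 * (m + 1) = 2 * m + 1 + 1 by ring]
        simp only [Nat.factorial_succ]; ring
      have e3 : (4 * (m + 1)).factorial =
          (4 * m + 4) * (4 * m + 3) * (4 * m + 2) * (4 * m + 1) * (4 * m).factorial := by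
        rw [show 4 * (m + 1) = 4 * m + 3 + 1 by ring]
        simp only [Nat.factorial_succ]; ring
      have hpoly : ((3 * m + 3) * (3 * m + 2) * (3 * m + 1)) ^ 2 ≤
          (2 * m + 2) * (2 * m + 1) * ((4 * m + 4) * (4 * m + 3) * (4 * m + 2) * (4 * m + 1)) := by
        refine (Nat.le_add_right _ (295 * m ^ 6 + 1180 * m ^ 5 + 1894 * m ^ 4 + 1552 * m ^ 3 +
          679 * m ^ 2 + 148 * m + 12)).trans_eq ?_
        ring
      rw [e1, e2, e3]
      calc _ = ((3 * m + 3) * (3 * m + 2) * (3 * m + 1)) ^ 2 *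
            (5 * ((3 * m).factorial * (3 * m).factorial)) := by ring
        _ ≤ _ := Nat.mul_le_mul hpoly ih
        _ = _ := by ring
  have h1 := Nat.choose_mul_factorial_mul_factorial (show 2 * m ≤ 6 * m by omega)
  have h2 := Nat.choose_mul_factorial_mul_factorial (show 3 * m ≤ 6 * m by omega)
  rw [show 6 * m - 2 * m = 4 * m by omega] at h1
  rw [show 6 * m - 3 * m = 3 * m by omega, ← h1] at h2
  refine Nat.le_of_mul_le_mul_right (c := (3 * m).factorial * (3 * m).factorial) ?_
    (Nat.mul_pos (Nat.factorial_pos _) (Nat.factorial_pos _))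
  calc _ = (6 * m).choose (2 * m) * (5 * ((3 * m).factorial * (3 * m).factorial)) := by ring
    _ ≤ (6 * m).choose (2 * m) * ((2 * m).factorial * (4 * m).factorial) :=
      Nat.mul_le_mul_left _ key
    _ = _ := by rw [← mul_assoc, ← h2]; ring

theorem sum_range_choose_le {n j : ℕ} (hj : 3 * j ≤ n + 1) :
    ∑ i ∈ Finset.range j, n.choose i ≤ n.choose j := by
  induction j with
  | zero => simp
  | succ j ih =>
    have h := Nat.choose_succ_right_eq n j
    have h2 : 2 * n.choose j ≤ n.choose (j + 1) := by
      refine Nat.le_of_mul_le_mul_right (c := j + 1) ?_ j.succ_pos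
      rw [h, mul_comm 2, mul_assoc]
      exact Nat.mul_le_mul_left _ (by omega)
    rw [Finset.sum_range_succ]
    have := ih (by omega)
    omega

theorem four_mul_choose_le {m : ℕ} (hm : 6 ≤ m) :
    4 * (6 * m).choose (3 * m) ≤ 5 * (6 * m).choose (3 * m - 2) := by
  have h1 := Nat.choose_succ_right_eq (6 * m) (3 * m - 1)
  have h2 := Nat.choose_succ_right_eq (6 * m) (3 * m - 2)
  rw [show 3 * m - 1 + 1 = 3 * m by omega, show 6 * m - (3 * m - 1) = 3 * m + 1 by omega] at h1
  rw [show 3 * m - 2 + 1 = 3 * m - 1 by omega, show 6 * m - (3 * m - 2) = 3 * m + 2 by omega] at h2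
  generalize (6 * m).choose (3 * m - 2) = a at *
  generalize (6 * m).choose (3 * m - 1) = b at *
  generalize (6 * m).choose (3 * m) = c at *
  obtain ⟨t, rfl⟩ : ∃ t, m = t + 6 := ⟨m - 6, by omega⟩
  rw [show 3 * (t + 6) - 1 = 3 * t + 17 by omega] at h2
  have h3 : c * ((3 * (t + 6)) * (3 * t + 17)) = a * ((3 * (t + 6) + 2) * (3 * (t + 6) + 1)) := by
    calc _ = (c * (3 * (t + 6))) * (3 * t + 17) := by ring
      _ = (b * (3 * t + 17)) * (3 * (t + 6) + 1) := by rw [h1]; ring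
      _ = _ := by rw [h2]; ring
  refine Nat.le_of_mul_le_mul_right (c := (3 * (t + 6)) * (3 * t + 17)) ?_ (by positivity)
  calc _ = 4 * (c * ((3 * (t + 6)) * (3 * t + 17))) := by ring
    _ = a * (4 * ((3 * (t + 6) + 2) * (3 * (t + 6) + 1))) := by rw [h3]; ring
    _ ≤ a * (5 * ((3 * (t + 6)) * (3 * t + 17))) := Nat.mul_le_mul_left _ (by nlinarith)
    _ = _ := by ring

theorem factorial_two_mul_le {L : ℕ} (hL : 18 ≤ L) :
    (2 * L).factorial ≤ L.factorial * (L.factorial * (L - 2).factorial) := by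
  induction L, hL using Nat.le_induction with
  | base => decide +kernel
  | succ L hL ih =>
    obtain ⟨t, rfl⟩ : ∃ t, L = t + 2 := ⟨L - 2, by omega⟩
    rw [show 2 * (t + 2 + 1) = 2 * (t + 2) + 1 + 1 by ring, show t + 2 + 1 - 2 = t + 1 by omega,
      Nat.factorial_succ (2 * (t + 2) + 1), Nat.factorial_succ (2 * (t + 2)),
      Nat.factorial_succ (t + 2), Nat.factorial_succ t]
    rw [show t + 2 - 2 = t by omega] at ih
    calc _ = ((2 * (t + 2) + 1 + 1) * (2 * (t + 2) + 1)) * (2 * (t + 2)).factorial := by ring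
      _ ≤ ((t + 2 + 1) * (t + 2 + 1) * (t + 1)) * _ :=
        Nat.mul_le_mul (by nlinarith [Nat.mul_le_mul hL (le_refl (t * t))]) ih
      _ = _ := by ring

/-- The degree of the shorter cycle: the largest number below `n / 2` coprime to `n = 6 * m`. -/
theorem exists_coprime_bounds {m : ℕ} (hm : 6 ≤ m) :
    ∃ k, 2 ≤ k ∧ 2 * k < 6 * m ∧ k.Coprime (6 * m) ∧
      (6 * m).factorial ≤ (6 * m - 6 * m / 2).factorial *
        ((k - 1).factorial * (6 * m - k - 1).factorial) ∧
      (6 * m).choose (3 * m - 2) ≤ (6 * m).choose k := by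
  have hfac := factorial_two_mul_le (L := 3 * m) (by omega)
  rw [show 2 * (3 * m) = 6 * m by ring] at hfac
  rcases Nat.even_or_odd m with ⟨t, rfl⟩ | ⟨t, rfl⟩
  · refine ⟨3 * (t + t) - 1, by omega, by omega, ?_, ?_, ?_⟩
    · have h1 : (3 * (t + t) - 1).Coprime 2 := by
        rw [Nat.coprime_two_right]; exact ⟨3 * t - 1, by omega⟩
      have h2 : (3 * (t + t) - 1).Coprime (3 * (t + t)) := by
        rw [Nat.coprime_self_sub_left (by omega)]; exact Nat.coprime_one_left _
      rw [show 6 * (t + t) = 2 * (3 * (t + t)) by ring]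
      exact h1.mul_right h2
    · rw [show 6 * (t + t) - 6 * (t + t) / 2 = 3 * (t + t) by omega,
        show 3 * (t + t) - 1 - 1 = 3 * (t + t) - 2 by omega,
        show 6 * (t + t) - (3 * (t + t) - 1) - 1 = 3 * (t + t) by omega,
        mul_comm (3 * (t + t) - 2).factorial]
      exact hfac
    · have h := Nat.choose_le_succ_of_lt_half_left
        (show 3 * (t + t) - 2 < 6 * (t + t) / 2 by omega)
      rwa [show 3 * (t + t) - 2 + 1 = 3 * (t + t) - 1 by omega] at h
  · refine ⟨3 * (2 * t + 1) - 2, by omega, by omega, ?_, ?_, le_rfl⟩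
    · have h0 : (3 * (2 * t + 1) - 2).Coprime 2 := by
        rw [Nat.coprime_two_right]; exact ⟨3 * t, by omega⟩
      have h2 : (3 * (2 * t + 1) - 2).Coprime (3 * (2 * t + 1)) := by
        rw [Nat.coprime_self_sub_left (by omega), Nat.coprime_two_left]; exact ⟨3 * t + 1, by omega⟩
      rw [show 6 * (2 * t + 1) = 2 * (3 * (2 * t + 1)) by ring]
      exact h0.mul_right h2
    · rw [show 6 * (2 * t + 1) - 6 * (2 * t + 1) / 2 = 3 * (2 * t + 1) by omega]
      refine hfac.trans (Nat.mul_le_mul_left _ ?_)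
      rw [show 3 * (2 * t + 1) - 2 - 1 = 6 * t by omega,
        show 6 * (2 * t + 1) - (3 * (2 * t + 1) - 2) - 1 = 6 * t + 3 + 1 by omega,
        show 3 * (2 * t + 1) - 2 = 6 * t + 1 by omega, show 3 * (2 * t + 1) = 6 * t + 3 by ring,
        Nat.factorial_succ (6 * t + 3), Nat.factorial_succ (6 * t)]
      calc _ = (6 * t + 1) * ((6 * t + 3).factorial * (6 * t).factorial) := by ring
        _ ≤ (6 * t + 3 + 1) * ((6 * t + 3).factorial * (6 * t).factorial) :=
          Nat.mul_le_mul_right _ (by omega)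
        _ = _ := by ring

theorem cover_bound_lt_choose {m : ℕ} (hm : 6 ≤ m) :
    ∑ i ∈ Finset.range (2 * m), (6 * m).choose i + (6 * m - 1).choose (3 * m) <
      (6 * m).choose (3 * m - 2) := by
  have h1 := sum_range_choose_le (n := 6 * m) (j := 2 * m) (by omega)
  have h2 := five_mul_choose_two_mul_le hm
  have h3 := four_mul_choose_le hm
  have h4 : 2 * (6 * m - 1).choose (3 * m) = (6 * m).choose (3 * m) := by
    have e := Nat.choose_mul_succ_eq (6 * m - 1) (3 * m)
    rw [show 6 * m - 1 + 1 = 6 * m by omega, show 6 * m - 3 * m = 3 * m by omega] at e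
    refine Nat.eq_of_mul_eq_mul_right (show 0 < 3 * m by omega) ?_
    rw [← e]
    ring
  have h5 : 0 < (6 * m).choose (3 * m) := Nat.choose_pos (by omega)
  omega

/-- Lemma 3.9: for `n ≡ 0 (mod 6)` with `n > 30`, every minimal cover of `S_n` contains the
alternating group `A_n`. -/
theorem alternatingGroup_mem_minimal_cover (n : ℕ) (hmod : n % 6 = 0) (hn : 30 < n)
    (𝒞 : Finset (Subgroup (Equiv.Perm (Fin n))))
    (hproper : ∀ H ∈ 𝒞, H ≠ ⊤)
    (hcover : ∀ g : Equiv.Perm (Fin n), ∃ H ∈ 𝒞, g ∈ H)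
    (hcard : 𝒞.card = coveringNumber (Equiv.Perm (Fin n))) :
    alternatingGroup (Fin n) ∈ 𝒞 := by
  obtain ⟨m, rfl⟩ : ∃ m, n = 6 * m := ⟨n / 6, by omega⟩
  have hm : 6 ≤ m := by omega
  have : Nontrivial (Fin (6 * m)) := Fin.nontrivial_iff_two_le.2 (by omega)
  by_contra hA
  have hnot : ∀ H ∈ 𝒞, ¬ alternatingGroup (Fin (6 * m)) ≤ H := fun H hH hle ↦
    hA (eq_alternatingGroup_of_le_of_ne_top hle (hproper H hH) ▸ hH)
  obtain ⟨k, hk, hk', hcop, hfac, hchoose⟩ := exists_coprime_bounds hm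
  have hlower := choose_le_card_of_forall_not_alternatingGroup_le (α := Fin (6 * m)) (k := k) hk
    (by simpa using hk') (by simpa using hcop) (by simpa using hfac) hnot hcover
  have hupper := coveringNumber_perm_le (α := Fin (6 * m)) (by omega) (Fintype.card_fin _)
  have hlt := cover_bound_lt_choose hm
  rw [Fintype.card_fin] at hlower
  omega
end

section
/- For every natural number n with n ≡ 0 (mod 6) and n > 30, one has n · 6 · ((n/3)!)^3 < 2 · ((n/2)!)^2. -/
/-- The step from `k` to `k + 1` multiplies `k * (2 * k)! ^ 3` by no more than it multiplies
`(3 * k)! ^ 2`. -/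
theorem succ_mul_cube_le_mul_sq {k : ℕ} (hk : 1 ≤ k) :
    (k + 1) * ((2 * k + 2) * (2 * k + 1)) ^ 3 ≤
      k * ((3 * k + 3) * ((3 * k + 2) * (3 * k + 1))) ^ 2 := by
  obtain ⟨m, rfl⟩ := Nat.exists_eq_add_of_le hk
  ring_nf
  gcongr <;> norm_num

theorem mul_factorial_two_mul_cube_lt {k : ℕ} (hk : 6 ≤ k) :
    18 * k * (2 * k).factorial ^ 3 < (3 * k).factorial ^ 2 := by
  induction k, hk using Nat.le_induction with
  | base => decide +kernel
  | succ k hk ih =>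
    have h2 : (2 * (k + 1)).factorial = (2 * k + 2) * (2 * k + 1) * (2 * k).factorial := by
      rw [show 2 * (k + 1) = 2 * k + 1 + 1 by ring, Nat.factorial_succ, Nat.factorial_succ]
      ring
    have h3 : (3 * (k + 1)).factorial =
        (3 * k + 3) * ((3 * k + 2) * (3 * k + 1)) * (3 * k).factorial := by
      rw [show 3 * (k + 1) = 3 * k + 1 + 1 + 1 by ring, Nat.factorial_succ,
        Nat.factorial_succ, Nat.factorial_succ]
      ring
    rw [h2, h3]
    refine lt_of_mul_lt_mul_left (a := k) ?_ (Nat.zero_le k)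
    calc
      k * (18 * (k + 1) * ((2 * k + 2) * (2 * k + 1) * (2 * k).factorial) ^ 3)
          = 18 * k * (2 * k).factorial ^ 3 *
              ((k + 1) * ((2 * k + 2) * (2 * k + 1)) ^ 3) := by ring
      _ < (3 * k).factorial ^ 2 * ((k + 1) * ((2 * k + 2) * (2 * k + 1)) ^ 3) :=
        Nat.mul_lt_mul_of_pos_right ih (by positivity)
      _ ≤ (3 * k).factorial ^ 2 *
            (k * ((3 * k + 3) * ((3 * k + 2) * (3 * k + 1))) ^ 2) :=
        Nat.mul_le_mul_left _ (succ_mul_cube_le_mul_sq (by lia))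
      _ = k * ((3 * k + 3) * ((3 * k + 2) * (3 * k + 1)) * (3 * k).factorial) ^ 2 := by ring


/-- For every `n ≡ 0 (mod 6)` with `n > 30`, `n · 6 · ((n/3)!)³ < 2 · ((n/2)!)²`.  (Hence
any imprimitive maximal subgroup of `S_n` other than a stabilizer of a partition into two
blocks of size `n/2`, having order at most `((n/3)!)³ · 3!`, is smaller than
`(2/n)·((n/2)!)²`.) -/
theorem imprimitive_bound (n : ℕ) (hmod : n % 6 = 0) (hn : 30 < n) :
    n * 6 * (n / 3).factorial ^ 3 < 2 * (n / 2).factorial ^ 2 := by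
  obtain ⟨k, rfl⟩ := Nat.dvd_of_mod_eq_zero hmod
  rw [show 6 * k / 3 = 2 * k by lia, show 6 * k / 2 = 3 * k by lia]
  linarith [mul_factorial_two_mul_cube_lt (k := k) (by lia)]
end

section
/- Let n be an even natural number with n ≥ 4, and let g ∈ S_n be an n-cycle (i.e., the cycle type of g is the singleton multiset {n}). Then there are exactly two subsets s of Fin n with |s| = n/2 and g(s) = sᶜ, and these two subsets are complements of each other. In particular, g preserves a unique unordered partition of Fin n into two blocks of size n/2. -/
open Pointwise

/-- A permutation sends a finite set to its complement iff it swaps membership at every point. -/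
theorem Equiv.Perm.smul_finset_eq_compl_iff {α : Type*} [Fintype α] [DecidableEq α]
    (g : Equiv.Perm α) (t : Finset α) : g • t = tᶜ ↔ ∀ x, g x ∈ t ↔ x ∉ t := by
  rw [Finset.ext_iff, ← g.forall_congr_right]
  refine forall_congr' fun x => ?_
  rw [← Equiv.Perm.smul_def, Finset.smul_mem_smul_finset_iff, Finset.mem_compl]
  tauto

theorem Equiv.Perm.pow_apply_mem_iff_of_smul_eq_compl {α : Type*} [Fintype α] [DecidableEq α]
    {g : Equiv.Perm α} {t : Finset α} (ht : g • t = tᶜ) (x : α) (k : ℕ) :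
    (g ^ k) x ∈ t ↔ (x ∈ t ↔ Even k) := by
  rw [Equiv.Perm.smul_finset_eq_compl_iff] at ht
  induction k with
  | zero => simp
  | succ k ih =>
    rw [pow_succ', Equiv.Perm.mul_apply, ht, ih, Nat.even_add_one]
    tauto

/-- Two sets sent to their complements by a transitive cycle agree if they agree at a point. -/
theorem Equiv.Perm.IsCycleOn.eq_of_smul_eq_compl {α : Type*} [Fintype α] [DecidableEq α]
    {g : Equiv.Perm α} (hg : g.IsCycleOn (Finset.univ : Finset α)) {s t : Finset α}
    (hs : g • s = sᶜ) (ht : g • t = tᶜ) {a : α} (ha : a ∈ t ↔ a ∈ s) : t = s := by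
  ext x
  obtain ⟨k, -, rfl⟩ := hg.exists_pow_eq (Finset.mem_univ a) (Finset.mem_univ x)
  rw [Equiv.Perm.pow_apply_mem_iff_of_smul_eq_compl hs,
    Equiv.Perm.pow_apply_mem_iff_of_smul_eq_compl ht, ha]

theorem Equiv.Perm.IsCycleOn.exists_smul_eq_compl {α : Type*} [Fintype α] [DecidableEq α]
    [Nonempty α] {g : Equiv.Perm α} (hg : g.IsCycleOn (Finset.univ : Finset α))
    (hα : Even (Fintype.card α)) : ∃ s : Finset α, g • s = sᶜ := by
  classical
  obtain ⟨a⟩ := ‹Nonempty α›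
  refine ⟨Finset.univ.filter fun x => ∃ k, Even k ∧ (g ^ k) a = x, ?_⟩
  have key (m : ℕ) : (∃ k, Even k ∧ (g ^ k) a = (g ^ m) a) ↔ Even m := by
    refine ⟨?_, fun h => ⟨m, h, rfl⟩⟩
    rintro ⟨k, hk, h⟩
    rw [hg.pow_apply_eq_pow_apply (Finset.mem_univ a), Finset.card_univ] at h
    have h2 : k % 2 = m % 2 := h.of_dvd hα.two_dvd
    rwa [Nat.even_iff, ← h2, ← Nat.even_iff]
  rw [Equiv.Perm.smul_finset_eq_compl_iff]
  intro x
  obtain ⟨m, -, rfl⟩ := hg.exists_pow_eq (Finset.mem_univ a) (Finset.mem_univ x)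
  simp only [Finset.mem_filter_univ]
  rw [← Equiv.Perm.mul_apply, ← pow_succ', key, key, Nat.even_add_one]

theorem Finset.card_eq_half_of_smul_eq_compl {α : Type*} [Fintype α] [DecidableEq α]
    {g : Equiv.Perm α} {s : Finset α} (hs : g • s = sᶜ) : s.card = Fintype.card α / 2 := by
  have h := congrArg Finset.card hs
  rw [Finset.card_smul_finset] at h
  have := s.card_add_card_compl
  omega

theorem Equiv.Perm.isCycleOn_univ_of_cycleType {α : Type*} [Fintype α] [DecidableEq α]
    {g : Equiv.Perm α} (hg : g.cycleType = {Fintype.card α}) :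
    g.IsCycleOn (Finset.univ : Finset α) := by
  have hc : g.IsCycle := Equiv.Perm.card_cycleType_eq_one.mp (by rw [hg, Multiset.card_singleton])
  have hsupp : g.support = Finset.univ := by
    rw [← Finset.card_eq_iff_eq_univ, ← Equiv.Perm.sum_cycleType, hg, Multiset.sum_singleton]
  rw [← hsupp, Equiv.Perm.coe_support_eq_set_support]
  exact hc.isCycleOn

/-- For even `n ≥ 4` and an `n`-cycle `g ∈ S_n`, there are exactly two subsets `s` of
`Fin n` with `|s| = n/2` and `g(s) = sᶜ`, and these two subsets are complements of each
other: `g` preserves a unique unordered partition of `Fin n` into two blocks of size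
`n/2`. -/
theorem nCycle_unique_partition (n : ℕ) (hmod : n % 2 = 0) (hn : 4 ≤ n)
    (g : Equiv.Perm (Fin n)) (hg : g.cycleType = {n}) :
    ∃ s : Finset (Fin n), s ≠ sᶜ ∧
      {t : Finset (Fin n) | t.card = n / 2 ∧ g • t = tᶜ} = {s, sᶜ} := by
  have hcyc : g.IsCycleOn (Finset.univ : Finset (Fin n)) :=
    Equiv.Perm.isCycleOn_univ_of_cycleType (by rw [hg, Fintype.card_fin])
  have : Nonempty (Fin n) := ⟨⟨0, by omega⟩⟩
  obtain ⟨s, hs⟩ := hcyc.exists_smul_eq_compl (by rw [Fintype.card_fin, Nat.even_iff, hmod])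
  have hs' : g • sᶜ = sᶜᶜ := by
    rw [Equiv.Perm.smul_finset_eq_compl_iff] at hs ⊢
    intro x
    rw [Finset.mem_compl, Finset.mem_compl, hs]
  have hcard {t : Finset (Fin n)} (ht : g • t = tᶜ) : t.card = n / 2 := by
    simpa using Finset.card_eq_half_of_smul_eq_compl ht
  refine ⟨s, ne_compl_self, ?_⟩
  ext t
  simp only [Set.mem_ofPred_eq, Set.mem_insert_iff, Set.mem_singleton_iff]
  constructor
  · rintro ⟨-, ht⟩
    let a : Fin n := ⟨0, by omega⟩
    by_cases h : a ∈ t ↔ a ∈ s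
    · exact Or.inl (hcyc.eq_of_smul_eq_compl hs ht h)
    · refine Or.inr (hcyc.eq_of_smul_eq_compl (a := a) hs' ht ?_)
      rw [Finset.mem_compl]
      tauto
  · rintro (rfl | rfl)
    · exact ⟨hcard hs, hs⟩
    · exact ⟨hcard hs', hs'⟩
end

section
/- Let n ≡ 4 (mod 6), write n = 3t + 1 (so t = ⌊n/3⌋ is odd), and let g ∈ S_n be a permutation whose cycle type is the multiset {t − 1, t + 1, t + 1} (a product of three disjoint cycles of lengths t − 1, t + 1, t + 1 with no fixed points). Then there exists a subset s of Fin n with |s| = n/2 and g(s) = sᶜ; in particular, g lies in the stabilizer of a partition of Fin n into two blocks of size n/2. -/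
open Pointwise

/-- If every cycle of `g` has even length and `g` has no fixed point, then a power of `g` fixing
a point has even exponent. -/
theorem Equiv.Perm.even_of_zpow_apply_eq_self {α : Type*} [Fintype α] [DecidableEq α]
    {g : Equiv.Perm α} (hfix : ∀ x, g x ≠ x) (heven : ∀ m ∈ g.cycleType, Even m)
    {k : ℤ} {x : α} (hk : (g ^ k) x = x) : Even k := by
  have hc : (g.cycleOf x).IsCycle := g.isCycle_cycleOf (hfix x)
  have hmem : (g.cycleOf x).support.card ∈ g.cycleType := by
    rw [Equiv.Perm.cycleType_def]
    exact Multiset.mem_map.2 ⟨g.cycleOf x,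
      Equiv.Perm.cycleOf_mem_cycleFactorsFinset_iff.2 (Equiv.Perm.mem_support.2 (hfix x)), rfl⟩
  have hpow : g.cycleOf x ^ k = 1 := by
    by_contra hne
    have hsupp := Equiv.Perm.support_zpow_le (g.cycleOf x) k
    obtain ⟨y, hy⟩ := Finset.nonempty_iff_ne_empty.2 (mt Equiv.Perm.support_eq_empty_iff.1 hne)
    have hxy : g.SameCycle x y := (Equiv.Perm.mem_support_cycleOf_iff.1 (hsupp hy)).1
    obtain ⟨j, rfl⟩ := hxy
    rw [Equiv.Perm.mem_support] at hy
    apply hy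
    rw [← Equiv.Perm.cycleOf_zpow_apply_self g x j, ← Equiv.Perm.mul_apply, ← zpow_add,
      add_comm, zpow_add, Equiv.Perm.mul_apply, Equiv.Perm.cycleOf_zpow_apply_self g x k, hk]
  have hdvd := orderOf_dvd_iff_zpow_eq_one.2 hpow
  rw [hc.orderOf] at hdvd
  exact ((Int.even_coe_nat _).2 (heven _ hmem)).trans_dvd hdvd

/-- A fixed-point-free permutation all of whose cycles have even length maps some set onto its
complement. -/
theorem Equiv.Perm.exists_smul_finset_eq_compl {α : Type*} [Fintype α] [DecidableEq α]
    {g : Equiv.Perm α} (hfix : ∀ x, g x ≠ x) (heven : ∀ m ∈ g.cycleType, Even m) :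
    ∃ s : Finset α, g • s = sᶜ := by
  classical
  let r : α → α := fun x ↦ (Quotient.mk (Equiv.Perm.SameCycle.setoid g) x).out
  have hr (x : α) : g.SameCycle (r x) x :=
    Quotient.exact (s := Equiv.Perm.SameCycle.setoid g) (Quotient.out_eq _)
  have hrg (x : α) : r (g x) = r x :=
    congrArg Quotient.out (Quotient.sound (s := Equiv.Perm.SameCycle.setoid g)
      (Equiv.Perm.sameCycle_apply_left.2 (Equiv.Perm.SameCycle.refl g x)))
  choose k hk using hr
  have hkg (x : α) : Even (k (g x)) ↔ ¬ Even (k x) := by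
    have h : (g ^ (k x + 1 - k (g x))) (g x) = g x := by
      have hgx : (g ^ k (g x)) (r x) = g x := by rw [← hrg, hk]
      have hstep : (g ^ (k x + 1)) (r x) = g x := by
        rw [add_comm, zpow_add, zpow_one, Equiv.Perm.mul_apply, hk]
      calc (g ^ (k x + 1 - k (g x))) (g x)
          = (g ^ (k x + 1 - k (g x))) ((g ^ k (g x)) (r x)) := by rw [hgx]
        _ = g x := by rw [← Equiv.Perm.mul_apply, ← zpow_add, sub_add_cancel, hstep]
    have h' := Equiv.Perm.even_of_zpow_apply_eq_self hfix heven h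
    simp only [Int.even_sub, Int.even_add_one] at h'
    exact h'.symm
  refine ⟨Finset.univ.filter fun x ↦ Even (k x), ?_⟩
  ext y
  rw [Finset.mem_smul_finset]
  simp only [Finset.mem_filter_univ, Finset.mem_compl, Equiv.Perm.smul_def]
  constructor
  · rintro ⟨x, hx, rfl⟩
    rw [hkg, not_not]
    exact hx
  · intro hy
    refine ⟨g.symm y, ?_, g.apply_symm_apply y⟩
    have := hkg (g.symm y)
    rw [g.apply_symm_apply] at this
    tauto

/-- For `n ≡ 4 (mod 6)`, writing `n = 3t + 1`, a permutation of `Fin n` that is a product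
of three disjoint cycles of lengths `t − 1`, `t + 1`, `t + 1` (with no fixed points) maps
some subset of size `n/2` to its complement; in particular it lies in the stabilizer of a
partition of `Fin n` into two blocks of size `n/2`. -/
theorem cycles_preserve_partition_four_mod_six (n t : ℕ) (hmod : n % 6 = 4)
    (hnt : n = 3 * t + 1) (g : Equiv.Perm (Fin n))
    (hg : g.cycleType = {t - 1, t + 1, t + 1}) :
    ∃ s : Finset (Fin n), s.card = n / 2 ∧ g • s = sᶜ := by
  have hsupp : g.support = Finset.univ := by
    rw [← Finset.card_eq_iff_eq_univ, ← g.sum_cycleType, hg, Fintype.card_fin]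
    simp only [Multiset.insert_eq_cons, Multiset.sum_cons, Multiset.sum_singleton]
    omega
  have hfix (x : Fin n) : g x ≠ x := by
    rw [← Equiv.Perm.mem_support, hsupp]
    exact Finset.mem_univ x
  have heven : ∀ m ∈ g.cycleType, Even m := by
    intro m hm
    simp only [hg, Multiset.insert_eq_cons, Multiset.mem_cons, Multiset.mem_singleton] at hm
    rw [Nat.even_iff]
    omega
  obtain ⟨s, hs⟩ := Equiv.Perm.exists_smul_finset_eq_compl hfix heven
  refine ⟨s, ?_, hs⟩
  have hcard := congrArg Finset.card hs
  rw [Finset.card_smul_finset] at hcard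
  have hadd := s.card_add_card_compl
  rw [← hcard, Fintype.card_fin] at hadd
  omega
end

section
/- Let n be divisible by 3 and let g ∈ S_n be a permutation whose cycle type is a multiset {a, b, c} with a + b + c = n and a < n/3 ≤ b ≤ c (so g is a product of three disjoint cycles with no fixed points, the shortest of length a). If t is a subset of Fin n with g(t) = t and 1 ≤ |t| ≤ n/3 − 1, then |t| = a (indeed t is the support of the a-cycle of g). In particular, the only setwise stabilizers of subsets of size between 1 and n/3 − 1 containing g are those of the support of its shortest cycle. -/
open Pointwise

/-- A finset invariant under a permutation contains the support of the cycle through each of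
its points. -/
theorem support_cycleOf_subset_of_smul_eq {α : Type*} [Fintype α] [DecidableEq α]
    {g : Equiv.Perm α} {t : Finset α} (h : g • t = t) {x : α} (hx : x ∈ t) :
    (g.cycleOf x).support ⊆ t := by
  intro y hy
  obtain ⟨i, rfl⟩ := (Equiv.Perm.mem_support_cycleOf_iff.mp hy).1
  have hi : g ^ i ∈ MulAction.stabilizer (Equiv.Perm α) t := zpow_mem (by simpa using h) i
  rw [← MulAction.mem_stabilizer_iff.mp hi]
  exact Finset.smul_mem_smul_finset hx

/-- A permutation whose cycle lengths add up to the size of the type moves every point. -/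
theorem mem_support_of_sum_cycleType_eq_card {α : Type*} [Fintype α] [DecidableEq α]
    {g : Equiv.Perm α} (h : g.cycleType.sum = Fintype.card α) (x : α) : x ∈ g.support := by
  rw [Equiv.Perm.sum_cycleType] at h
  simp [(Finset.card_eq_iff_eq_univ _).mp h]

/-- Let `3 ∣ n` and let `g ∈ S_n` be a product of three disjoint cycles of lengths
`a < n/3 ≤ b ≤ c` with `a + b + c = n` (so `g` has no fixed points).  If `t` is a subset
of `Fin n` with `g(t) = t` and `1 ≤ |t| ≤ n/3 − 1`, then `|t| = a`; indeed `t` is the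
support of the `a`-cycle of `g`. -/
theorem invariant_small_subset_eq_short_cycle_support (n a b c : ℕ) (h3 : 3 ∣ n)
    (g : Equiv.Perm (Fin n)) (hg : g.cycleType = {a, b, c}) (hsum : a + b + c = n)
    (ha : a < n / 3) (hb : n / 3 ≤ b) (hbc : b ≤ c)
    (t : Finset (Fin n)) (hgt : g • t = t) (ht1 : 1 ≤ t.card) (ht2 : t.card ≤ n / 3 - 1) :
    t.card = a ∧ ∃ d ∈ g.cycleFactorsFinset, d.support.card = a ∧ t = d.support := by
  have hsupp := mem_support_of_sum_cycleType_eq_card (g := g) (by simp [hg, ← hsum, add_assoc])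
  have hmap := g.cycleType_def.symm.trans hg
  obtain ⟨d, hd, hda, hrest⟩ := (Multiset.map_eq_cons _ _ _ _).mpr hmap
  have hcycle : ∀ x ∈ t, g.cycleOf x = d := by
    intro x hx
    by_contra hne
    have hmem : g.cycleOf x ∈ g.cycleFactorsFinset :=
      Equiv.Perm.cycleOf_mem_cycleFactorsFinset_iff.mpr (hsupp x)
    have hlen := Multiset.mem_map_of_mem (Finset.card ∘ Equiv.Perm.support)
      ((Multiset.mem_erase_of_ne hne).mpr (Finset.mem_val.mpr hmem))
    rw [hrest] at hlen
    simp only [Multiset.insert_eq_cons, Multiset.mem_cons, Multiset.mem_singleton,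
      Function.comp_apply] at hlen
    have hle := Finset.card_le_card (support_cycleOf_subset_of_smul_eq hgt hx)
    omega
  have ht : t = d.support := by
    obtain ⟨x, hx⟩ := Finset.card_pos.mp ht1
    refine Finset.Subset.antisymm (fun y hy => ?_) ?_
    · rw [← hcycle y hy, Equiv.Perm.mem_support_cycleOf_iff]
      exact ⟨Equiv.Perm.SameCycle.refl g y, hsupp y⟩
    · rw [← hcycle x hx]
      exact support_cycleOf_subset_of_smul_eq hgt hx
  exact ⟨ht ▸ hda, d, hd, hda, ht⟩
end

section
/- Every permutation g ∈ S_18 satisfies at least one of the following: (i) g is an even permutation (g ∈ A_18); (ii) there exists a subset s of Fin 18 with |s| ∈ {1, 3, 4, 5} and g(s) = s; (iii) there exists a subset s of Fin 18 with |s| = 9 and either g(s) = s or g(s) = sᶜ. In other words, S_18 is covered by A_18, the setwise stabilizers of subsets of sizes 1, 3, 4, 5 (but notably not 2), and the stabilizers of partitions of Fin 18 into two blocks of size 9. -/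
open Pointwise

namespace Multiset

theorem exists_le_map_eq_of_le_map {α β : Type*} {f : α → β} {s : Multiset α} {t : Multiset β}
    (h : t ≤ s.map f) : ∃ u ≤ s, u.map f = t := by
  induction s using Quotient.inductionOn with | _ l
  induction t using Quotient.inductionOn with | _ k
  obtain ⟨k', hk', hsub⟩ := h
  obtain ⟨l', hl', rfl⟩ := List.sublist_map_iff.1 hsub
  exact ⟨l', coe_le.2 hl'.subperm, Quot.sound hk'⟩

/-- If a multiset of integers at least `2` has sum `18` and an odd number of terms, not all even,
then it has a sub-multiset with sum `3`, `4`, `5` or `9`. -/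
theorem exists_le_sum_mem_of_sum_eq_eighteen {m : Multiset ℕ} (two_le : ∀ n ∈ m, 2 ≤ n)
    (sum_eq : m.sum = 18) (odd_card : Odd m.card) (exists_odd : ∃ n ∈ m, Odd n) :
    ∃ t ≤ m, t.sum = 3 ∨ t.sum = 4 ∨ t.sum = 5 ∨ t.sum = 9 := by
  by_contra! H
  have ne_of_mem (n : ℕ) (hn : n ∈ m) : n ≠ 3 ∧ n ≠ 4 ∧ n ≠ 5 ∧ n ≠ 9 := by
    simpa using H {n} (singleton_le.2 hn)
  obtain ⟨a, ha, a_odd⟩ := exists_odd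
  obtain ⟨m, rfl⟩ := exists_cons_of_mem ha
  obtain ⟨b, hb, b_odd⟩ : ∃ b ∈ m, Odd b := by
    by_contra! h
    have : 2 ∣ m.sum := dvd_sum fun n hn ↦ (Nat.not_odd_iff_even.1 (h n hn)).two_dvd
    rw [sum_cons] at sum_eq
    grind
  obtain ⟨m, rfl⟩ := exists_cons_of_mem hb
  have a_ne := ne_of_mem a (by simp)
  have b_ne := ne_of_mem b (by simp)
  have a_ge := two_le a (by simp)
  have b_ge := two_le b (by simp)
  simp only [sum_cons, card_cons] at sum_eq odd_card
  have m_ne : m ≠ 0 := by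
    rintro rfl
    simp at odd_card
    grind
  obtain ⟨c, hc⟩ := exists_mem_of_ne_zero m_ne
  obtain ⟨m, rfl⟩ := exists_cons_of_mem hc
  have c_ne := ne_of_mem c (by simp)
  have c_ge := two_le c (by simp)
  simp only [sum_cons, card_cons] at sum_eq odd_card
  have sum_eq_two : c = 2 ∧ m.sum = 2 := by grind
  have m_ne : m ≠ 0 := by
    rintro rfl
    simp at sum_eq_two
  obtain ⟨d, hd⟩ := exists_mem_of_ne_zero m_ne
  obtain ⟨m, rfl⟩ := exists_cons_of_mem hd
  have d_ge := two_le d (by simp)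
  rw [sum_cons] at sum_eq_two
  refine (H {c, d} ?_).2.1 ?_
  · refine le_trans ?_ ((le_cons_self _ b).trans (le_cons_self _ a))
    exact cons_le_cons _ (singleton_le.2 (mem_cons_self _ _))
  · simp only [insert_eq_cons, sum_cons, sum_singleton]
    omega

end Multiset

namespace Equiv.Perm

variable {α : Type*} [DecidableEq α]

theorem smul_finset_eq_self_iff {g : Perm α} {s : Finset α} :
    g • s = s ↔ ∀ x, g x ∈ s ↔ x ∈ s := by
  rw [eq_comm, Finset.ext_iff, g.surjective.forall]
  refine forall_congr' fun x ↦ ?_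
  rw [← Perm.smul_def, Finset.smul_mem_smul_finset_iff]

variable [Fintype α]

theorem smul_finset_eq_compl_iff_s16 {g : Perm α} {s : Finset α} :
    g • s = sᶜ ↔ ∀ x, g x ∈ s ↔ x ∉ s := by
  rw [eq_comm, Finset.ext_iff, g.surjective.forall]
  refine forall_congr' fun x ↦ ?_
  rw [← Perm.smul_def, Finset.smul_mem_smul_finset_iff, Finset.mem_compl]
  tauto

theorem exists_smul_finset_eq_self_of_le_cycleType {g : Perm α} {t : Multiset ℕ}
    (h : t ≤ g.cycleType) : ∃ s : Finset α, s.card = t.sum ∧ g • s = s := by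
  obtain ⟨u, hu, rfl⟩ := Multiset.exists_le_map_eq_of_le_map h
  let c : Finset (Perm α) := ⟨u, Multiset.nodup_of_le hu g.cycleFactorsFinset.nodup⟩
  have hc : c ⊆ g.cycleFactorsFinset := Finset.val_le_iff.1 hu
  refine ⟨c.biUnion support, ?_, ?_⟩
  · rw [Finset.card_biUnion]
    · rfl
    · exact fun x hx y hy hxy ↦ disjoint_iff_disjoint_support.1
        (g.cycleFactorsFinset_pairwise_disjoint (hc hx) (hc hy) hxy)
  · rw [smul_finset_eq_self_iff]
    intro x
    simp only [Finset.mem_biUnion]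
    exact exists_congr fun p ↦ and_congr_right fun hp ↦ mem_cycleFactorsFinset_support (hc hp) x

theorem even_of_zpow_apply_eq_self_s16 {g : Perm α} (support_eq : g.support = Finset.univ)
    (even : ∀ n ∈ g.cycleType, Even n) {x : α} {k : ℤ} (h : (g ^ k) x = x) : Even k := by
  have hx : x ∈ g.support := support_eq ▸ Finset.mem_univ x
  rw [(g.isCycleOn_support_cycleOf x).zpow_apply_eq (mem_support_cycleOf_iff.2 ⟨.rfl, hx⟩)] at h
  have := even _ (Multiset.mem_map_of_mem _ (cycleOf_mem_cycleFactorsFinset_iff.2 hx))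
  exact ((Int.even_coe_nat _).2 this).trans_dvd h

theorem exists_smul_finset_eq_compl_s16 {g : Perm α} (support_eq : g.support = Finset.univ)
    (even : ∀ n ∈ g.cycleType, Even n) : ∃ s : Finset α, g • s = sᶜ := by
  classical
  let r (x : α) : α := (Quotient.mk (SameCycle.setoid g) x).out
  have sameCycle_r (x : α) : g.SameCycle (r x) x :=
    Quotient.exact (s := SameCycle.setoid g) (Quotient.out_eq _)
  have r_apply (x : α) : r (g x) = r x :=
    congrArg Quotient.out (Quotient.sound (s := SameCycle.setoid g) (sameCycle_apply_left.2 .rfl))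
  refine ⟨Finset.univ.filter fun x ↦ ∃ k : ℤ, Even k ∧ (g ^ k) (r x) = x,
    smul_finset_eq_compl_iff_s16.2 fun x ↦ ?_⟩
  simp only [Finset.mem_filter_univ, r_apply]
  constructor
  · rintro ⟨j, hj, hjx⟩ ⟨k, hk, hkx⟩
    have : (g ^ (-j + (1 + k))) (r x) = r x := by
      rw [zpow_add, zpow_add, mul_apply, mul_apply, hkx, zpow_one, zpow_neg, inv_eq_iff_eq, hjx]
    have := even_of_zpow_apply_eq_self_s16 support_eq even this
    grind
  · intro h
    obtain ⟨k, hk⟩ := sameCycle_r x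
    refine ⟨1 + k, ?_, by rw [zpow_add, mul_apply, hk, zpow_one]⟩
    have : ¬ Even k := fun hk' ↦ h ⟨k, hk', hk⟩
    grind

end Equiv.Perm

/-- Every permutation of `Fin 18` is even, or stabilizes a subset of size `1`, `3`, `4`
or `5` (notably size `2` is not needed), or stabilizes a partition of `Fin 18` into two
blocks of size `9`. -/
theorem S18_cover (g : Equiv.Perm (Fin 18)) :
    g ∈ alternatingGroup (Fin 18) ∨
    (∃ s : Finset (Fin 18), s.card ∈ ({1, 3, 4, 5} : Set ℕ) ∧ g • s = s) ∨
    (∃ s : Finset (Fin 18), s.card = 9 ∧ (g • s = s ∨ g • s = sᶜ)) := by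
  by_cases support_eq : g.support = Finset.univ
  swap
  · obtain ⟨x, hx⟩ : ∃ x, g x = x := by
      simpa [Finset.eq_univ_iff_forall] using support_eq
    exact .inr (.inl ⟨{x}, by simp, by simp [hx]⟩)
  by_cases even : ∀ n ∈ g.cycleType, Even n
  · obtain ⟨s, hs⟩ := Equiv.Perm.exists_smul_finset_eq_compl_s16 support_eq even
    have := congrArg Finset.card hs
    rw [Finset.card_smul_finset, Finset.card_compl, Fintype.card_fin] at this
    exact .inr (.inr ⟨s, by omega, .inr hs⟩)
  refine or_iff_not_imp_left.2 fun not_mem ↦ ?_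
  have sum_eq : g.cycleType.sum = 18 := by simp [g.sum_cycleType, support_eq]
  have odd_card : Odd g.cycleType.card := by
    rw [← Nat.not_even_iff_odd]
    intro h
    rw [Equiv.Perm.mem_alternatingGroup, g.sign_of_cycleType, sum_eq] at not_mem
    exact not_mem (Even.neg_one_pow (Even.add (by decide) h))
  obtain ⟨t, ht, sum_t⟩ := Multiset.exists_le_sum_mem_of_sum_eq_eighteen
    (fun _ ↦ Equiv.Perm.two_le_of_mem_cycleType) sum_eq odd_card (by simpa using even)
  obtain ⟨s, card_s, hs⟩ := Equiv.Perm.exists_smul_finset_eq_self_of_le_cycleType ht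
  rw [← card_s] at sum_t
  rcases sum_t with h | h | h | h
  · exact .inl ⟨s, by simp [h], hs⟩
  · exact .inl ⟨s, by simp [h], hs⟩
  · exact .inl ⟨s, by simp [h], hs⟩
  · exact .inr ⟨s, h, .inl hs⟩
end
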